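/- Let n ≥ 2, let f : Sⁿ → (0,∞) be a smooth function on the unit sphere Sⁿ ⊂ ℝⁿ⁺¹, and let A = {x ∈ ℝⁿ⁺¹ : x ≠ 0 and ‖x‖ ≥ f(x/‖x‖)}, with open interior A° = {x ∈ ℝⁿ⁺¹ : x ≠ 0 and ‖x‖ > f(x/‖x‖)}. Let Ω ⊂ ℝⁿ⁺¹ be a bounded open set with Ω ⊆ A and such that 0 does not belong to the closure of the convex hull of Ω. Let W : ℝⁿ⁺¹ → ℝⁿ⁺¹ be C² and let q : ℝⁿ⁺¹ → ℂ be bounded and measurable. Then there exist C > 0 and h₀ > 0 such that for all h ∈ (0, h₀] and all w ∈ C_c^∞(Ω; ℂ): h·‖w‖_{L²(Ω)} ≤ C·‖L_{φ,W,q} w‖_{H⁻¹_h(A°)}. -/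

import Mathlib

open MeasureTheory Complex Set

noncomputable section

/-- Euclidean space `ℝ^d`. -/
abbrev Euc (d : ℕ) := EuclideanSpace ℝ (Fin d)

/-- Partial derivative in the `j`-th coordinate direction. -/
def pd {d : ℕ} {F : Type*} [NormedAddCommGroup F] [NormedSpace ℝ F]
    (j : Fin d) (u : Euc d → F) : Euc d → F :=
  fun x => fderiv ℝ u x (EuclideanSpace.single j 1)

/-- The magnetic Schrödinger operator
`L_{W,q} u = -Δu - 2i⟨W,∇u⟩ - i (div W) u + (‖W‖² + q) u`. -/
def magSchrodinger {d : ℕ} (W : Euc d → Euc d) (q : Euc d → ℂ) (u : Euc d → ℂ) :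
    Euc d → ℂ :=
  fun x =>
    -(∑ j, pd j (pd j u) x)
    - 2 * Complex.I * ∑ j, ((W x j : ℝ) : ℂ) * pd j u x
    - Complex.I * (((∑ j, pd j (fun y => W y j) x) : ℝ) : ℂ) * u x
    + ((((‖W x‖ ^ 2 : ℝ)) : ℂ) + q x) * u x

/-- The logarithmic limiting Carleman weight `φ(x) = log ‖x‖`. -/
def carlWeight {d : ℕ} (x : Euc d) : ℝ := Real.log ‖x‖

/-- The conjugated operator `L_{φ,W,q} w = h² e^{φ/h} L_{W,q}(e^{-φ/h} w)`. -/
def conjOp {d : ℕ} (h : ℝ) (W : Euc d → Euc d) (q : Euc d → ℂ) (w : Euc d → ℂ) :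
    Euc d → ℂ :=
  fun x =>
    ((h : ℂ) ^ 2) * Complex.exp (((carlWeight x / h : ℝ) : ℂ)) *
      magSchrodinger W q
        (fun y => Complex.exp (((-(carlWeight y / h) : ℝ) : ℂ)) * w y) x

/-- The conjugated operator `L_{φ,W,q,ε} w = h² e^{φ/h + φ²/(2ε)} L_{W,q}(e^{-φ/h - φ²/(2ε)} w)`. -/
def conjOpEps {d : ℕ} (h ε : ℝ) (W : Euc d → Euc d) (q : Euc d → ℂ) (w : Euc d → ℂ) :
    Euc d → ℂ :=
  fun x =>
    ((h : ℂ) ^ 2) *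
      Complex.exp (((carlWeight x / h + (carlWeight x) ^ 2 / (2 * ε) : ℝ) : ℂ)) *
      magSchrodinger W q
        (fun y =>
          Complex.exp (((-(carlWeight y / h + (carlWeight y) ^ 2 / (2 * ε)) : ℝ) : ℂ)) * w y) x

/-- `w ∈ C_c^∞(U; ℂ)`. -/
def IsTest {d : ℕ} (U : Set (Euc d)) (w : Euc d → ℂ) : Prop :=
  ContDiff ℝ (⊤ : ℕ∞) w ∧ HasCompactSupport w ∧ tsupport w ⊆ U

/-- The `L²` norm on a set. -/
def L2normOn {d : ℕ} (U : Set (Euc d)) (w : Euc d → ℂ) : ℝ :=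
  Real.sqrt (∫ x in U, ‖w x‖ ^ 2)

/-- The semiclassical `H¹` norm on an open set. -/
def H1norm {d : ℕ} (h : ℝ) (U : Set (Euc d)) (ψ : Euc d → ℂ) : ℝ :=
  Real.sqrt ((∫ x in U, ‖ψ x‖ ^ 2) + h ^ 2 * ∫ x in U, ∑ j, ‖pd j ψ x‖ ^ 2)

/-- The semiclassical `H⁻¹` norm on an open set, defined by duality against
smooth compactly supported test functions. -/
def Hneg1norm {d : ℕ} (h : ℝ) (U : Set (Euc d)) (v : Euc d → ℂ) : ℝ :=
  sSup {r : ℝ | ∃ ψ : Euc d → ℂ, IsTest U ψ ∧ H1norm h U ψ ≤ 1 ∧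
    r = ‖∫ x in U, v x * (starRingEnd ℂ) (ψ x)‖}

open Filter Topology

section Calculus

variable {d : ℕ} {F : Type*} [NormedAddCommGroup F] [NormedSpace ℝ F]

/-- The Euler (radial) derivative `x ↦ ∑ j, x j ∂_j u x`. -/
def euler (u : Euc d → F) : Euc d → F := fun x => fderiv ℝ u x x

/-- The Laplacian. -/
def lap (u : Euc d → F) : Euc d → F := fun x => ∑ j, pd j (pd j u) x

/-- The squared norm of the gradient. -/
def gradSq (u : Euc d → F) : Euc d → ℝ := fun x => ∑ j, ‖pd j u x‖ ^ 2

theorem ContDiff.pd {u : Euc d → F} (hu : ContDiff ℝ (⊤ : ℕ∞) u) (j : Fin d) :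
    ContDiff ℝ (⊤ : ℕ∞) (pd j u) :=
  (hu.fderiv_right (m := (⊤ : ℕ∞)) (by simp)).clm_apply contDiff_const

theorem ContDiff.euler {u : Euc d → F} (hu : ContDiff ℝ (⊤ : ℕ∞) u) :
    ContDiff ℝ (⊤ : ℕ∞) (euler u) :=
  (hu.fderiv_right (m := (⊤ : ℕ∞)) (by simp)).clm_apply contDiff_id

theorem ContDiff.lap {u : Euc d → F} (hu : ContDiff ℝ (⊤ : ℕ∞) u) :
    ContDiff ℝ (⊤ : ℕ∞) (lap u) :=
  ContDiff.sum fun j _ => (hu.pd j).pd j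

theorem ContDiff.differentiableAt_top {u : Euc d → F} (hu : ContDiff ℝ (⊤ : ℕ∞) u) (x : Euc d) :
    DifferentiableAt ℝ u x :=
  (hu.differentiable (by simp)) x

theorem continuous_gradSq {u : Euc d → F} (hu : ContDiff ℝ (⊤ : ℕ∞) u) :
    Continuous (gradSq u) :=
  continuous_finsetSum _ fun j _ => ((hu.pd j).continuous.norm).pow 2

theorem gradSq_nonneg (u : Euc d → F) (x : Euc d) : 0 ≤ gradSq u x :=
  Finset.sum_nonneg fun _ _ => sq_nonneg _

theorem norm_pd_le_sqrt_gradSq (u : Euc d → F) (j : Fin d) (x : Euc d) :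
    ‖pd j u x‖ ≤ Real.sqrt (gradSq u x) :=
  Real.le_sqrt_of_sq_le
    (Finset.single_le_sum (f := fun i => ‖pd i u x‖ ^ 2) (fun _ _ => sq_nonneg _)
      (Finset.mem_univ j))

theorem sum_single_smul (y : Euc d) : ∑ j, y j • EuclideanSpace.single j (1 : ℝ) = y := by
  ext i
  simp [Finset.sum_apply, Pi.single_apply]

theorem fderiv_apply_eq_sum_pd (u : Euc d → F) (x y : Euc d) :
    fderiv ℝ u x y = ∑ j, y j • pd j u x := by
  conv_lhs => rw [← sum_single_smul y]
  simp [pd, map_sum]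

theorem euler_eq_sum (u : Euc d → F) (x : Euc d) : euler u x = ∑ j, x j • pd j u x :=
  fderiv_apply_eq_sum_pd u x x

theorem Filter.EventuallyEq.pd_eq {u v : Euc d → F} {x : Euc d} (h : u =ᶠ[𝓝 x] v) (j : Fin d) :
    pd j u x = pd j v x := by
  simp [pd, h.fderiv_eq]

theorem Filter.EventuallyEq.pd {u v : Euc d → F} {x : Euc d} (h : u =ᶠ[𝓝 x] v) (j : Fin d) :
    pd j u =ᶠ[𝓝 x] pd j v :=
  h.eventuallyEq_nhds.mono fun _ hy => hy.pd_eq j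

theorem Filter.EventuallyEq.euler_eq {u v : Euc d → F} {x : Euc d} (h : u =ᶠ[𝓝 x] v) :
    euler u x = euler v x := by
  simp [euler, h.fderiv_eq]

theorem pd_zero (j : Fin d) (x : Euc d) : pd j (0 : Euc d → F) x = 0 := by
  simp [pd]

theorem pd_eq_zero_of_notMem_tsupport {u : Euc d → F} {x : Euc d} (hx : x ∉ tsupport u)
    (j : Fin d) : pd j u x = 0 := by
  rw [(notMem_tsupport_iff_eventuallyEq.1 hx).pd_eq j, pd_zero]

theorem tsupport_pd_subset (u : Euc d → F) (j : Fin d) : tsupport (pd j u) ⊆ tsupport u :=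
  closure_minimal (fun x hx => by
    by_contra h
    exact hx (pd_eq_zero_of_notMem_tsupport h j)) (isClosed_tsupport u)

theorem gradSq_eq_zero_of_notMem_tsupport {u : Euc d → F} {x : Euc d} (hx : x ∉ tsupport u) :
    gradSq u x = 0 :=
  Finset.sum_eq_zero fun j _ => by simp [pd_eq_zero_of_notMem_tsupport hx j]

theorem euler_eq_zero_of_notMem_tsupport {u : Euc d → F} {x : Euc d} (hx : x ∉ tsupport u) :
    euler u x = 0 := by
  simp [euler_eq_sum, pd_eq_zero_of_notMem_tsupport hx]

theorem lap_eq_zero_of_notMem_tsupport {u : Euc d → F} {x : Euc d} (hx : x ∉ tsupport u) :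
    lap u x = 0 :=
  Finset.sum_eq_zero fun j _ =>
    pd_eq_zero_of_notMem_tsupport (fun h => hx (tsupport_pd_subset u j h)) j

theorem pd_add {u v : Euc d → F} {x : Euc d} (hu : DifferentiableAt ℝ u x)
    (hv : DifferentiableAt ℝ v x) (j : Fin d) :
    pd j (fun y => u y + v y) x = pd j u x + pd j v x := by
  simp [pd, fderiv_fun_add hu hv]

theorem pd_sub {u v : Euc d → F} {x : Euc d} (hu : DifferentiableAt ℝ u x)
    (hv : DifferentiableAt ℝ v x) (j : Fin d) :
    pd j (fun y => u y - v y) x = pd j u x - pd j v x := by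
  simp [pd, fderiv_fun_sub hu hv]

theorem pd_const_smul {u : Euc d → F} {x : Euc d} (hu : DifferentiableAt ℝ u x) (c : ℝ)
    (j : Fin d) : pd j (fun y => c • u y) x = c • pd j u x := by
  simp [pd, fderiv_fun_const_smul hu c]

theorem pd_smul {b : Euc d → ℝ} {u : Euc d → F} {x : Euc d} (hb : DifferentiableAt ℝ b x)
    (hu : DifferentiableAt ℝ u x) (j : Fin d) :
    pd j (fun y => b y • u y) x = b x • pd j u x + pd j b x • u x := by
  simp [pd, fderiv_fun_smul hb hu]

theorem euler_sub {u v : Euc d → F} {x : Euc d} (hu : DifferentiableAt ℝ u x)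
    (hv : DifferentiableAt ℝ v x) :
    euler (fun y => u y - v y) x = euler u x - euler v x := by
  simp [euler, fderiv_fun_sub hu hv]

theorem lap_sub {u v : Euc d → F} (hu : ContDiff ℝ (⊤ : ℕ∞) u)
    (hv : ContDiff ℝ (⊤ : ℕ∞) v) (x : Euc d) :
    lap (fun y => u y - v y) x = lap u x - lap v x := by
  unfold lap
  rw [← Finset.sum_sub_distrib]
  refine Finset.sum_congr rfl fun j _ => ?_
  have : pd j (fun y => u y - v y) = fun y => pd j u y - pd j v y :=
    funext fun y => pd_sub (hu.differentiableAt_top y) (hv.differentiableAt_top y) j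
  rw [this, pd_sub ((hu.pd j).differentiableAt_top x) ((hv.pd j).differentiableAt_top x)]

theorem lap_smul {b : Euc d → ℝ} {u : Euc d → F} (hb : ContDiff ℝ (⊤ : ℕ∞) b)
    (hu : ContDiff ℝ (⊤ : ℕ∞) u) (x : Euc d) :
    lap (fun y => b y • u y) x =
      b x • lap u x + (2 : ℝ) • ∑ j, pd j b x • pd j u x + lap b x • u x := by
  have key : ∀ j, pd j (pd j fun y => b y • u y) x =
      b x • pd j (pd j u) x + (2 : ℝ) • (pd j b x • pd j u x) + pd j (pd j b) x • u x := by
    intro j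
    have : pd j (fun y => b y • u y) = fun y => b y • pd j u y + pd j b y • u y :=
      funext fun y => pd_smul (hb.differentiableAt_top y) (hu.differentiableAt_top y) j
    rw [this, pd_add, pd_smul (hb.differentiableAt_top x) ((hu.pd j).differentiableAt_top x),
      pd_smul ((hb.pd j).differentiableAt_top x) (hu.differentiableAt_top x), two_smul]
    · abel
    · exact (hb.differentiableAt_top x).smul ((hu.pd j).differentiableAt_top x)
    · exact ((hb.pd j).differentiableAt_top x).smul (hu.differentiableAt_top x)
  simp only [lap, key, Finset.sum_add_distrib, Finset.smul_sum, Finset.sum_smul]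

theorem norm_sq_euler_le (u : Euc d → F) (x : Euc d) :
    ‖euler u x‖ ^ 2 ≤ ‖x‖ ^ 2 * gradSq u x := by
  have h1 : ‖euler u x‖ ≤ ∑ j, ‖x j‖ * ‖pd j u x‖ := by
    rw [euler_eq_sum]
    exact (norm_sum_le _ _).trans (Finset.sum_le_sum fun j _ => (norm_smul _ _).le)
  calc ‖euler u x‖ ^ 2 ≤ (∑ j, ‖x j‖ * ‖pd j u x‖) ^ 2 := by gcongr
    _ ≤ (∑ j, ‖x j‖ ^ 2) * ∑ j, ‖pd j u x‖ ^ 2 := Finset.sum_mul_sq_le_sq_mul_sq _ _ _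
    _ = _ := by rw [EuclideanSpace.norm_sq_eq, gradSq]

theorem integral_pd_eq_zero {f : Euc d → ℝ} (hf : ContDiff ℝ (⊤ : ℕ∞) f)
    (hc : HasCompactSupport f) (j : Fin d) : ∫ x, pd j f x = 0 := by
  have h := integral_bilinear_hasLineDerivAt_right_eq_neg_left_of_integrable
    (μ := (volume : Measure (Euc d)))
    (f := fun _ => (1 : ℝ)) (f' := fun _ => (0 : ℝ)) (g := f) (g' := pd j f)
    (v := EuclideanSpace.single j 1) (B := ContinuousLinearMap.mul ℝ ℝ)
    (by simp)
    (by
      simp only [ContinuousLinearMap.mul_apply', one_mul]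
      exact (hf.pd j).continuous.integrable_of_hasCompactSupport
        (hc.mono' ((subset_tsupport _).trans (tsupport_pd_subset f j))))
    (by
      simp only [ContinuousLinearMap.mul_apply', one_mul]
      exact hf.continuous.integrable_of_hasCompactSupport hc)
    (fun x _ => by simpa using (hasFDerivAt_const (1 : ℝ) x).hasLineDerivAt _)
    (fun x _ => (hf.differentiableAt_top x).hasFDerivAt.hasLineDerivAt _)
  simpa using h

end Calculus

section InnerCalculus

variable {d : ℕ} {F : Type*} [NormedAddCommGroup F] [InnerProductSpace ℝ F]

/-- The pointwise real inner product of two gradients. -/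
def gradInner (u v : Euc d → F) : Euc d → ℝ := fun x => ∑ j, inner ℝ (pd j u x) (pd j v x)

theorem pd_inner {u v : Euc d → F} {x : Euc d} (hu : DifferentiableAt ℝ u x)
    (hv : DifferentiableAt ℝ v x) (j : Fin d) :
    pd j (fun y => inner ℝ (u y) (v y)) x =
      inner ℝ (u x) (pd j v x) + inner ℝ (pd j u x) (v x) :=
  fderiv_inner_apply ℝ hu hv _

theorem gradInner_self (u : Euc d → F) (x : Euc d) : gradInner u u x = gradSq u x := by
  simp [gradInner, gradSq]

theorem continuous_gradInner {u v : Euc d → F} (hu : ContDiff ℝ (⊤ : ℕ∞) u)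
    (hv : ContDiff ℝ (⊤ : ℕ∞) v) : Continuous (gradInner u v) :=
  continuous_finsetSum _ fun j _ => (hu.pd j).continuous.inner (hv.pd j).continuous

end InnerCalculus

section LogRadius

variable {d : ℕ} {F : Type*} [NormedAddCommGroup F] [InnerProductSpace ℝ F]

/-- A globally smooth function which agrees with `log ‖x‖` for `‖x‖ > c`. -/
structure IsLogRadius (c : ℝ) (s : Euc d → ℝ) : Prop where
  pos : 0 < c
  smooth : ContDiff ℝ (⊤ : ℕ∞) s
  eq_log : ∀ x, c < ‖x‖ → s x = Real.log ‖x‖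

/-- Smooth compactly supported functions whose support avoids the closed ball of radius `c`. -/
structure IsTestOff (c : ℝ) (v : Euc d → F) : Prop where
  smooth : ContDiff ℝ (⊤ : ℕ∞) v
  compact : HasCompactSupport v
  supp : ∀ x ∈ tsupport v, c < ‖x‖

/-- The density `‖x‖⁻ᵈ` of the dilation invariant measure, written through `s = log ‖x‖`. -/
def invDensity (s : Euc d → ℝ) : Euc d → ℝ := fun x => Real.exp (-(d : ℝ) * s x)

theorem invDensity_pos (s : Euc d → ℝ) (x : Euc d) : 0 < invDensity s x := Real.exp_pos _

theorem pd_exp {g : Euc d → ℝ} {x : Euc d} (hg : DifferentiableAt ℝ g x) (j : Fin d) :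
    pd j (fun y => Real.exp (g y)) x = Real.exp (g x) * pd j g x := by
  simp [pd, fderiv_exp hg]

theorem pd_mul_real {f g : Euc d → ℝ} {x : Euc d} (hf : DifferentiableAt ℝ f x)
    (hg : DifferentiableAt ℝ g x) (j : Fin d) :
    pd j (fun y => f y * g y) x = f x * pd j g x + pd j f x * g x := by
  simpa using pd_smul hf hg j

theorem pd_coord (i j : Fin d) (x : Euc d) :
    pd j (fun y : Euc d => y i) x = if i = j then 1 else 0 := by
  have : (fun y : Euc d => y i) = (EuclideanSpace.proj i : Euc d →L[ℝ] ℝ) := by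
    ext; simp
  rw [this, pd, ContinuousLinearMap.fderiv]
  simp

theorem contDiff_coord (i : Fin d) : ContDiff ℝ (⊤ : ℕ∞) (fun y : Euc d => y i) :=
  (EuclideanSpace.proj i : Euc d →L[ℝ] ℝ).contDiff

theorem pd_norm_sq (j : Fin d) (x : Euc d) :
    pd j (fun y : Euc d => ‖y‖ ^ 2) x = 2 * x j := by
  rw [pd, (hasStrictFDerivAt_norm_sq x).hasFDerivAt.fderiv]
  simp [EuclideanSpace.inner_single_right]

namespace IsLogRadius

variable {c : ℝ} {s : Euc d → ℝ} {x : Euc d}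

theorem eventually_lt (hx : c < ‖x‖) : ∀ᶠ y in 𝓝 x, c < ‖y‖ :=
  continuous_norm.continuousAt.eventually_const_lt hx

theorem contDiff_invDensity (hs : IsLogRadius c s) : ContDiff ℝ (⊤ : ℕ∞) (invDensity s) :=
  Real.contDiff_exp.comp (contDiff_const.mul hs.smooth)

theorem pd_eq (hs : IsLogRadius c s) (hx : c < ‖x‖) (j : Fin d) :
    pd j s x = x j / ‖x‖ ^ 2 := by
  have h0 : ‖x‖ ≠ 0 := (hs.pos.trans hx).ne'
  have h1 : s =ᶠ[𝓝 x] fun y => (1 / 2 : ℝ) • Real.log (‖y‖ ^ 2) :=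
    (eventually_lt hx).mono fun y hy => by
      simp [hs.eq_log y hy, Real.log_pow]
  have h2 := (hasStrictFDerivAt_norm_sq x).hasFDerivAt
  rw [h1.pd_eq j, pd_const_smul, pd, fderiv.log h2.differentiableAt (by positivity), h2.fderiv]
  · simp [EuclideanSpace.inner_single_right]
    field_simp
  · exact h2.differentiableAt.log (by positivity)

theorem pd_mul_norm_sq (hs : IsLogRadius c s) (hx : c < ‖x‖) (j : Fin d) :
    ‖x‖ ^ 2 * pd j s x = x j := by
  have h0 : ‖x‖ ≠ 0 := (hs.pos.trans hx).ne'
  rw [hs.pd_eq hx]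
  field_simp

theorem euler_eq (hs : IsLogRadius c s) (hx : c < ‖x‖) : euler s x = 1 := by
  have h0 : ‖x‖ ≠ 0 := (hs.pos.trans hx).ne'
  simp only [euler_eq_sum, hs.pd_eq hx, smul_eq_mul]
  have : ∀ j, x j * (x j / ‖x‖ ^ 2) = ‖x j‖ ^ 2 / ‖x‖ ^ 2 := fun j => by
    rw [Real.norm_eq_abs, sq_abs]; ring
  simp only [this, ← Finset.sum_div, ← EuclideanSpace.norm_sq_eq]
  field_simp

theorem sum_pd_smul (hs : IsLogRadius c s) (hx : c < ‖x‖) (u : Euc d → F) :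
    ‖x‖ ^ 2 • ∑ j, pd j s x • pd j u x = euler u x := by
  rw [euler_eq_sum, Finset.smul_sum]
  exact Finset.sum_congr rfl fun j _ => by rw [smul_smul, hs.pd_mul_norm_sq hx]

theorem sum_pd_sq (hs : IsLogRadius c s) (hx : c < ‖x‖) :
    ‖x‖ ^ 2 * ∑ j, pd j s x * pd j s x = 1 := by
  simpa [hs.euler_eq hx] using hs.sum_pd_smul hx s

theorem lap_eq (hs : IsLogRadius c s) (hx : c < ‖x‖) :
    ‖x‖ ^ 2 * lap s x = (d : ℝ) - 2 := by
  have h0 : ‖x‖ ≠ 0 := (hs.pos.trans hx).ne'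
  have key : ∀ j, ‖x‖ ^ 2 * pd j (pd j s) x = 1 - 2 * (x j * pd j s x) := by
    intro j
    have h1 : (fun y => ‖y‖ ^ 2 * pd j s y) =ᶠ[𝓝 x] fun y => y j :=
      (eventually_lt hx).mono fun y hy => hs.pd_mul_norm_sq hy j
    have h2 := h1.pd_eq j
    rw [pd_mul_real (hasStrictFDerivAt_norm_sq x).hasFDerivAt.differentiableAt
      ((hs.smooth.pd j).differentiableAt_top x), pd_norm_sq, pd_coord, if_pos rfl] at h2
    linarith
  have h3 := hs.euler_eq hx
  simp only [euler_eq_sum, smul_eq_mul] at h3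
  rw [lap, Finset.mul_sum, Finset.sum_congr rfl fun j _ => key j, Finset.sum_sub_distrib,
    ← Finset.mul_sum, h3]
  simp

theorem pd_invDensity (hs : IsLogRadius c s) (j : Fin d) (x : Euc d) :
    pd j (invDensity s) x = invDensity s x * (-(d : ℝ) * pd j s x) := by
  have h := hs.smooth.differentiableAt_top x
  unfold invDensity
  rw [pd_exp (h.const_mul _)]
  congr 1
  exact pd_const_smul h (-(d : ℝ)) j

theorem integral_invDensity_euler (hs : IsLogRadius c s) {f : Euc d → ℝ} (hf : IsTestOff c f) :
    ∫ x, invDensity s x * euler f x = 0 := by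
  have hJ := hs.contDiff_invDensity
  have hsm : ∀ j : Fin d, ContDiff ℝ (⊤ : ℕ∞) (fun y : Euc d => (y j * invDensity s y) * f y) :=
    fun j => ((contDiff_coord j).mul hJ).mul hf.smooth
  have hcs : ∀ j : Fin d, HasCompactSupport (fun y : Euc d => (y j * invDensity s y) * f y) :=
    fun j => hf.compact.mul_left
  have h1 : ∀ x, invDensity s x * euler f x =
      ∑ j, pd j (fun y : Euc d => (y j * invDensity s y) * f y) x := by
    intro x
    have hxj : ∀ j, pd j (fun y : Euc d => (y j * invDensity s y) * f y) x =
        invDensity s x * (x j * pd j f x) + f x * invDensity s x * (1 - d * (x j * pd j s x)) := by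
      intro j
      rw [pd_mul_real (((contDiff_coord j).mul hJ).differentiableAt_top x)
        (hf.smooth.differentiableAt_top x),
        pd_mul_real ((contDiff_coord j).differentiableAt_top x) (hJ.differentiableAt_top x),
        pd_coord, if_pos rfl, hs.pd_invDensity]
      ring
    simp only [hxj, Finset.sum_add_distrib, ← Finset.mul_sum, Finset.sum_sub_distrib]
    by_cases hx : x ∈ tsupport f
    · have h3 := hs.euler_eq (hf.supp x hx)
      simp only [euler_eq_sum, smul_eq_mul] at h3 ⊢
      rw [h3]
      simp
    · rw [image_eq_zero_of_notMem_tsupport hx, euler_eq_sum]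
      simp
  simp_rw [h1]
  rw [integral_finsetSum]
  · exact Finset.sum_eq_zero fun j _ => integral_pd_eq_zero (hsm j) (hcs j) j
  · intro j _
    exact ((hsm j).pd j).continuous.integrable_of_hasCompactSupport
      ((hcs j).mono' ((subset_tsupport _).trans (tsupport_pd_subset _ j)))

theorem integral_gradInner (hs : IsLogRadius c s) {u ψ : Euc d → F}
    (hu : ContDiff ℝ (⊤ : ℕ∞) u) (hψ : IsTestOff c ψ) :
    ∫ x, invDensity s x * (‖x‖ ^ 2 * gradInner u ψ x) =
      -∫ x, invDensity s x *
        inner ℝ (‖x‖ ^ 2 • lap u x + (2 - (d : ℝ)) • euler u x) (ψ x) := by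
  have hJ := hs.contDiff_invDensity
  have hN : ContDiff ℝ (⊤ : ℕ∞) (fun y : Euc d => ‖y‖ ^ 2) := contDiff_norm_sq ℝ
  have hK := hN.mul hJ
  have hsm : ∀ j : Fin d, ContDiff ℝ (⊤ : ℕ∞)
      (fun y : Euc d => (‖y‖ ^ 2 * invDensity s y) * inner ℝ (pd j u y) (ψ y)) :=
    fun j => hK.mul ((hu.pd j).inner ℝ hψ.smooth)
  have hcs : ∀ j : Fin d, HasCompactSupport
      (fun y : Euc d => (‖y‖ ^ 2 * invDensity s y) * inner ℝ (pd j u y) (ψ y)) :=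
    fun j => hψ.compact.mono fun x hx => by
      contrapose! hx
      simp [Function.notMem_support.1 hx]
  have h1 : ∀ x, invDensity s x * (‖x‖ ^ 2 * gradInner u ψ x) +
      invDensity s x * inner ℝ (‖x‖ ^ 2 • lap u x + (2 - (d : ℝ)) • euler u x) (ψ x) =
      ∑ j, pd j (fun y : Euc d =>
        (‖y‖ ^ 2 * invDensity s y) * inner ℝ (pd j u y) (ψ y)) x := by
    intro x
    have hxj : ∀ j, pd j (fun y : Euc d =>
        (‖y‖ ^ 2 * invDensity s y) * inner ℝ (pd j u y) (ψ y)) x =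
        invDensity s x * ‖x‖ ^ 2 * inner ℝ (pd j u x) (pd j ψ x) +
        invDensity s x * ‖x‖ ^ 2 * inner ℝ (pd j (pd j u) x) (ψ x) +
        invDensity s x * ((2 * x j - d * (‖x‖ ^ 2 * pd j s x)) * inner ℝ (pd j u x) (ψ x)) := by
      intro j
      rw [pd_mul_real (hK.differentiableAt_top x)
        (((hu.pd j).inner ℝ hψ.smooth).differentiableAt_top x),
        pd_mul_real (hN.differentiableAt_top x) (hJ.differentiableAt_top x),
        pd_norm_sq, hs.pd_invDensity, pd_inner ((hu.pd j).differentiableAt_top x)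
          (hψ.smooth.differentiableAt_top x)]
      ring
    simp only [hxj, Finset.sum_add_distrib, ← Finset.mul_sum, gradInner, lap, inner_add_left,
      inner_smul_left, sum_inner, euler_eq_sum]
    by_cases hx : x ∈ tsupport ψ
    · simp only [hs.pd_mul_norm_sq (hψ.supp x hx)]
      have : ∀ j, (2 * x j - d * x j) * inner ℝ (pd j u x) (ψ x) =
        (2 - d) * (x j * inner ℝ (pd j u x) (ψ x)) := fun j => by ring
      simp only [this, ← Finset.mul_sum]
      simp
      ring
    · simp [image_eq_zero_of_notMem_tsupport hx, mul_assoc]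
  have hi1 : Integrable fun x => invDensity s x * (‖x‖ ^ 2 * gradInner u ψ x) := by
    refine Continuous.integrable_of_hasCompactSupport ?_ ?_
    · exact hJ.continuous.mul (hN.continuous.mul (continuous_gradInner hu hψ.smooth))
    · refine hψ.compact.mono' fun x hx => ?_
      contrapose! hx
      simp [gradInner, pd_eq_zero_of_notMem_tsupport hx]
  have hi2 : Integrable fun x => invDensity s x *
      inner ℝ (‖x‖ ^ 2 • lap u x + (2 - (d : ℝ)) • euler u x) (ψ x) := by
    refine Continuous.integrable_of_hasCompactSupport ?_ ?_
    · exact hJ.continuous.mul (((hN.continuous.smul hu.lap.continuous).add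
        (hu.euler.continuous.const_smul _)).inner hψ.smooth.continuous)
    · refine hψ.compact.mono' fun x hx => ?_
      contrapose! hx
      simp [image_eq_zero_of_notMem_tsupport hx]
  rw [← add_eq_zero_iff_eq_neg, ← integral_add hi1 hi2]
  simp_rw [h1]
  rw [integral_finsetSum]
  · exact Finset.sum_eq_zero fun j _ => integral_pd_eq_zero (hsm j) (hcs j) j
  · intro j _
    exact ((hsm j).pd j).continuous.integrable_of_hasCompactSupport
      ((hcs j).mono' ((subset_tsupport _).trans (tsupport_pd_subset _ j)))

theorem apply_smul (hs : IsLogRadius c s) {τ : ℝ} (hτ : 0 ≤ τ)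
    (hx : c < ‖Real.exp (-τ) • x‖) : c < ‖x‖ ∧ s x = s (Real.exp (-τ) • x) + τ := by
  have h1 : ‖Real.exp (-τ) • x‖ = Real.exp (-τ) * ‖x‖ := by
    rw [norm_smul, Real.norm_of_nonneg (Real.exp_pos _).le]
  have h2 : Real.exp (-τ) ≤ 1 := Real.exp_le_one_iff.2 (by linarith)
  have h3 : c < ‖x‖ := hx.trans_le (by rw [h1]; nlinarith [norm_nonneg x])
  refine ⟨h3, ?_⟩
  rw [hs.eq_log _ h3, hs.eq_log _ hx, h1,
    Real.log_mul (Real.exp_pos _).ne' (hs.pos.trans h3).ne', Real.log_exp]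
  ring

theorem integral_invDensity_comp_smul (hs : IsLogRadius c s) {τ : ℝ} (hτ : 0 ≤ τ)
    {f : Euc d → ℝ} (hf : ∀ x, f x ≠ 0 → c < ‖x‖) :
    ∫ x, invDensity s x * f (Real.exp (-τ) • x) = ∫ x, invDensity s x * f x := by
  have h1 : ∀ x, invDensity s x * f (Real.exp (-τ) • x) =
      Real.exp (-τ) ^ d * ((fun y => invDensity s y * f y) (Real.exp (-τ) • x)) := by
    intro x
    by_cases h0 : f (Real.exp (-τ) • x) = 0
    · simp [h0]
    · obtain ⟨-, h2⟩ := hs.apply_smul hτ (hf _ h0)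
      simp only [invDensity]
      rw [h2, ← mul_assoc, ← Real.exp_nat_mul, ← Real.exp_add]
      congr 2
      ring
  simp_rw [h1]
  rw [integral_const_mul, Measure.integral_comp_smul_of_nonneg volume
    (fun y => invDensity s y * f y) _ (hR := (Real.exp_pos _).le)]
  rw [finrank_euclideanSpace_fin, smul_eq_mul, ← mul_assoc,
    mul_inv_cancel₀ (pow_ne_zero _ (Real.exp_pos _).ne'), one_mul]

end IsLogRadius

end LogRadius

section Dilation

variable {d : ℕ} {F : Type*} [NormedAddCommGroup F] [InnerProductSpace ℝ F]

/-- The difference quotient along the dilation flow, with supports moving outwards. -/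
def dilQuot (τ : ℝ) (v : Euc d → F) : Euc d → F :=
  fun x => τ⁻¹ • (v x - v (Real.exp (-τ) • x))

namespace IsTestOff

variable {c : ℝ} {v : Euc d → F}

theorem integrable_of_continuous (hv : IsTestOff c v) {g : Euc d → ℝ} (hg : Continuous g)
    (h : ∀ x, x ∉ tsupport v → g x = 0) : Integrable g :=
  hg.integrable_of_hasCompactSupport (hv.compact.mono' fun x hx => by
    by_contra h1
    exact hx (h x h1))

theorem smul {b : Euc d → ℝ} (hb : ContDiff ℝ (⊤ : ℕ∞) b) (hv : IsTestOff c v) :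
    IsTestOff c (fun x => b x • v x) where
  smooth := hb.smul hv.smooth
  compact := hv.compact.smul_left
  supp x hx := hv.supp x (closure_mono (fun y hy => by
    contrapose! hy
    simp [Function.notMem_support.1 hy]) hx)

theorem sub {u : Euc d → F} (hu : IsTestOff c u) (hv : IsTestOff c v) :
    IsTestOff c (fun x => u x - v x) where
  smooth := hu.smooth.sub hv.smooth
  compact := hu.compact.sub hv.compact
  supp x hx := (tsupport_sub u v hx).elim (hu.supp x) (hv.supp x)

theorem add {u : Euc d → F} (hu : IsTestOff c u) (hv : IsTestOff c v) :
    IsTestOff c (fun x => u x + v x) where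
  smooth := hu.smooth.add hv.smooth
  compact := hu.compact.add hv.compact
  supp x hx := (tsupport_add u v hx).elim (hu.supp x) (hv.supp x)

theorem comp_dil (hv : IsTestOff c v) {τ : ℝ} (hτ : 0 ≤ τ) :
    IsTestOff c (fun x => v (Real.exp (-τ) • x)) where
  smooth := hv.smooth.comp (contDiff_const_smul _)
  compact := hv.compact.comp_smul (Real.exp_pos _).ne'
  supp x hx := by
    have h1 : Real.exp (-τ) • x ∈ tsupport v :=
      tsupport_comp_subset_preimage v (continuous_const_smul _) hx
    refine (hv.supp _ h1).trans_le ?_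
    rw [norm_smul, Real.norm_of_nonneg (Real.exp_pos _).le]
    have h2 : Real.exp (-τ) ≤ 1 := Real.exp_le_one_iff.2 (by linarith)
    nlinarith [norm_nonneg x]

theorem dilQuot (hv : IsTestOff c v) {τ : ℝ} (hτ : 0 ≤ τ) : IsTestOff c (dilQuot τ v) :=
  (hv.sub (hv.comp_dil hτ)).smul contDiff_const

end IsTestOff

theorem pd_comp_dil (v : Euc d → F) (a : ℝ) (x : Euc d) (j : Fin d) :
    pd j (fun y => v (a • y)) x = a • pd j v (a • x) := by
  simp [pd, fderiv_comp_smul]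

theorem norm_sq_mul_gradSq_comp_dil (v : Euc d → F) (a : ℝ) (x : Euc d) :
    ‖x‖ ^ 2 * gradSq (fun y => v (a • y)) x = ‖a • x‖ ^ 2 * gradSq v (a • x) := by
  simp only [gradSq, pd_comp_dil, norm_smul, mul_pow, ← Finset.mul_sum]
  ring

namespace IsLogRadius

variable {c : ℝ} {s : Euc d → ℝ}

theorem pd_affine (hs : IsLogRadius c s) (κ : ℝ) (x : Euc d) (j : Fin d) :
    pd j (fun y => 1 + κ * s y) x = κ * pd j s x := by
  have h := hs.smooth.differentiableAt_top x
  rw [pd_add (differentiableAt_const _) (h.const_mul κ)]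
  have := pd_const_smul h κ j
  simp only [smul_eq_mul] at this
  rw [this]
  simp [pd]

theorem gradInner_affine_smul (hs : IsLogRadius c s) (κ : ℝ) {v z : Euc d → F}
    (hv : IsTestOff c v) (hz : ContDiff ℝ (⊤ : ℕ∞) z) (x : Euc d) :
    ‖x‖ ^ 2 * gradInner v (fun y => (1 + κ * s y) • z y) x =
      (1 + κ * s x) * (‖x‖ ^ 2 * gradInner v z x) + κ * inner ℝ (euler v x) (z x) := by
  have hb : ContDiff ℝ (⊤ : ℕ∞) fun y => 1 + κ * s y :=
    contDiff_const.add (contDiff_const.mul hs.smooth)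
  simp only [gradInner, pd_smul (hb.differentiableAt_top x) (hz.differentiableAt_top x),
    hs.pd_affine, inner_add_right, inner_smul_right, Finset.sum_add_distrib, ← Finset.mul_sum]
  by_cases hx : x ∈ tsupport v
  · rw [← hs.sum_pd_smul (hv.supp x hx), inner_smul_left, sum_inner]
    simp only [inner_smul_left, mul_assoc, ← Finset.mul_sum, RCLike.conj_to_real]
    ring
  · simp [pd_eq_zero_of_notMem_tsupport hx, euler_eq_zero_of_notMem_tsupport hx]

theorem pohozaev_le (hs : IsLogRadius c s) {κ τ : ℝ} (hκ : 0 ≤ κ) (hτ : 0 < τ) {v : Euc d → F}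
    (hv : IsTestOff c v) (hb : ∀ x ∈ tsupport v, 0 ≤ 1 + κ * s x) :
    -(κ / 2) * (∫ x, invDensity s x * (‖x‖ ^ 2 * gradSq v x)) +
      κ * (∫ x, invDensity s x * inner ℝ (euler v x) (dilQuot τ v x)) ≤
    ∫ x, invDensity s x * (‖x‖ ^ 2 *
      gradInner v (fun y => (1 + κ * s y) • dilQuot τ v y) x) := by
  have hJ := hs.contDiff_invDensity.continuous
  have hJ0 := invDensity_pos s
  have hq := hv.dilQuot hτ.le
  have hT := hv.comp_dil hτ.le
  have hn : Continuous fun x : Euc d => ‖x‖ ^ 2 := continuous_norm.pow 2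
  have hbc : Continuous fun x => 1 + κ * s x :=
    continuous_const.add (continuous_const.mul hs.smooth.continuous)
  have i1 : Integrable fun x => invDensity s x * inner ℝ (euler v x) (dilQuot τ v x) :=
    hv.integrable_of_continuous
      (hJ.mul (hv.smooth.euler.continuous.inner hq.smooth.continuous))
      fun x hx => by simp [euler_eq_zero_of_notMem_tsupport hx]
  have i2 : Integrable fun x => invDensity s x * (‖x‖ ^ 2 * gradSq v x) :=
    hv.integrable_of_continuous (hJ.mul (hn.mul (continuous_gradSq hv.smooth)))
      fun x hx => by simp [gradSq_eq_zero_of_notMem_tsupport hx]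
  have i3 : Integrable fun x => invDensity s x * ((1 + κ * s x) * (‖x‖ ^ 2 * gradSq v x)) :=
    hv.integrable_of_continuous (hJ.mul (hbc.mul (hn.mul (continuous_gradSq hv.smooth))))
      fun x hx => by simp [gradSq_eq_zero_of_notMem_tsupport hx]
  have i4 : Integrable fun x => invDensity s x *
      ((1 + κ * s x) * (‖x‖ ^ 2 * gradSq (fun y => v (Real.exp (-τ) • y)) x)) :=
    hT.integrable_of_continuous (hJ.mul (hbc.mul (hn.mul (continuous_gradSq hT.smooth))))
      fun x hx => by simp [gradSq_eq_zero_of_notMem_tsupport hx]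
  have i5 : Integrable fun x => invDensity s x * ((1 + κ * s x) *
      (‖x‖ ^ 2 * gradInner v (dilQuot τ v) x)) :=
    hv.integrable_of_continuous
      (hJ.mul (hbc.mul (hn.mul (continuous_gradInner hv.smooth hq.smooth))))
      fun x hx => by simp [gradInner, pd_eq_zero_of_notMem_tsupport hx]
  simp only [hs.gradInner_affine_smul κ hv hq.smooth, mul_add]
  rw [integral_add i5 (by simpa only [mul_left_comm] using i1.const_mul κ)]
  have e1 : ∫ x, invDensity s x * (κ * inner ℝ (euler v x) (dilQuot τ v x)) =
      κ * ∫ x, invDensity s x * inner ℝ (euler v x) (dilQuot τ v x) := by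
    simp_rw [mul_left_comm _ κ]
    rw [integral_const_mul]
  rw [e1]
  have e2 : ∫ x, invDensity s x *
      ((1 + κ * s x) * (‖x‖ ^ 2 * gradSq (fun y => v (Real.exp (-τ) • y)) x)) =
      ∫ x, invDensity s x * ((1 + κ * s x + κ * τ) * (‖x‖ ^ 2 * gradSq v x)) := by
    rw [← hs.integral_invDensity_comp_smul hτ.le
      (f := fun x => (1 + κ * s x + κ * τ) * (‖x‖ ^ 2 * gradSq v x))]
    · refine integral_congr_ae (.of_forall fun x => ?_)
      simp only [norm_sq_mul_gradSq_comp_dil]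
      by_cases hx : Real.exp (-τ) • x ∈ tsupport v
      · rw [(hs.apply_smul hτ.le (hv.supp _ hx)).2]
        ring
      · simp [gradSq_eq_zero_of_notMem_tsupport hx]
    · intro x hx
      refine hv.supp x ?_
      contrapose! hx
      simp [gradSq_eq_zero_of_notMem_tsupport hx]
  have e3 : ∫ x, invDensity s x * ((1 + κ * s x + κ * τ) * (‖x‖ ^ 2 * gradSq v x)) =
      (∫ x, invDensity s x * ((1 + κ * s x) * (‖x‖ ^ 2 * gradSq v x))) +
      κ * τ * ∫ x, invDensity s x * (‖x‖ ^ 2 * gradSq v x) := by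
    rw [← integral_const_mul, ← integral_add i3 (i2.const_mul _)]
    exact integral_congr_ae (.of_forall fun x => by ring)
  have key : (2 * τ)⁻¹ *
      ((∫ x, invDensity s x * ((1 + κ * s x) * (‖x‖ ^ 2 * gradSq v x))) -
      ∫ x, invDensity s x *
        ((1 + κ * s x) * (‖x‖ ^ 2 * gradSq (fun y => v (Real.exp (-τ) • y)) x))) ≤
      ∫ x, invDensity s x * ((1 + κ * s x) * (‖x‖ ^ 2 * gradInner v (dilQuot τ v) x)) := by
    rw [← integral_sub i3 i4, ← integral_const_mul]
    refine integral_mono ((i3.sub i4).const_mul _) i5 fun x => ?_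
    have hpt : (2 * τ)⁻¹ * (gradSq v x - gradSq (fun y => v (Real.exp (-τ) • y)) x) ≤
        gradInner v (dilQuot τ v) x := by
      simp only [gradSq, gradInner, ← Finset.sum_sub_distrib, Finset.mul_sum]
      refine Finset.sum_le_sum fun j _ => ?_
      have : pd j (dilQuot τ v) x =
          τ⁻¹ • (pd j v x - pd j (fun y => v (Real.exp (-τ) • y)) x) := by
        unfold _root_.dilQuot
        rw [pd_const_smul ((hv.sub hT).smooth.differentiableAt_top x),
          pd_sub (hv.smooth.differentiableAt_top x) (hT.smooth.differentiableAt_top x)]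
      rw [this, inner_smul_right, inner_sub_right, real_inner_self_eq_norm_sq, mul_inv,
        mul_comm (2 : ℝ)⁻¹, mul_assoc]
      gcongr
      have h1 := real_inner_le_norm (pd j v x) (pd j (fun y => v (Real.exp (-τ) • y)) x)
      nlinarith [sq_nonneg (‖pd j v x‖ - ‖pd j (fun y => v (Real.exp (-τ) • y)) x‖)]
    have hcase : 0 ≤ 1 + κ * s x ∨ (x ∉ tsupport v ∧ Real.exp (-τ) • x ∉ tsupport v) := by
      by_cases h1 : x ∈ tsupport v
      · exact .inl (hb x h1)
      by_cases h2 : Real.exp (-τ) • x ∈ tsupport v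
      · left
        rw [(hs.apply_smul hτ.le (hv.supp _ h2)).2]
        nlinarith [hb _ h2, mul_nonneg hκ hτ.le]
      · exact .inr ⟨h1, h2⟩
    rcases hcase with hpos | ⟨h1, h2⟩
    · calc (2 * τ)⁻¹ * (invDensity s x * ((1 + κ * s x) * (‖x‖ ^ 2 * gradSq v x)) -
          invDensity s x * ((1 + κ * s x) *
            (‖x‖ ^ 2 * gradSq (fun y => v (Real.exp (-τ) • y)) x)))
          = (invDensity s x * ((1 + κ * s x) * ‖x‖ ^ 2)) * ((2 * τ)⁻¹ *
            (gradSq v x - gradSq (fun y => v (Real.exp (-τ) • y)) x)) := by ring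
        _ ≤ (invDensity s x * ((1 + κ * s x) * ‖x‖ ^ 2)) * gradInner v (dilQuot τ v) x := by
          have := (hJ0 x).le
          gcongr
        _ = _ := by ring
    · have h3 := norm_sq_mul_gradSq_comp_dil v (Real.exp (-τ)) x
      rw [gradSq_eq_zero_of_notMem_tsupport h2, mul_zero] at h3
      simp [h3, gradSq_eq_zero_of_notMem_tsupport h1, gradInner,
        pd_eq_zero_of_notMem_tsupport h1]
  rw [e2, e3] at key
  have hlin : ∀ A B : ℝ, (2 * τ)⁻¹ * (A - (A + κ * τ * B)) = -(κ / 2) * B := fun A B => by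
    field_simp
    ring
  rw [hlin] at key
  linarith

end IsLogRadius

section Quotient

variable {c : ℝ} {s : Euc d → ℝ}

theorem hasDerivAt_comp_dil {z : Euc d → F} (hz : ContDiff ℝ (⊤ : ℕ∞) z) (x : Euc d) (t : ℝ) :
    HasDerivAt (fun t : ℝ => z (Real.exp (-t) • x)) (-euler z (Real.exp (-t) • x)) t := by
  have h1 : HasDerivAt (fun t : ℝ => Real.exp (-t) • x) (-(Real.exp (-t) • x)) t := by
    have := ((hasDerivAt_neg t).exp).smul_const x
    simpa using this
  have h2 := (hz.differentiableAt_top (Real.exp (-t) • x)).hasFDerivAt.comp_hasDerivAt t h1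
  simpa [euler, Function.comp_def] using h2

theorem tendsto_dilQuot {z : Euc d → F} (hz : ContDiff ℝ (⊤ : ℕ∞) z) (x : Euc d) :
    Tendsto (fun τ => dilQuot τ z x) (𝓝[>] 0) (𝓝 (euler z x)) := by
  have h := (hasDerivAt_comp_dil hz x 0).tendsto_slope_zero_right.neg
  simp only [neg_zero, Real.exp_zero, one_smul, zero_add, neg_neg] at h
  refine h.congr fun τ => ?_
  rw [dilQuot, ← smul_neg, neg_sub]

theorem norm_dilQuot_le {z : Euc d → F} (hz : ContDiff ℝ (⊤ : ℕ∞) z) {C : ℝ}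
    (hC : ∀ y, ‖euler z y‖ ≤ C) {τ : ℝ} (hτ : 0 < τ) (x : Euc d) : ‖dilQuot τ z x‖ ≤ C := by
  have h := Convex.norm_image_sub_le_of_norm_hasDerivWithin_le (s := univ) (x := τ) (y := 0)
    (f := fun t : ℝ => z (Real.exp (-t) • x)) (f' := fun t => -euler z (Real.exp (-t) • x))
    (C := C) (fun t _ => (hasDerivAt_comp_dil hz x t).hasDerivWithinAt)
    (fun t _ => by simpa using hC _) convex_univ (mem_univ _) (mem_univ _)
  simp only [neg_zero, Real.exp_zero, one_smul, zero_sub, norm_neg, Real.norm_of_nonneg hτ.le] at h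
  rw [dilQuot, norm_smul, norm_inv, Real.norm_of_nonneg hτ.le, inv_mul_le_iff₀ hτ]
  linarith

theorem tendsto_integral_dilQuot (hs : IsLogRadius c s) {z : Euc d → F} (hz : IsTestOff c z)
    (α : ℝ) :
    Tendsto (fun τ => ∫ x, invDensity s x * ‖dilQuot τ z x - α • euler z x‖ ^ 2) (𝓝[>] 0)
      (𝓝 (∫ x, invDensity s x * ‖euler z x - α • euler z x‖ ^ 2)) := by
  have hJ := hs.contDiff_invDensity.continuous
  have hec : HasCompactSupport (euler z) := hz.compact.mono' fun x hx => by
    by_contra h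
    exact hx (euler_eq_zero_of_notMem_tsupport h)
  obtain ⟨C, hC⟩ := hec.exists_bound_of_continuous hz.smooth.euler.continuous
  obtain ⟨R, hR⟩ := hz.compact.isCompact.isBounded.subset_closedBall 0
  have hout : ∀ x, R < ‖x‖ → x ∉ tsupport z := fun x hx h => by
    have := hR h
    rw [mem_closedBall_zero_iff] at this
    linarith
  refine tendsto_integral_filter_of_dominated_convergence
    ((Metric.closedBall (0 : Euc d) (Real.exp 1 * |R|)).indicator
      fun x => invDensity s x * (C + |α| * C) ^ 2) ?_ ?_ ?_ ?_
  · filter_upwards [self_mem_nhdsWithin] with τ hτ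
    exact (hJ.mul (((hz.dilQuot (le_of_lt hτ)).smooth.continuous.sub
      (hz.smooth.euler.continuous.const_smul α)).norm.pow 2)).aestronglyMeasurable
  · have h1 : ∀ᶠ τ : ℝ in 𝓝[>] 0, τ < 1 :=
      (eventually_lt_nhds (by norm_num : (0 : ℝ) < 1)).filter_mono nhdsWithin_le_nhds
    filter_upwards [self_mem_nhdsWithin, h1] with τ hτ hτ1
    refine .of_forall fun x => ?_
    by_cases hx : x ∈ Metric.closedBall (0 : Euc d) (Real.exp 1 * |R|)
    · rw [indicator_of_mem hx, Real.norm_of_nonneg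
        (mul_nonneg (invDensity_pos s x).le (sq_nonneg _))]
      have h2 : ‖dilQuot τ z x - α • euler z x‖ ≤ C + |α| * C := by
        refine (norm_sub_le _ _).trans (add_le_add (norm_dilQuot_le hz.smooth hC hτ x) ?_)
        rw [norm_smul, Real.norm_eq_abs]
        exact mul_le_mul_of_nonneg_left (hC x) (abs_nonneg _)
      have := (invDensity_pos s x).le
      gcongr
    · rw [indicator_of_notMem hx]
      rw [mem_closedBall_zero_iff, not_le] at hx
      have h3 : R < ‖Real.exp (-τ) • x‖ := by
        rw [norm_smul, Real.norm_of_nonneg (Real.exp_pos _).le]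
        calc R ≤ |R| := le_abs_self R
          _ = Real.exp (-1) * (Real.exp 1 * |R|) := by
            rw [← mul_assoc, ← Real.exp_add]; simp
          _ < Real.exp (-1) * ‖x‖ := by gcongr
          _ ≤ Real.exp (-τ) * ‖x‖ := by gcongr
      have h4 : R < ‖x‖ := by
        refine (le_abs_self R).trans_lt (lt_of_le_of_lt ?_ hx)
        have := Real.one_le_exp (zero_le_one' ℝ)
        nlinarith [abs_nonneg R]
      simp [dilQuot, image_eq_zero_of_notMem_tsupport (hout _ h3),
        image_eq_zero_of_notMem_tsupport (hout _ h4),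
        euler_eq_zero_of_notMem_tsupport (hout _ h4)]
  · rw [integrable_indicator_iff Metric.isClosed_closedBall.measurableSet]
    exact (hJ.mul continuous_const).continuousOn.integrableOn_compact (isCompact_closedBall _ _)
  · refine .of_forall fun x => ?_
    exact (((tendsto_dilQuot hz.smooth x).sub_const _).norm.pow 2).const_mul _

theorem integral_dilQuot_le_of_div (hs : IsLogRadius c s) {z : Euc d → F} (hz : IsTestOff c z)
    {τ : ℝ} (hτ : 0 < τ) {n : ℕ} (hn : 0 < n) :
    ∫ x, invDensity s x * ‖dilQuot τ z x‖ ^ 2 ≤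
      ∫ x, invDensity s x * ‖dilQuot (τ / n) z x‖ ^ 2 := by
  have hn' : (0 : ℝ) < n := Nat.cast_pos.2 hn
  have hσ : 0 < τ / n := div_pos hτ hn'
  set σ := τ / n with hσd
  have hJ := hs.contDiff_invDensity.continuous
  have hq := hz.dilQuot hσ.le
  have hk : ∀ k : ℕ, (0 : ℝ) ≤ k * σ := fun k => by positivity
  have htel : ∀ x, dilQuot τ z x =
      (n : ℝ)⁻¹ • ∑ k ∈ Finset.range n, dilQuot σ z (Real.exp (-(k * σ)) • x) := by
    intro x
    have h1 : ∀ k : ℕ, dilQuot σ z (Real.exp (-(k * σ)) • x) =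
        σ⁻¹ • (z (Real.exp (-(k * σ)) • x) - z (Real.exp (-((k + 1 : ℕ) * σ)) • x)) := by
      intro k
      rw [dilQuot, smul_smul, ← Real.exp_add]
      congr 5
      push_cast
      ring
    simp only [h1, ← Finset.smul_sum]
    rw [Finset.sum_range_sub' (fun k : ℕ => z (Real.exp (-(k * σ)) • x)), smul_smul]
    have h2 : (n : ℝ) * σ = τ := by rw [hσd]; field_simp
    rw [h2, ← mul_inv, h2]
    simp [dilQuot]
  have hI : ∀ k : ℕ, ∫ x, invDensity s x * ‖dilQuot σ z (Real.exp (-(k * σ)) • x)‖ ^ 2 =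
      ∫ x, invDensity s x * ‖dilQuot σ z x‖ ^ 2 := fun k =>
    hs.integral_invDensity_comp_smul (hk k) (f := fun x => ‖dilQuot σ z x‖ ^ 2) fun x hx =>
      hq.supp x (by
        contrapose! hx
        simp [image_eq_zero_of_notMem_tsupport hx])
  have hint : ∀ k : ℕ,
      Integrable fun x => invDensity s x * ‖dilQuot σ z (Real.exp (-(k * σ)) • x)‖ ^ 2 :=
    fun k => (hq.comp_dil (hk k)).integrable_of_continuous
      (hJ.mul ((hq.comp_dil (hk k)).smooth.continuous.norm.pow 2))
      fun x hx => by
        have h0 := image_eq_zero_of_notMem_tsupport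
          (f := fun x => dilQuot σ z (Real.exp (-(k * σ)) • x)) hx
        beta_reduce at h0
        simp [h0]
  calc ∫ x, invDensity s x * ‖dilQuot τ z x‖ ^ 2
      ≤ ∫ x, (n : ℝ)⁻¹ * ∑ k ∈ Finset.range n,
          invDensity s x * ‖dilQuot σ z (Real.exp (-(k * σ)) • x)‖ ^ 2 := by
        refine integral_mono ?_ ((integrable_finsetSum _ fun k _ => hint k).const_mul _) fun x => ?_
        · exact (hz.dilQuot hτ.le).integrable_of_continuous
            (hJ.mul ((hz.dilQuot hτ.le).smooth.continuous.norm.pow 2))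
            fun x hx => by simp [image_eq_zero_of_notMem_tsupport hx]
        · have h1 : ‖dilQuot τ z x‖ ≤
              (n : ℝ)⁻¹ * ∑ k ∈ Finset.range n, ‖dilQuot σ z (Real.exp (-(k * σ)) • x)‖ := by
            rw [htel, norm_smul, norm_inv, Real.norm_of_nonneg hn'.le]
            gcongr
            exact norm_sum_le _ _
          have h2 := sq_sum_le_card_mul_sum_sq (s := Finset.range n)
            (f := fun k => ‖dilQuot σ z (Real.exp (-(k * σ)) • x)‖)
          rw [Finset.card_range] at h2
          have h3 : ‖dilQuot τ z x‖ ^ 2 ≤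
              (n : ℝ)⁻¹ * ∑ k ∈ Finset.range n, ‖dilQuot σ z (Real.exp (-(k * σ)) • x)‖ ^ 2 := by
            calc ‖dilQuot τ z x‖ ^ 2 ≤ ((n : ℝ)⁻¹ *
                ∑ k ∈ Finset.range n, ‖dilQuot σ z (Real.exp (-(k * σ)) • x)‖) ^ 2 := by gcongr
              _ ≤ ((n : ℝ)⁻¹) ^ 2 * (n *
                ∑ k ∈ Finset.range n, ‖dilQuot σ z (Real.exp (-(k * σ)) • x)‖ ^ 2) := by
                  rw [mul_pow]; gcongr
              _ = _ := by
                rw [sq, mul_assoc, inv_mul_cancel_left₀ hn'.ne']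
          simp only [← Finset.mul_sum]
          rw [mul_left_comm]
          exact mul_le_mul_of_nonneg_left h3 (invDensity_pos s x).le
    _ = ∫ x, invDensity s x * ‖dilQuot σ z x‖ ^ 2 := by
        rw [integral_const_mul, integral_finsetSum _ fun k _ => hint k]
        simp only [hI, Finset.sum_const, Finset.card_range, nsmul_eq_mul]
        field_simp

theorem integral_dilQuot_le (hs : IsLogRadius c s) {z : Euc d → F} (hz : IsTestOff c z)
    {τ : ℝ} (hτ : 0 < τ) :
    ∫ x, invDensity s x * ‖dilQuot τ z x‖ ^ 2 ≤ ∫ x, invDensity s x * ‖euler z x‖ ^ 2 := by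
  have h1 := tendsto_integral_dilQuot hs hz 0
  simp only [zero_smul, sub_zero] at h1
  have h2 : Tendsto (fun n : ℕ => τ / n) atTop (𝓝[>] 0) :=
    tendsto_nhdsWithin_iff.2 ⟨tendsto_const_div_atTop_nhds_zero_nat τ,
      (eventually_gt_atTop 0).mono fun n hn => div_pos hτ (Nat.cast_pos.2 hn)⟩
  exact ge_of_tendsto (h1.comp h2)
    ((eventually_gt_atTop 0).mono fun n hn => integral_dilQuot_le_of_div hs hz hτ hn)

theorem tendsto_integral_dilQuot_sub_euler (hs : IsLogRadius c s) {z : Euc d → F}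
    (hz : IsTestOff c z) :
    Tendsto (fun τ => ∫ x, invDensity s x * ‖dilQuot τ z x - euler z x‖ ^ 2) (𝓝[>] 0) (𝓝 0) := by
  simpa using tendsto_integral_dilQuot hs hz 1

/-- The error of the difference quotient for `v`, in terms of the error for a fixed `u`. -/
theorem integral_dilQuot_sub_euler_le (hs : IsLogRadius c s) {u v : Euc d → F}
    (hu : IsTestOff c u) (hv : IsTestOff c v) {τ : ℝ} (hτ : 0 < τ) :
    ∫ x, invDensity s x * ‖dilQuot τ v x - euler v x‖ ^ 2 ≤
      3 * (∫ x, invDensity s x * ‖dilQuot τ u x - euler u x‖ ^ 2) +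
      6 * ∫ x, invDensity s x * ‖euler (fun y => v y - u y) x‖ ^ 2 := by
  have hJ := hs.contDiff_invDensity.continuous
  have hw := hv.sub hu
  have i0 : ∀ {z : Euc d → F}, IsTestOff c z →
      Integrable fun x => invDensity s x * ‖dilQuot τ z x‖ ^ 2 := fun hz =>
    (hz.dilQuot hτ.le).integrable_of_continuous
      (hJ.mul ((hz.dilQuot hτ.le).smooth.continuous.norm.pow 2))
      fun x hx => by simp [image_eq_zero_of_notMem_tsupport hx]
  have i1 : ∀ {z : Euc d → F}, IsTestOff c z →
      Integrable fun x => invDensity s x * ‖euler z x‖ ^ 2 := fun hz =>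
    hz.integrable_of_continuous (hJ.mul (hz.smooth.euler.continuous.norm.pow 2))
      fun x hx => by simp [euler_eq_zero_of_notMem_tsupport hx]
  have hb : ∀ a b : F, ‖a - b‖ ^ 2 ≤ 2 * ‖a‖ ^ 2 + 2 * ‖b‖ ^ 2 := fun a b => by
    have := norm_sub_le a b
    nlinarith [norm_nonneg (a - b), sq_nonneg (‖a‖ - ‖b‖)]
  have i2 : ∀ {z : Euc d → F}, IsTestOff c z →
      Integrable fun x => invDensity s x * ‖dilQuot τ z x - euler z x‖ ^ 2 := fun {z} hz => by
    refine Integrable.mono' (((i0 hz).const_mul 2).add ((i1 hz).const_mul 2))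
      (hJ.mul (((hz.dilQuot hτ.le).smooth.continuous.sub
        hz.smooth.euler.continuous).norm.pow 2)).aestronglyMeasurable (.of_forall fun x => ?_)
    rw [Real.norm_of_nonneg (mul_nonneg (invDensity_pos s x).le (sq_nonneg _))]
    have := mul_le_mul_of_nonneg_left (hb (dilQuot τ z x) (euler z x)) (invDensity_pos s x).le
    simp only [Pi.add_apply]
    linarith
  have h1 := integral_dilQuot_le hs hw hτ
  have h2 : ∫ x, invDensity s x * ‖dilQuot τ v x - euler v x‖ ^ 2 ≤
      3 * (∫ x, invDensity s x * ‖dilQuot τ u x - euler u x‖ ^ 2) +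
      (3 * (∫ x, invDensity s x * ‖dilQuot τ (fun y => v y - u y) x‖ ^ 2) +
      3 * ∫ x, invDensity s x * ‖euler (fun y => v y - u y) x‖ ^ 2) := by
    simp only [← integral_const_mul]
    have i7 : Integrable fun x => 3 * (invDensity s x * ‖dilQuot τ (fun y => v y - u y) x‖ ^ 2) +
        3 * (invDensity s x * ‖euler (fun y => v y - u y) x‖ ^ 2) :=
      ((i0 hw).const_mul 3).add ((i1 hw).const_mul 3)
    rw [← integral_add ((i0 hw).const_mul 3) ((i1 hw).const_mul 3), ← integral_add
      ((i2 hu).const_mul 3) i7]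
    refine integral_mono (i2 hv)
      (((i2 hu).const_mul 3).add i7) fun x => ?_
    have e1 : dilQuot τ v x - euler v x = (dilQuot τ u x - euler u x) +
        dilQuot τ (fun y => v y - u y) x - euler (fun y => v y - u y) x := by
      rw [euler_sub (hv.smooth.differentiableAt_top x) (hu.smooth.differentiableAt_top x)]
      simp only [dilQuot, smul_sub]
      abel
    have h3 : ∀ a b e : F, ‖a + b - e‖ ^ 2 ≤ 3 * ‖a‖ ^ 2 + (3 * ‖b‖ ^ 2 + 3 * ‖e‖ ^ 2) := by
      intro a b e
      have h4 := (norm_sub_le (a + b) e).trans (add_le_add_left (norm_add_le a b) _)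
      have h5 : ‖a + b - e‖ ^ 2 ≤ (‖a‖ + ‖b‖ + ‖e‖) ^ 2 := by gcongr
      nlinarith [sq_nonneg (‖a‖ - ‖b‖), sq_nonneg (‖a‖ - ‖e‖), sq_nonneg (‖b‖ - ‖e‖)]
    have h6 := mul_le_mul_of_nonneg_left (h3 (dilQuot τ u x - euler u x)
      (dilQuot τ (fun y => v y - u y) x) (euler (fun y => v y - u y) x)) (invDensity_pos s x).le
    simp only
    rw [e1]
    linarith
  linarith

end Quotient

end Dilation

section Core

variable {d : ℕ} {F : Type*} [NormedAddCommGroup F] [InnerProductSpace ℝ F]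

theorem mul_le_young {t : ℝ} (ht : 0 < t) (x y : ℝ) : x * y ≤ t / 4 * x ^ 2 + t⁻¹ * y ^ 2 := by
  have h1 : t / 4 * x ^ 2 + t⁻¹ * y ^ 2 - x * y = t⁻¹ * (t / 2 * x - y) ^ 2 := by
    field_simp
    ring
  have h2 : 0 ≤ t⁻¹ * (t / 2 * x - y) ^ 2 := by positivity
  linarith

theorem carleman_pointwise (a ω v : F) {b h κ P : ℝ} (hb1 : 1 / 2 ≤ b) (hb2 : b ≤ 3 / 2)
    (hh : 0 < h) (hκ : 0 < κ) (hhκ : h * κ ≤ 1 / 32) (hP : 0 ≤ P) :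
    κ / 32 * ‖v‖ ^ 2 - 4 * h⁻¹ * P ^ 2 - (51 * h + 128 * κ⁻¹) * ‖ω‖ ^ 2 +
        P * ‖b • (a + ω) + κ • v‖ ≤
      h ^ 2 * κ * inner ℝ a (a + ω) +
        inner ℝ ((2 * h * b) • a - b ^ 2 • v) (b • (a + ω) + κ • v) -
        h * κ * (κ * ‖v‖ ^ 2 + 2 * b * inner ℝ a v) +
        1 / 2 * (3 * κ * b ^ 2 * ‖v‖ ^ 2 + 2 * b ^ 3 * inner ℝ a v) := by
  have e1 : h ^ 2 * κ * inner ℝ a (a + ω) +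
        inner ℝ ((2 * h * b) • a - b ^ 2 • v) (b • (a + ω) + κ • v) -
        h * κ * (κ * ‖v‖ ^ 2 + 2 * b * inner ℝ a v) +
        1 / 2 * (3 * κ * b ^ 2 * ‖v‖ ^ 2 + 2 * b ^ 3 * inner ℝ a v) =
      (h ^ 2 * κ + 2 * h * b ^ 2) * ‖a‖ ^ 2 + (h ^ 2 * κ + 2 * h * b ^ 2) * inner ℝ a ω -
        b ^ 3 * inner ℝ v ω + (κ / 2 * b ^ 2 - h * κ ^ 2) * ‖v‖ ^ 2 := by
    simp only [inner_add_right, inner_sub_left, inner_smul_left, inner_smul_right,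
      real_inner_self_eq_norm_sq, RCLike.conj_to_real, real_inner_comm a v]
    ring
  rw [e1]
  have hb0 : 0 ≤ b := by linarith
  have hb4 : 1 / 4 ≤ b ^ 2 := by nlinarith
  have hb5 : b ^ 2 ≤ 9 / 4 := by nlinarith
  have hb6 : b ^ 3 ≤ 27 / 8 := by nlinarith [mul_nonneg hb0 hb0]
  have n1 := norm_nonneg a
  have n2 := norm_nonneg ω
  have n3 := norm_nonneg v
  have t1 : P * ‖b • (a + ω) + κ • v‖ ≤ P * (3 / 2 * ‖a‖ + 3 / 2 * ‖ω‖ + κ * ‖v‖) := by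
    gcongr
    calc ‖b • (a + ω) + κ • v‖ ≤ ‖b • (a + ω)‖ + ‖κ • v‖ := norm_add_le _ _
      _ = b * ‖a + ω‖ + κ * ‖v‖ := by
        rw [norm_smul, norm_smul, Real.norm_of_nonneg hb0, Real.norm_of_nonneg hκ.le]
      _ ≤ 3 / 2 * (‖a‖ + ‖ω‖) + κ * ‖v‖ := by gcongr; exact norm_add_le _ _
      _ = _ := by ring
  have c1 : h ^ 2 * κ ≤ h / 32 := by linarith [mul_le_mul_of_nonneg_left hhκ hh.le]
  have c2 : h * κ ^ 2 ≤ κ / 32 := by linarith [mul_le_mul_of_nonneg_left hhκ hκ.le]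
  have t2 : -((5 * h) * (‖a‖ * ‖ω‖)) ≤ (h ^ 2 * κ + 2 * h * b ^ 2) * inner ℝ a ω := by
    have i1 := abs_real_inner_le_norm a ω
    have i2 : 0 ≤ h ^ 2 * κ + 2 * h * b ^ 2 := by positivity
    have i3 : h ^ 2 * κ + 2 * h * b ^ 2 ≤ 5 * h := by
      linarith [mul_le_mul_of_nonneg_left hb5 hh.le]
    calc -((5 * h) * (‖a‖ * ‖ω‖)) ≤ -((h ^ 2 * κ + 2 * h * b ^ 2) * (‖a‖ * ‖ω‖)) := by gcongr
      _ = (h ^ 2 * κ + 2 * h * b ^ 2) * (-(‖a‖ * ‖ω‖)) := by ring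
      _ ≤ _ := by gcongr; exact (abs_le.1 i1).1
  have t3 : b ^ 3 * inner ℝ v ω ≤ 4 * (‖v‖ * ‖ω‖) := by
    calc b ^ 3 * inner ℝ v ω ≤ b ^ 3 * (‖v‖ * ‖ω‖) := by
          gcongr; exact real_inner_le_norm v ω
      _ ≤ _ := by gcongr; linarith
  have y1 := mul_le_young hh ‖a‖ (3 / 2 * P)
  have y2 := mul_le_young (by positivity : 0 < 4 * h) ‖ω‖ (3 / 2 * P)
  have y3 := mul_le_young (by positivity : (0 : ℝ) < 8⁻¹) ‖v‖ P
  have y4 := mul_le_young (by positivity : (0 : ℝ) < 10⁻¹) ‖a‖ ‖ω‖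
  have y5 := mul_le_young (by positivity : 0 < κ / 32) ‖v‖ ‖ω‖
  have y3' := mul_le_mul_of_nonneg_left y3 hκ.le
  have y4' := mul_le_mul_of_nonneg_left y4 hh.le
  have q1 : κ * P ^ 2 ≤ 1 / 32 * (h⁻¹ * P ^ 2) := by
    have : κ ≤ 1 / 32 * h⁻¹ := by
      rw [← div_eq_mul_inv, le_div_iff₀ hh]; linarith
    linarith [mul_le_mul_of_nonneg_right this (sq_nonneg P)]
  have q2 : 1 / 2 * h * ‖a‖ ^ 2 ≤ (h ^ 2 * κ + 2 * h * b ^ 2) * ‖a‖ ^ 2 := by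
    gcongr
    have p0 : 0 ≤ h ^ 2 * κ := by positivity
    linarith [mul_le_mul_of_nonneg_left hb4 hh.le]
  have q3 : 3 / 32 * κ * ‖v‖ ^ 2 ≤ (κ / 2 * b ^ 2 - h * κ ^ 2) * ‖v‖ ^ 2 := by
    gcongr
    linarith [mul_le_mul_of_nonneg_left hb4 hκ.le]
  have q4 : (4 * h)⁻¹ = h⁻¹ / 4 := by rw [mul_inv]; ring
  have q5 : (κ / 32)⁻¹ = 32 * κ⁻¹ := by field_simp
  rw [q4] at y2
  rw [q5] at y5
  have p1 : 0 ≤ h * ‖ω‖ ^ 2 := by positivity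
  have p2 : 0 ≤ h * ‖a‖ ^ 2 := by positivity
  have p3 : 0 ≤ h⁻¹ * P ^ 2 := by positivity
  norm_num at y3' y4'
  linarith

/-- The conjugated operator `e^θ (-h² ‖x‖² Δ) e^{-θ}` up to lower order terms, where
`h ∇θ = (1 + κ s) ∇s`. -/
def carlemanOp (h κ : ℝ) (s : Euc d → ℝ) (v : Euc d → F) : Euc d → F := fun x =>
  -(h ^ 2) • (‖x‖ ^ 2 • lap v x + (2 - (d : ℝ)) • euler v x) +
    ((2 * h * (1 + κ * s x)) • euler v x - (1 + κ * s x) ^ 2 • v x)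

/-- The multiplier paired with `carlemanOp`. -/
def carlemanMult (κ τ : ℝ) (s : Euc d → ℝ) (v : Euc d → F) : Euc d → F := fun x =>
  (1 + κ * s x) • dilQuot τ v x + κ • v x

variable {c : ℝ} {s : Euc d → ℝ}

theorem IsTestOff.carlemanMult (hs : IsLogRadius c s) {v : Euc d → F} (hv : IsTestOff c v)
    (κ : ℝ) {τ : ℝ} (hτ : 0 ≤ τ) : IsTestOff c (carlemanMult κ τ s v) :=
  ((hv.dilQuot hτ).smul (contDiff_const.add (contDiff_const.mul hs.smooth))).add
    (hv.smul contDiff_const)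

theorem euler_pow_smul_norm_sq (hs : IsLogRadius c s) (κ : ℝ) (m : ℕ) {v : Euc d → F}
    (hv : IsTestOff c v) (x : Euc d) :
    euler (fun y => (1 + κ * s y) ^ m * ‖v y‖ ^ 2) x =
      m * κ * (1 + κ * s x) ^ (m - 1) * ‖v x‖ ^ 2 +
        2 * (1 + κ * s x) ^ m * inner ℝ (euler v x) (v x) := by
  by_cases hx : x ∈ tsupport v
  · have h1 : HasFDerivAt (fun y => (1 + κ * s y) ^ m)
        ((m * (1 + κ * s x) ^ (m - 1)) • (κ • fderiv ℝ s x)) x := by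
      have h2 := (hs.smooth.differentiableAt_top x).hasFDerivAt
      simpa using ((h2.const_mul κ).const_add 1).pow m
    have h3 := (hv.smooth.differentiableAt_top x).hasFDerivAt.norm_sq
    have h4 := hs.euler_eq (hv.supp x hx)
    rw [euler] at h4
    have h5 : fderiv ℝ (fun y => (1 + κ * s y) ^ m * ‖v y‖ ^ 2) x = _ := (h1.mul h3).fderiv
    rw [euler, h5]
    simp only [add_apply, smul_apply, smul_eq_mul, h4,
      ContinuousLinearMap.comp_apply, innerSL_apply_apply, euler]
    rw [real_inner_comm (v x)]
    ring
  · have h0 : (fun y => (1 + κ * s y) ^ m * ‖v y‖ ^ 2) =ᶠ[𝓝 x] 0 := by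
      filter_upwards [notMem_tsupport_iff_eventuallyEq.1 hx] with y hy
      simp [hy]
    rw [h0.euler_eq]
    simp [euler, image_eq_zero_of_notMem_tsupport hx]

theorem integral_carlemanOp_inner_ge (hs : IsLogRadius c s) {v : Euc d → F} (hv : IsTestOff c v)
    {h κ τ : ℝ} (hκ : 0 ≤ κ) (hτ : 0 < τ) (hb : ∀ x ∈ tsupport v, 0 ≤ 1 + κ * s x) :
    h ^ 2 * (κ / 2 * (∫ x, invDensity s x * (‖x‖ ^ 2 * gradSq v x)) +
        κ * ∫ x, invDensity s x * inner ℝ (euler v x) (dilQuot τ v x)) +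
      (∫ x, invDensity s x * inner ℝ
        ((2 * h * (1 + κ * s x)) • euler v x - (1 + κ * s x) ^ 2 • v x)
        (carlemanMult κ τ s v x)) ≤
      ∫ x, invDensity s x * inner ℝ (carlemanOp h κ s v x) (carlemanMult κ τ s v x) := by
  have hJ := hs.contDiff_invDensity.continuous
  have hq := hv.dilQuot hτ.le
  have hm := hv.carlemanMult hs κ hτ.le
  have hbs : ContDiff ℝ (⊤ : ℕ∞) fun x => 1 + κ * s x :=
    contDiff_const.add (contDiff_const.mul hs.smooth)
  have hbq := hq.smul hbs
  have hn : Continuous fun x : Euc d => ‖x‖ ^ 2 := continuous_norm.pow 2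
  have hL : Continuous fun x => ‖x‖ ^ 2 • lap v x + (2 - (d : ℝ)) • euler v x :=
    (hn.smul hv.smooth.lap.continuous).add (hv.smooth.euler.continuous.const_smul _)
  have hA : Continuous fun x =>
      (2 * h * (1 + κ * s x)) • euler v x - (1 + κ * s x) ^ 2 • v x :=
    ((continuous_const.mul hbs.continuous).smul hv.smooth.euler.continuous).sub
      ((hbs.continuous.pow 2).smul hv.smooth.continuous)
  have i1 : Integrable fun x => invDensity s x * inner ℝ
      (‖x‖ ^ 2 • lap v x + (2 - (d : ℝ)) • euler v x) (carlemanMult κ τ s v x) :=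
    hm.integrable_of_continuous (hJ.mul (hL.inner hm.smooth.continuous))
      fun x hx => by simp [image_eq_zero_of_notMem_tsupport hx]
  have i2 : Integrable fun x => invDensity s x * inner ℝ
      ((2 * h * (1 + κ * s x)) • euler v x - (1 + κ * s x) ^ 2 • v x)
      (carlemanMult κ τ s v x) :=
    hm.integrable_of_continuous (hJ.mul (hA.inner hm.smooth.continuous))
      fun x hx => by simp [image_eq_zero_of_notMem_tsupport hx]
  have i3 : Integrable fun x => invDensity s x * (‖x‖ ^ 2 *
      gradInner v (fun y => (1 + κ * s y) • dilQuot τ v y) x) :=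
    hv.integrable_of_continuous (hJ.mul (hn.mul (continuous_gradInner hv.smooth hbq.smooth)))
      fun x hx => by simp [gradInner, pd_eq_zero_of_notMem_tsupport hx]
  have i4 : Integrable fun x => invDensity s x * (‖x‖ ^ 2 * gradSq v x) :=
    hv.integrable_of_continuous (hJ.mul (hn.mul (continuous_gradSq hv.smooth)))
      fun x hx => by simp [gradSq_eq_zero_of_notMem_tsupport hx]
  have e1 : ∫ x, invDensity s x * inner ℝ (carlemanOp h κ s v x) (carlemanMult κ τ s v x) =
      -(h ^ 2) * (∫ x, invDensity s x * inner ℝ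
        (‖x‖ ^ 2 • lap v x + (2 - (d : ℝ)) • euler v x) (carlemanMult κ τ s v x)) +
      ∫ x, invDensity s x * inner ℝ
        ((2 * h * (1 + κ * s x)) • euler v x - (1 + κ * s x) ^ 2 • v x)
        (carlemanMult κ τ s v x) := by
    rw [← integral_const_mul, ← integral_add (i1.const_mul _) i2]
    refine integral_congr_ae (.of_forall fun x => ?_)
    simp only [carlemanOp, inner_add_left _ _ (carlemanMult κ τ s v x),
      inner_smul_left _ _ (-(h ^ 2)), RCLike.conj_to_real]
    ring
  have e2 := hs.integral_gradInner hv.smooth hm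
  have e3 : ∫ x, invDensity s x * (‖x‖ ^ 2 * gradInner v (carlemanMult κ τ s v) x) =
      (∫ x, invDensity s x * (‖x‖ ^ 2 *
        gradInner v (fun y => (1 + κ * s y) • dilQuot τ v y) x)) +
      κ * ∫ x, invDensity s x * (‖x‖ ^ 2 * gradSq v x) := by
    rw [← integral_const_mul, ← integral_add i3 (i4.const_mul _)]
    refine integral_congr_ae (.of_forall fun x => ?_)
    have : gradInner v (carlemanMult κ τ s v) x =
        gradInner v (fun y => (1 + κ * s y) • dilQuot τ v y) x + κ * gradSq v x := by
      rw [← gradInner_self]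
      simp only [gradInner, Finset.mul_sum, ← Finset.sum_add_distrib]
      refine Finset.sum_congr rfl fun j _ => ?_
      unfold _root_.carlemanMult
      rw [pd_add (hbq.smooth.differentiableAt_top x)
        ((hv.smul (b := fun _ => κ) contDiff_const).smooth.differentiableAt_top x),
        pd_const_smul (hv.smooth.differentiableAt_top x), inner_add_right, inner_smul_right]
    simp only [this]
    ring
  have e4 := hs.pohozaev_le hκ hτ hv hb
  rw [e1]
  nlinarith [mul_le_mul_of_nonneg_left e4 (sq_nonneg h)]

theorem integral_linear_combination {α : Type*} [MeasurableSpace α] {μ : Measure α}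
    {f₁ f₂ f₃ f₄ : α → ℝ} (i₁ : Integrable f₁ μ) (i₂ : Integrable f₂ μ) (i₃ : Integrable f₃ μ)
    (i₄ : Integrable f₄ μ) (a₁ a₂ a₃ a₄ : ℝ) :
    Integrable (fun x => a₁ * f₁ x + a₂ * f₂ x + a₃ * f₃ x + a₄ * f₄ x) μ ∧
    ∫ x, (a₁ * f₁ x + a₂ * f₂ x + a₃ * f₃ x + a₄ * f₄ x) ∂μ =
      a₁ * (∫ x, f₁ x ∂μ) + a₂ * (∫ x, f₂ x ∂μ) + a₃ * (∫ x, f₃ x ∂μ) + a₄ * ∫ x, f₄ x ∂μ := by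
  have j₂ : Integrable (fun x => a₁ * f₁ x + a₂ * f₂ x) μ := (i₁.const_mul _).add (i₂.const_mul _)
  have j₃ : Integrable (fun x => a₁ * f₁ x + a₂ * f₂ x + a₃ * f₃ x) μ := j₂.add (i₃.const_mul _)
  refine ⟨j₃.add (i₄.const_mul _), ?_⟩
  rw [integral_add j₃ (i₄.const_mul _), integral_add j₂ (i₃.const_mul _),
    integral_add (i₁.const_mul _) (i₂.const_mul _)]
  simp only [integral_const_mul]

/-- Weighted estimate with two large parameters; `P` dominates the part of the right-hand side
which is measured in `L²`, and `η` the remainder. -/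
theorem carleman_integral_le (hs : IsLogRadius c s) {v : Euc d → F} (hv : IsTestOff c v)
    {h κ τ η : ℝ} (hh : 0 < h) (hκ : 0 < κ) (hτ : 0 < τ) (hhκ : h * κ ≤ 1 / 32)
    (hκτ : κ * τ ≤ 1 / 4) (hκs : ∀ x ∈ tsupport v, |κ * s x| ≤ 1 / 4)
    {P : Euc d → ℝ} (hP : Continuous P) (hPc : HasCompactSupport P) (hP0 : ∀ x, 0 ≤ P x)
    (hR : ∫ x, invDensity s x * inner ℝ (carlemanOp h κ s v x) (carlemanMult κ τ s v x) ≤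
      η + ∫ x, invDensity s x * (P x * ‖carlemanMult κ τ s v x‖)) :
    h ^ 2 * (κ / 2) * (∫ x, invDensity s x * (‖x‖ ^ 2 * gradSq v x)) +
        κ / 32 * (∫ x, invDensity s x * ‖v x‖ ^ 2) ≤
      η + 4 * h⁻¹ * (∫ x, invDensity s x * P x ^ 2) +
        (51 * h + 128 * κ⁻¹) * ∫ x, invDensity s x * ‖dilQuot τ v x - euler v x‖ ^ 2 := by
  have hJ := hs.contDiff_invDensity.continuous
  have hq := hv.dilQuot hτ.le
  have hm := hv.carlemanMult hs κ hτ.le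
  have hbs : ContDiff ℝ (⊤ : ℕ∞) fun x => 1 + κ * s x :=
    contDiff_const.add (contDiff_const.mul hs.smooth)
  have hvc := hv.smooth.continuous
  have hDc := hv.smooth.euler.continuous
  have hmc := hm.smooth.continuous
  have hqc := hq.smooth.continuous
  have hsupp : ∀ x ∈ tsupport v, 0 ≤ 1 + κ * s x := fun x hx => by
    linarith [(abs_le.1 (hκs x hx)).1]
  have hN : ∀ m : ℕ, ∫ x, invDensity s x *
      (m * κ * (1 + κ * s x) ^ (m - 1) * ‖v x‖ ^ 2 +
        2 * (1 + κ * s x) ^ m * inner ℝ (euler v x) (v x)) = 0 := fun m => by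
    simp only [← euler_pow_smul_norm_sq hs κ m hv]
    refine hs.integral_invDensity_euler ⟨(hbs.pow m).mul (hv.smooth.norm_sq ℝ), ?_, ?_⟩
    · refine hv.compact.mono fun x hx => ?_
      contrapose! hx
      simp [Function.notMem_support.1 hx]
    · intro x hx
      refine hv.supp x (closure_mono (fun y hy => ?_) hx)
      contrapose! hy
      simp [Function.notMem_support.1 hy]
  have iN : ∀ m : ℕ, Integrable fun x => invDensity s x *
      (m * κ * (1 + κ * s x) ^ (m - 1) * ‖v x‖ ^ 2 +
        2 * (1 + κ * s x) ^ m * inner ℝ (euler v x) (v x)) := fun m =>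
    hv.integrable_of_continuous (hJ.mul (((continuous_const.mul (hbs.continuous.pow _)).mul
      (hvc.norm.pow 2)).add ((continuous_const.mul (hbs.continuous.pow _)).mul (hDc.inner hvc))))
      fun x hx => by simp [image_eq_zero_of_notMem_tsupport hx]
  have i1 : Integrable fun x => invDensity s x * inner ℝ (euler v x) (dilQuot τ v x) :=
    hv.integrable_of_continuous (hJ.mul (hDc.inner hqc))
      fun x hx => by simp [euler_eq_zero_of_notMem_tsupport hx]
  have i2 : Integrable fun x => invDensity s x * inner ℝ
      ((2 * h * (1 + κ * s x)) • euler v x - (1 + κ * s x) ^ 2 • v x)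
      (carlemanMult κ τ s v x) :=
    hm.integrable_of_continuous (hJ.mul ((((continuous_const.mul hbs.continuous).smul hDc).sub
      ((hbs.continuous.pow 2).smul hvc)).inner hmc))
      fun x hx => by simp [image_eq_zero_of_notMem_tsupport hx]
  have i3 : Integrable fun x => invDensity s x * ‖v x‖ ^ 2 :=
    hv.integrable_of_continuous (hJ.mul (hvc.norm.pow 2))
      fun x hx => by simp [image_eq_zero_of_notMem_tsupport hx]
  have i4 : Integrable fun x => invDensity s x * P x ^ 2 := by
    refine (hJ.mul (hP.pow 2)).integrable_of_hasCompactSupport (hPc.mono fun x hx => ?_)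
    contrapose! hx
    simp [Function.notMem_support.1 hx]
  have i5 : Integrable fun x => invDensity s x * (P x * ‖carlemanMult κ τ s v x‖) :=
    hm.integrable_of_continuous (hJ.mul (hP.mul hmc.norm))
      fun x hx => by simp [image_eq_zero_of_notMem_tsupport hx]
  have i6 : Integrable fun x => invDensity s x * ‖dilQuot τ v x - euler v x‖ ^ 2 := by
    refine (hJ.mul ((hqc.sub hDc).norm.pow 2)).integrable_of_hasCompactSupport
      ((hq.compact.sub (hv.compact.mono' (f' := euler v) fun x hx => ?_)).mono fun x hx => ?_)
    · by_contra h1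
      exact hx (euler_eq_zero_of_notMem_tsupport h1)
    · contrapose! hx
      have : dilQuot τ v x - euler v x = 0 := Function.notMem_support.1 hx
      simp [this]
  have c1 := integral_linear_combination i3 i4 i6 i5 (κ / 32) (-(4 * h⁻¹))
    (-(51 * h + 128 * κ⁻¹)) 1
  have c2 := integral_linear_combination i1 i2 (iN 1) (iN 3) (h ^ 2 * κ) 1 (-(h * κ)) (1 / 2)
  have key : ∫ x, (κ / 32 * (invDensity s x * ‖v x‖ ^ 2) +
        -(4 * h⁻¹) * (invDensity s x * P x ^ 2) +
        -(51 * h + 128 * κ⁻¹) * (invDensity s x * ‖dilQuot τ v x - euler v x‖ ^ 2) +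
        1 * (invDensity s x * (P x * ‖carlemanMult κ τ s v x‖))) ≤
      ∫ x, (h ^ 2 * κ * (invDensity s x * inner ℝ (euler v x) (dilQuot τ v x)) +
        1 * (invDensity s x * inner ℝ
          ((2 * h * (1 + κ * s x)) • euler v x - (1 + κ * s x) ^ 2 • v x)
          (carlemanMult κ τ s v x)) +
        -(h * κ) * (invDensity s x *
          ((1 : ℕ) * κ * (1 + κ * s x) ^ (1 - 1) * ‖v x‖ ^ 2 +
            2 * (1 + κ * s x) ^ 1 * inner ℝ (euler v x) (v x))) +
        1 / 2 * (invDensity s x *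
          ((3 : ℕ) * κ * (1 + κ * s x) ^ (3 - 1) * ‖v x‖ ^ 2 +
            2 * (1 + κ * s x) ^ 3 * inner ℝ (euler v x) (v x)))) := by
    refine integral_mono c1.1 c2.1 fun x => ?_
    have hpt : κ / 32 * ‖v x‖ ^ 2 - 4 * h⁻¹ * P x ^ 2 -
          (51 * h + 128 * κ⁻¹) * ‖dilQuot τ v x - euler v x‖ ^ 2 +
          P x * ‖carlemanMult κ τ s v x‖ ≤
        h ^ 2 * κ * inner ℝ (euler v x) (dilQuot τ v x) +
          inner ℝ ((2 * h * (1 + κ * s x)) • euler v x - (1 + κ * s x) ^ 2 • v x)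
            (carlemanMult κ τ s v x) -
          h * κ * (κ * ‖v x‖ ^ 2 + 2 * (1 + κ * s x) * inner ℝ (euler v x) (v x)) +
          1 / 2 * (3 * κ * (1 + κ * s x) ^ 2 * ‖v x‖ ^ 2 +
            2 * (1 + κ * s x) ^ 3 * inner ℝ (euler v x) (v x)) := by
      have hcase : |κ * s x| ≤ 1 / 2 ∨
          (x ∉ tsupport v ∧ Real.exp (-τ) • x ∉ tsupport v) := by
        by_cases h1 : x ∈ tsupport v
        · exact .inl ((hκs x h1).trans (by norm_num))
        by_cases h2 : Real.exp (-τ) • x ∈ tsupport v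
        · left
          rw [(hs.apply_smul hτ.le (hv.supp _ h2)).2, mul_add]
          have := abs_add_le (κ * s (Real.exp (-τ) • x)) (κ * τ)
          rw [abs_of_nonneg (mul_nonneg hκ.le hτ.le)] at this
          linarith [hκs _ h2]
        · exact .inr ⟨h1, h2⟩
      rcases hcase with hb | ⟨h1, h2⟩
      · have hb' := abs_le.1 hb
        have := carleman_pointwise (euler v x) (dilQuot τ v x - euler v x) (v x)
          (b := 1 + κ * s x) (by linarith [hb'.1]) (by linarith [hb'.2]) hh hκ hhκ (hP0 x)
        rwa [add_sub_cancel] at this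
      · have z1 := euler_eq_zero_of_notMem_tsupport h1
        have z2 := image_eq_zero_of_notMem_tsupport h1
        have z3 : dilQuot τ v x = 0 := by
          simp [dilQuot, z2, image_eq_zero_of_notMem_tsupport h2]
        simp only [carlemanMult, z1, z2, z3]
        simp
        positivity
    have := mul_le_mul_of_nonneg_left hpt (invDensity_pos s x).le
    simp only [Nat.cast_one, Nat.cast_ofNat, one_mul, tsub_self, pow_zero, mul_one, pow_one,
      Nat.add_one_sub_one]
    linarith
  rw [c1.2, c2.2, hN 1, hN 3] at key
  have hge := integral_carlemanOp_inner_ge hs hv (h := h) hκ.le hτ hsupp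
  linarith

end Core

section Minimization

variable {V : Type*} [AddCommGroup V] [Module ℝ V]

/-- `G` minimizes `B ψ ψ - 2 L ψ` up to an error `δ²`. -/
def IsNearMin (B : V →ₗ[ℝ] V →ₗ[ℝ] ℝ) (L : V →ₗ[ℝ] ℝ) (δ : ℝ) (G : V) : Prop :=
  ∀ ψ, B G G - 2 * L G ≤ B ψ ψ - 2 * L ψ + δ ^ 2

variable {B : V →ₗ[ℝ] V →ₗ[ℝ] ℝ} {L : V →ₗ[ℝ] ℝ} {N δ : ℝ} {G : V}

theorem exists_isNearMin (hpos : ∀ u, 0 ≤ B u u) (hL : ∀ ψ, L ψ ≤ N * √(B ψ ψ)) (hδ : 0 < δ) :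
    ∃ G, IsNearMin B L δ G := by
  have hbd : BddBelow (range fun ψ => B ψ ψ - 2 * L ψ) := by
    refine ⟨-N ^ 2, ?_⟩
    rintro _ ⟨ψ, rfl⟩
    have h1 := hL ψ
    have h2 := Real.sq_sqrt (hpos ψ)
    dsimp only
    nlinarith [sq_nonneg (√(B ψ ψ) - N)]
  obtain ⟨_, ⟨G, rfl⟩, hG⟩ := Real.lt_sInf_add_pos (range_nonempty fun ψ => B ψ ψ - 2 * L ψ)
    (pow_pos hδ 2)
  exact ⟨G, fun ψ => hG.le.trans (add_le_add_left (csInf_le hbd (mem_range_self ψ)) _)⟩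

theorem IsNearMin.abs_sub_le (hG : IsNearMin B L δ G) (hsymm : ∀ u v, B u v = B v u)
    (hδ : 0 ≤ δ) (ψ : V) : |B G ψ - L ψ| ≤ δ * √(B ψ ψ) := by
  have h1 : ∀ t : ℝ, 0 ≤ B ψ ψ * (t * t) + 2 * (B G ψ - L ψ) * t + δ ^ 2 := fun t => by
    have := hG (G + t • ψ)
    simp only [map_add, map_smul, LinearMap.add_apply, LinearMap.smul_apply, smul_eq_mul,
      hsymm ψ G] at this
    linarith
  have h2 := discrim_le_zero h1
  rw [discrim] at h2
  rw [← Real.sqrt_sq hδ, ← Real.sqrt_mul (sq_nonneg δ)]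
  exact Real.abs_le_sqrt (by linarith)

theorem IsNearMin.sub_le {δ' : ℝ} {G' : V} (hG : IsNearMin B L δ G) (hG' : IsNearMin B L δ' G')
    (hsymm : ∀ u v, B u v = B v u) :
    B (G' - G) (G' - G) ≤ 2 * δ ^ 2 + 2 * δ' ^ 2 := by
  have h1 := hG ((1 / 2 : ℝ) • (G + G'))
  have h2 := hG' ((1 / 2 : ℝ) • (G + G'))
  simp only [map_add, map_sub, map_smul, LinearMap.add_apply, LinearMap.sub_apply,
    LinearMap.smul_apply, smul_eq_mul, hsymm G' G] at h1 h2 ⊢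
  linarith

theorem IsNearMin.sqrt_le (hG : IsNearMin B L δ G) (hsymm : ∀ u v, B u v = B v u)
    (hpos : ∀ u, 0 ≤ B u u) (hL : ∀ ψ, L ψ ≤ N * √(B ψ ψ)) (hN : 0 ≤ N) (hδ : 0 ≤ δ) :
    √(B G G) ≤ N + δ := by
  have h1 := (abs_le.1 (hG.abs_sub_le hsymm hδ G)).2
  have h2 := Real.sq_sqrt (hpos G)
  have h3 := hL G
  have h4 := Real.sqrt_nonneg (B G G)
  by_contra! h5
  nlinarith

end Minimization

section Sobolev

variable {d : ℕ} {U : Set (Euc d)} {h : ℝ} {ψ u : Euc d → ℂ}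

theorem IsTest.add (hu : IsTest U u) (hψ : IsTest U ψ) : IsTest U (u + ψ) :=
  ⟨hu.1.add hψ.1, hu.2.1.add hψ.2.1,
    (tsupport_add u ψ).trans (union_subset hu.2.2 hψ.2.2)⟩

theorem IsTest.smul (hψ : IsTest U ψ) (a : ℝ) : IsTest U (a • ψ) :=
  ⟨hψ.1.const_smul a, hψ.2.1.smul_left (f := fun _ => a),
    (closure_mono (Function.support_const_smul_subset a ψ)).trans hψ.2.2⟩

theorem isTest_zero : IsTest U (0 : Euc d → ℂ) :=
  ⟨contDiff_const, HasCompactSupport.zero, by simp [tsupport]⟩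

/-- The space `C_c^∞(U; ℂ)`. -/
def testSpace (U : Set (Euc d)) : Submodule ℝ (Euc d → ℂ) where
  carrier := {ψ | IsTest U ψ}
  add_mem' := IsTest.add
  zero_mem' := isTest_zero
  smul_mem' a _ hψ := hψ.smul a

theorem IsTest.integrable_inner (hu : ContDiff ℝ (⊤ : ℕ∞) u) (hψ : IsTest U ψ) :
    Integrable fun x => inner ℝ (u x) (ψ x) :=
  (hu.continuous.inner hψ.1.continuous).integrable_of_hasCompactSupport
    (hψ.2.1.mono fun x hx => by
      contrapose! hx
      simp [Function.notMem_support.1 hx])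

theorem IsTest.integrable_gradInner (hu : ContDiff ℝ (⊤ : ℕ∞) u) (hψ : IsTest U ψ) :
    Integrable fun x => gradInner u ψ x :=
  (continuous_gradInner hu hψ.1).integrable_of_hasCompactSupport
    (hψ.2.1.mono' fun x hx => by
      by_contra h1
      exact hx (by simp [gradInner, pd_eq_zero_of_notMem_tsupport h1]))

/-- The real part of the semiclassical `H¹` inner product. -/
def h1Inner (h : ℝ) (u ψ : Euc d → ℂ) : ℝ :=
  (∫ x, inner ℝ (u x) (ψ x)) + h ^ 2 * ∫ x, gradInner u ψ x

theorem h1Inner_comm (h : ℝ) (u ψ : Euc d → ℂ) : h1Inner h u ψ = h1Inner h ψ u := by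
  simp only [h1Inner, gradInner, real_inner_comm]

theorem h1Inner_add_left {u' : Euc d → ℂ} (h : ℝ) (hu : ContDiff ℝ (⊤ : ℕ∞) u)
    (hu' : ContDiff ℝ (⊤ : ℕ∞) u') (hψ : IsTest U ψ) :
    h1Inner h (u + u') ψ = h1Inner h u ψ + h1Inner h u' ψ := by
  have h1 : ∀ x, gradInner (u + u') ψ x = gradInner u ψ x + gradInner u' ψ x := fun x => by
    simp only [gradInner, ← Finset.sum_add_distrib]
    refine Finset.sum_congr rfl fun j _ => ?_
    rw [← inner_add_left, ← pd_add (hu.differentiableAt_top x) (hu'.differentiableAt_top x)]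
    rfl
  simp only [h1Inner, h1, Pi.add_apply, inner_add_left]
  rw [integral_add (hψ.integrable_inner hu) (hψ.integrable_inner hu'),
    integral_add (hψ.integrable_gradInner hu) (hψ.integrable_gradInner hu')]
  ring

theorem h1Inner_smul_left (h a : ℝ) (hu : ContDiff ℝ (⊤ : ℕ∞) u) :
    h1Inner h (a • u) ψ = a * h1Inner h u ψ := by
  have h1 : ∀ x, gradInner (a • u) ψ x = a * gradInner u ψ x := fun x => by
    simp only [gradInner, Finset.mul_sum]
    refine Finset.sum_congr rfl fun j _ => ?_
    rw [← real_inner_smul_left, ← pd_const_smul (hu.differentiableAt_top x)]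
    rfl
  simp only [h1Inner, h1, Pi.smul_apply, real_inner_smul_left, integral_const_mul]
  ring

/-- The semiclassical `H¹` inner product as a bilinear form on test functions. -/
def h1Form (h : ℝ) (U : Set (Euc d)) : testSpace U →ₗ[ℝ] testSpace U →ₗ[ℝ] ℝ :=
  LinearMap.mk₂ ℝ (fun u ψ => h1Inner h u.1 ψ.1)
    (fun u u' ψ => h1Inner_add_left h u.2.1 u'.2.1 ψ.2)
    (fun a u _ => h1Inner_smul_left h a u.2.1)
    (fun u ψ ψ' => by
      rw [h1Inner_comm, h1Inner_comm h u.1, h1Inner_comm h u.1]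
      exact h1Inner_add_left h ψ.2.1 ψ'.2.1 u.2)
    (fun a u ψ => by
      rw [h1Inner_comm, h1Inner_comm h u.1]
      exact h1Inner_smul_left h a ψ.2.1)

theorem h1Inner_self (h : ℝ) (u : Euc d → ℂ) :
    h1Inner h u u = (∫ x, ‖u x‖ ^ 2) + h ^ 2 * ∫ x, gradSq u x := by
  simp only [h1Inner, gradInner_self, real_inner_self_eq_norm_sq]

theorem h1Inner_self_nonneg (h : ℝ) (u : Euc d → ℂ) : 0 ≤ h1Inner h u u := by
  rw [h1Inner_self]
  have h1 : 0 ≤ ∫ x, ‖u x‖ ^ 2 := integral_nonneg fun x => by positivity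
  have h2 : 0 ≤ ∫ x, gradSq u x := integral_nonneg (gradSq_nonneg u)
  positivity

theorem H1norm_eq (hψ : IsTest U ψ) : H1norm h U ψ = √(h1Inner h ψ ψ) := by
  rw [h1Inner_self, H1norm, setIntegral_eq_integral_of_forall_compl_eq_zero,
    setIntegral_eq_integral_of_forall_compl_eq_zero]
  · rfl
  · intro x hx
    exact gradSq_eq_zero_of_notMem_tsupport (u := ψ) fun h1 => hx (hψ.2.2 h1)
  · intro x hx
    simp [image_eq_zero_of_notMem_tsupport fun h1 => hx (hψ.2.2 h1)]

theorem IsTest.integrable_norm_sq (hψ : IsTest U ψ) : Integrable fun x => ‖ψ x‖ ^ 2 := by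
  simpa only [real_inner_self_eq_norm_sq] using hψ.integrable_inner hψ.1

theorem IsTest.integrable_gradSq (hψ : IsTest U ψ) : Integrable fun x => gradSq ψ x := by
  simpa only [gradInner_self] using hψ.integrable_gradInner hψ.1

theorem Hneg1norm_nonneg (h : ℝ) (U : Set (Euc d)) (L : Euc d → ℂ) : 0 ≤ Hneg1norm h U L := by
  refine Real.sSup_nonneg ?_
  rintro _ ⟨ψ, -, -, rfl⟩
  positivity

theorem norm_integral_le_Hneg1norm_mul {L : Euc d → ℂ} (hL : Integrable fun x => ‖L x‖ ^ 2)
    (hψ : IsTest U ψ) :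
    ‖∫ x in U, L x * (starRingEnd ℂ) (ψ x)‖ ≤ Hneg1norm h U L * √(h1Inner h ψ ψ) := by
  have hbdd : BddAbove {r : ℝ | ∃ ψ : Euc d → ℂ, IsTest U ψ ∧ H1norm h U ψ ≤ 1 ∧
      r = ‖∫ x in U, L x * (starRingEnd ℂ) (ψ x)‖} := by
    refine ⟨(∫ x in U, ‖L x‖ ^ 2) + 1, ?_⟩
    rintro _ ⟨χ, hχ, hχ1, rfl⟩
    have i1 := hχ.integrable_norm_sq.integrableOn (s := U)
    have h2 : ∫ x in U, ‖χ x‖ ^ 2 ≤ 1 := by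
      have h3 : 0 ≤ ∫ x in U, ∑ j, ‖pd j χ x‖ ^ 2 := integral_nonneg fun x => by positivity
      have h4 := (Real.sqrt_le_one).1 hχ1
      nlinarith [mul_nonneg (sq_nonneg h) h3]
    calc ‖∫ x in U, L x * (starRingEnd ℂ) (χ x)‖
        ≤ ∫ x in U, (‖L x‖ ^ 2 + ‖χ x‖ ^ 2) := by
          refine norm_integral_le_of_norm_le (hL.integrableOn.add i1) (.of_forall fun x => ?_)
          rw [norm_mul, RCLike.norm_conj]
          nlinarith [sq_nonneg (‖L x‖ - ‖χ x‖), sq_nonneg ‖L x‖, sq_nonneg ‖χ x‖]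
      _ = (∫ x in U, ‖L x‖ ^ 2) + ∫ x in U, ‖χ x‖ ^ 2 := integral_add hL.integrableOn i1
      _ ≤ _ := by gcongr
  have hN := Hneg1norm_nonneg h U L
  set N := Hneg1norm h U L with hNd
  set I := ‖∫ x in U, L x * (starRingEnd ℂ) (ψ x)‖ with hI
  have ha := Real.sqrt_nonneg (h1Inner h ψ ψ)
  have hscale : ∀ t : ℝ, 0 < t → t * √(h1Inner h ψ ψ) ≤ 1 → t * I ≤ N := by
    intro t ht h1
    refine le_csSup hbdd ⟨t • ψ, hψ.smul t, ?_, ?_⟩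
    · rw [H1norm_eq (hψ.smul t), h1Inner_smul_left h t hψ.1, h1Inner_comm,
        h1Inner_smul_left h t hψ.1, ← mul_assoc, Real.sqrt_mul (by positivity),
        Real.sqrt_mul_self ht.le]
      exact h1
    · simp only [Pi.smul_apply, real_smul, map_mul, conj_ofReal]
      simp only [mul_left_comm (L _)]
      rw [integral_const_mul, norm_mul, Complex.norm_of_nonneg ht.le]
  refine le_of_forall_pos_le_add fun ε hε => ?_
  set η := ε / (N + 1) with hη
  have hη0 : 0 < η := by positivity
  have h1 := hscale (√(h1Inner h ψ ψ) + η)⁻¹ (by positivity) (by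
    rw [inv_mul_le_iff₀ (by positivity)]; linarith)
  rw [inv_mul_le_iff₀ (by positivity)] at h1
  have h2 : η * N ≤ ε := by
    rw [hη, div_mul_eq_mul_div, div_le_iff₀ (by positivity)]
    nlinarith
  nlinarith

/-- Approximate solutions `G` of `G - h² Δ G = L` in `C_c^∞(U)`: a fixed one `G₁`, and arbitrarily
precise ones `G₂` close to it. -/
theorem exists_approx_resolvent {L : Euc d → ℂ} (hLm : AEStronglyMeasurable L)
    (hL : Integrable fun x => ‖L x‖ ^ 2) (h : ℝ) {δ : ℝ} (hδ : 0 < δ) :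
    ∃ G₁, IsTest U G₁ ∧ ∀ δ', 0 < δ' → δ' ≤ δ → ∃ G₂, IsTest U G₂ ∧
      h1Inner h (G₂ - G₁) (G₂ - G₁) ≤ 4 * δ ^ 2 ∧
      √(h1Inner h G₂ G₂) ≤ Hneg1norm h U L + δ ∧
      ∀ ψ, IsTest U ψ → |h1Inner h G₂ ψ - ∫ x, inner ℝ (L x) (ψ x)| ≤
        δ' * √(h1Inner h ψ ψ) := by
  have hint : ∀ ψ : testSpace U, Integrable fun x => inner ℝ (L x) (ψ.1 x) := fun ψ => by
    refine Integrable.mono' (hL.add (IsTest.integrable_norm_sq ψ.2))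
      (hLm.inner (ContDiff.continuous ψ.2.1).aestronglyMeasurable) (.of_forall fun x => ?_)
    have := abs_real_inner_le_norm (L x) (ψ.1 x)
    rw [Real.norm_eq_abs, Pi.add_apply]
    nlinarith [sq_nonneg (‖L x‖ - ‖ψ.1 x‖), sq_nonneg ‖L x‖, sq_nonneg ‖ψ.1 x‖]
  let Λ : testSpace U →ₗ[ℝ] ℝ :=
    { toFun := fun ψ => ∫ x, inner ℝ (L x) (ψ.1 x)
      map_add' := fun ψ ψ' => by
        rw [← integral_add (hint ψ) (hint ψ')]
        simp [inner_add_right]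
      map_smul' := fun a ψ => by
        simp only [Submodule.coe_smul, Pi.smul_apply, real_inner_smul_right, integral_const_mul,
          RingHom.id_apply, smul_eq_mul] }
  have hΛ : ∀ ψ, Λ ψ ≤ Hneg1norm h U L * √(h1Form h U ψ ψ) := fun ψ => by
    refine le_trans ?_ (norm_integral_le_Hneg1norm_mul hL ψ.2)
    rw [setIntegral_eq_integral_of_forall_compl_eq_zero (fun x hx => by
      simp [image_eq_zero_of_notMem_tsupport fun h1 => hx (ψ.2.2.2 h1)])]
    refine le_trans (le_of_eq ?_) (Complex.re_le_norm _)
    have i1 : Integrable fun x => L x * (starRingEnd ℂ) (ψ.1 x) := by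
      refine Integrable.mono' (hL.add (IsTest.integrable_norm_sq ψ.2))
        (hLm.mul (continuous_conj.comp (ContDiff.continuous ψ.2.1)).aestronglyMeasurable)
        (.of_forall fun x => ?_)
      rw [norm_mul, RCLike.norm_conj, Pi.add_apply]
      nlinarith [sq_nonneg (‖L x‖ - ‖ψ.1 x‖), sq_nonneg ‖L x‖, sq_nonneg ‖ψ.1 x‖]
    have h2 : (∫ x, L x * (starRingEnd ℂ) (ψ.1 x)).re = ∫ x, (L x * (starRingEnd ℂ) (ψ.1 x)).re :=
      (integral_re i1).symm
    rw [h2]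
    refine integral_congr_ae (.of_forall fun x => ?_)
    simp [Complex.inner, mul_comm]
  have hsymm : ∀ u v, h1Form h U u v = h1Form h U v u := fun u v => h1Inner_comm h u.1 v.1
  have hpos : ∀ u, 0 ≤ h1Form h U u u := fun u => h1Inner_self_nonneg h u.1
  obtain ⟨G₁, hG₁⟩ := exists_isNearMin hpos hΛ hδ
  refine ⟨G₁.1, G₁.2, fun δ' hδ' hle => ?_⟩
  obtain ⟨G₂, hG₂⟩ := exists_isNearMin hpos hΛ hδ'
  refine ⟨G₂.1, G₂.2, ?_, ?_, fun ψ hψ => hG₂.abs_sub_le hsymm hδ'.le ⟨ψ, hψ⟩⟩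
  · have h1 : h1Inner h (G₂.1 - G₁.1) (G₂.1 - G₁.1) ≤ _ := hG₁.sub_le hG₂ hsymm
    nlinarith
  · have h1 : √(h1Inner h G₂.1 G₂.1) ≤ _ :=
      hG₂.sqrt_le hsymm hpos hΛ (Hneg1norm_nonneg h U L) hδ'.le
    linarith

end Sobolev

section Conjugation

variable {d : ℕ} {c : ℝ} {s : Euc d → ℝ}

/-- The inverse of the exponential weight `exp ((s + κ s² / 2) / h)`. -/
def expWeight (h κ : ℝ) (s : Euc d → ℝ) : Euc d → ℝ := fun x =>
  Real.exp (-((s x + κ / 2 * s x ^ 2) / h))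

/-- The part of the conjugated operator which is of order `h`. -/
def lowerOp (h κ : ℝ) (s : Euc d → ℝ) (W : Euc d → Euc d) (q : Euc d → ℂ) (z : Euc d → ℂ) :
    Euc d → ℂ := fun x =>
  (h ^ 2 * (2 - (d : ℝ))) • euler z x +
    (h * κ + h * (1 + κ * s x) * ((d : ℝ) - 2)) • z x +
    (h ^ 2 * ‖x‖ ^ 2) •
      (-(2 * Complex.I * ∑ j, ((W x j : ℝ) : ℂ) *
          (pd j z x - ((1 + κ * s x) / h * pd j s x) • z x)) -
        Complex.I * (((∑ j, pd j (fun y => W y j) x) : ℝ) : ℂ) * z x +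
        ((((‖W x‖ ^ 2 : ℝ)) : ℂ) + q x) * z x)

theorem contDiff_expWeight (hs : IsLogRadius c s) (h κ : ℝ) :
    ContDiff ℝ (⊤ : ℕ∞) (expWeight h κ s) :=
  Real.contDiff_exp.comp
    (((hs.smooth.add (contDiff_const.mul (hs.smooth.pow 2))).div_const h).neg)

theorem pd_expWeight (hs : IsLogRadius c s) (h κ : ℝ) (j : Fin d) (x : Euc d) :
    pd j (expWeight h κ s) x =
      -(expWeight h κ s x * ((1 + κ * s x) / h * pd j s x)) := by
  have h1 := (hs.smooth.differentiableAt_top x).hasFDerivAt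
  have h2 : HasFDerivAt (expWeight h κ s) _ x :=
    (((h1.add ((h1.pow 2).const_mul (κ / 2))).mul_const h⁻¹).neg).exp
  rw [pd, h2.fderiv]
  simp [pd, expWeight, div_eq_mul_inv]
  ring

theorem lap_expWeight (hs : IsLogRadius c s) {h : ℝ} (hh : h ≠ 0) (κ : ℝ) {x : Euc d}
    (hx : c < ‖x‖) :
    h ^ 2 * ‖x‖ ^ 2 * lap (expWeight h κ s) x =
      expWeight h κ s x *
        ((1 + κ * s x) ^ 2 - h * κ - h * (1 + κ * s x) * ((d : ℝ) - 2)) := by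
  have h1 : ∀ j, pd j (pd j (expWeight h κ s)) x = expWeight h κ s x *
      (((1 + κ * s x) / h) ^ 2 * (pd j s x * pd j s x) - κ / h * (pd j s x * pd j s x) -
        (1 + κ * s x) / h * pd j (pd j s) x) := fun j => by
    have e1 : pd j (expWeight h κ s) = fun y =>
        expWeight h κ s y * (h⁻¹ * (-(1 + κ * s y) * pd j s y)) := by
      ext y
      rw [pd_expWeight hs]
      ring
    have d1 := (contDiff_expWeight hs h κ).differentiableAt_top x
    have d2 : DifferentiableAt ℝ (fun y => -(1 + κ * s y)) x :=
      ((contDiff_const.add (contDiff_const.mul hs.smooth)).neg).differentiableAt_top x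
    have d3 := (hs.smooth.pd j).differentiableAt_top x
    have e2 : pd j (fun y => -(1 + κ * s y)) x = -(κ * pd j s x) := by
      rw [← hs.pd_affine κ x j]
      simp [pd, fderiv_fun_neg]
    have d4 : DifferentiableAt ℝ (fun y => -(1 + κ * s y) * pd j s y) x := d2.mul d3
    have d5 : DifferentiableAt ℝ (fun y => h⁻¹ * (-(1 + κ * s y) * pd j s y)) x :=
      d4.const_mul _
    rw [e1, pd_mul_real d1 d5, pd_expWeight hs]
    have e3 : pd j (fun y => h⁻¹ * (-(1 + κ * s y) * pd j s y)) x =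
        h⁻¹ * (-(1 + κ * s x) * pd j (pd j s) x + -(κ * pd j s x) * pd j s x) := by
      rw [← e2, ← pd_mul_real d2 d3]
      exact pd_const_smul d4 h⁻¹ j
    rw [e3]
    ring
  have e1 := hs.sum_pd_sq hx
  have e2 := hs.lap_eq hx
  rw [lap] at e2
  rw [lap, Finset.sum_congr rfl fun j _ => h1 j, ← Finset.mul_sum, Finset.sum_sub_distrib,
    Finset.sum_sub_distrib, ← Finset.mul_sum, ← Finset.mul_sum, ← Finset.mul_sum]
  have e3 : ∀ A D : ℝ, h ^ 2 * ‖x‖ ^ 2 * (expWeight h κ s x *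
      (((1 + κ * s x) / h) ^ 2 * A - κ / h * A - (1 + κ * s x) / h * D)) =
      expWeight h κ s x * ((1 + κ * s x) ^ 2 * (‖x‖ ^ 2 * A) - h * κ * (‖x‖ ^ 2 * A) -
        h * (1 + κ * s x) * (‖x‖ ^ 2 * D)) := fun A D => by field_simp
  rw [e3, e1, e2]
  ring

theorem magSchrodinger_expWeight_smul (hs : IsLogRadius c s) {h : ℝ} (hh : h ≠ 0) (κ : ℝ)
    (W : Euc d → Euc d) (q : Euc d → ℂ) {z : Euc d → ℂ} (hz : ContDiff ℝ (⊤ : ℕ∞) z)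
    {x : Euc d} (hx : c < ‖x‖) :
    (h ^ 2 * ‖x‖ ^ 2) • magSchrodinger W q (fun y => expWeight h κ s y • z y) x =
      expWeight h κ s x • (carlemanOp h κ s z x + lowerOp h κ s W q z x) := by
  have hB := contDiff_expWeight hs h κ
  have h1 : ∀ j, pd j (fun y => expWeight h κ s y • z y) x =
      expWeight h κ s x • (pd j z x - ((1 + κ * s x) / h * pd j s x) • z x) := fun j => by
    rw [pd_smul (hB.differentiableAt_top x) (hz.differentiableAt_top x), pd_expWeight hs]
    module
  have h2 : ∑ j, pd j (pd j (fun y => expWeight h κ s y • z y)) x =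
      expWeight h κ s x • lap z x + (2 : ℝ) • ∑ j, pd j (expWeight h κ s) x • pd j z x +
        lap (expWeight h κ s) x • z x := lap_smul hB hz x
  have h3 : ‖x‖ ^ 2 • ∑ j, pd j (expWeight h κ s) x • pd j z x =
      -((expWeight h κ s x * ((1 + κ * s x) / h)) • euler z x) := by
    rw [← hs.sum_pd_smul hx z]
    simp only [Finset.smul_sum, ← Finset.sum_neg_distrib, pd_expWeight hs]
    refine Finset.sum_congr rfl fun j _ => ?_
    module
  have h4 : (h ^ 2 * ‖x‖ ^ 2) • ∑ j, pd j (pd j (fun y => expWeight h κ s y • z y)) x =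
      expWeight h κ s x • ((h ^ 2 * ‖x‖ ^ 2) • lap z x - (2 * h * (1 + κ * s x)) • euler z x +
        ((1 + κ * s x) ^ 2 - h * κ - h * (1 + κ * s x) * ((d : ℝ) - 2)) • z x) := by
    have e1 : (h ^ 2 * ‖x‖ ^ 2) • (lap (expWeight h κ s) x • z x) =
        (expWeight h κ s x *
          ((1 + κ * s x) ^ 2 - h * κ - h * (1 + κ * s x) * ((d : ℝ) - 2))) • z x := by
      rw [smul_smul, lap_expWeight hs hh κ hx]
    have e2 : (h ^ 2 * ‖x‖ ^ 2) • ((2 : ℝ) • ∑ j, pd j (expWeight h κ s) x • pd j z x) =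
        -((expWeight h κ s x * (2 * h * (1 + κ * s x))) • euler z x) := by
      have : (h ^ 2 * ‖x‖ ^ 2) • ((2 : ℝ) • ∑ j, pd j (expWeight h κ s) x • pd j z x) =
          (2 * h ^ 2) • (‖x‖ ^ 2 • ∑ j, pd j (expWeight h κ s) x • pd j z x) := by module
      rw [this, h3, smul_neg, smul_smul]
      congr 2
      field_simp
    rw [h2, smul_add, smul_add, e1, e2]
    module
  have h5 : ∑ j, ((W x j : ℝ) : ℂ) * pd j (fun y => expWeight h κ s y • z y) x =
      (expWeight h κ s x : ℂ) * ∑ j, ((W x j : ℝ) : ℂ) *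
        (pd j z x - ((1 + κ * s x) / h * pd j s x) • z x) := by
    simp only [h1, Finset.mul_sum]
    exact Finset.sum_congr rfl fun j _ => by
      rw [real_smul]
      ring
  rw [magSchrodinger, h5]
  simp only [carlemanOp, lowerOp]
  generalize (∑ j, ((W x j : ℝ) : ℂ) * (pd j z x - ((1 + κ * s x) / h * pd j s x) • z x)) = A
  generalize (∑ j, pd j (fun y => W y j) x) = D
  simp only [real_smul] at h4 ⊢
  push_cast at h4 ⊢
  linear_combination -h4

theorem IsTest.isTestOff {U : Set (Euc d)} {w : Euc d → ℂ} (hw : IsTest U w)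
    (hU : ∀ x ∈ U, c < ‖x‖) : IsTestOff c w :=
  ⟨hw.1, hw.2.1, fun x hx => hU x (hw.2.2 hx)⟩

theorem conjOp_eq_zero_of_notMem_tsupport (h : ℝ) (W : Euc d → Euc d) (q : Euc d → ℂ)
    {w : Euc d → ℂ} {x : Euc d} (hx : x ∉ tsupport w) : conjOp h W q w x = 0 := by
  have h1 : (fun y => Complex.exp (((-(carlWeight y / h) : ℝ) : ℂ)) * w y) =ᶠ[𝓝 x] 0 := by
    filter_upwards [notMem_tsupport_iff_eventuallyEq.1 hx] with y hy
    simp [hy]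
  have h2 : ∀ j, pd j (pd j (0 : Euc d → ℂ)) x = 0 := fun j => by
    rw [show pd j (0 : Euc d → ℂ) = 0 from funext (pd_zero j), pd_zero]
  simp only [conjOp, magSchrodinger, h1.pd_eq, (h1.pd _).pd_eq, pd_zero, h2,
    image_eq_zero_of_notMem_tsupport hx]
  simp

/-- The conjugated operator in terms of the model operator, after the additional conjugation by
`ρ = exp (κ s² / (2h))`. -/
theorem conjOp_eq (hs : IsLogRadius c s) {h : ℝ} (hh : h ≠ 0) (κ : ℝ)
    (W : Euc d → Euc d) (q : Euc d → ℂ) {w : Euc d → ℂ} (hw : IsTestOff c w) {ρ : Euc d → ℝ}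
    (hρs : ContDiff ℝ (⊤ : ℕ∞) ρ)
    (hρ : ∀ x ∈ tsupport w, ρ x = Real.exp (κ / 2 * s x ^ 2 / h)) {x : Euc d} (hx : c < ‖x‖) :
    (‖x‖ ^ 2 * ρ x) • conjOp h W q w x =
      carlemanOp h κ s (fun y => ρ y • w y) x + lowerOp h κ s W q (fun y => ρ y • w y) x := by
  have h1 : (fun y => Complex.exp (((-(carlWeight y / h) : ℝ) : ℂ)) * w y) =
      fun y => expWeight h κ s y • (ρ y • w y) := by
    ext y
    by_cases hy : y ∈ tsupport w
    · rw [smul_smul, real_smul, hρ y hy, expWeight, ← Real.exp_add, ← Complex.ofReal_exp,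
        carlWeight, ← hs.eq_log y (hw.supp y hy)]
      congr 4
      field_simp
      ring
    · simp [image_eq_zero_of_notMem_tsupport hy]
  have h2 := magSchrodinger_expWeight_smul hs hh κ W q (z := fun y => ρ y • w y) (hρs.smul hw.smooth) hx
  by_cases hy : x ∈ tsupport w
  · have h3 : (‖x‖ ^ 2 * ρ x) • conjOp h W q w x =
        (expWeight h κ s x)⁻¹ • ((h ^ 2 * ‖x‖ ^ 2) • magSchrodinger W q
          (fun y => expWeight h κ s y • (ρ y • w y)) x) := by
      rw [conjOp, h1, expWeight, ← Real.exp_neg, hρ x hy, ← Complex.ofReal_exp,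
        carlWeight, ← hs.eq_log x hx, smul_smul]
      have : Real.exp (- -((s x + κ / 2 * s x ^ 2) / h)) =
          Real.exp (κ / 2 * s x ^ 2 / h) * Real.exp (s x / h) := by
        rw [← Real.exp_add]
        congr 1
        field_simp
        ring
      rw [this]
      simp only [real_smul]
      push_cast
      ring
    rw [h3, h2, smul_smul, expWeight, inv_mul_cancel₀ (Real.exp_pos _).ne', one_smul]
  · have h4 : x ∉ tsupport fun y => ρ y • w y := fun h5 =>
      hy (closure_mono (Function.support_smul_subset_right ρ w) h5)
    have h0 : ∀ j, pd j (fun y => ρ y • w y) x = 0 := fun j => pd_eq_zero_of_notMem_tsupport h4 j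
    have h6 := image_eq_zero_of_notMem_tsupport h4
    rw [conjOp_eq_zero_of_notMem_tsupport h W q hy]
    simp only [carlemanOp, lowerOp, lap_eq_zero_of_notMem_tsupport h4,
      euler_eq_zero_of_notMem_tsupport h4, h0, h6]
    simp

end Conjugation

section Bounds

variable {d : ℕ} {F : Type*} [NormedAddCommGroup F] [NormedSpace ℝ F]

theorem norm_euler_le (u : Euc d → F) (x : Euc d) : ‖euler u x‖ ≤ ‖x‖ * √(gradSq u x) := by
  refine le_of_sq_le_sq ?_ (by positivity)
  rw [mul_pow, Real.sq_sqrt (gradSq_nonneg u x)]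
  exact norm_sq_euler_le u x

theorem sqrt_gradSq_le {u : Euc d → F} {x : Euc d} {B : ℝ} (h : ∀ j, ‖pd j u x‖ ≤ B) :
    √(gradSq u x) ≤ d * B := by
  rcases Nat.eq_zero_or_pos d with rfl | hd
  · simp [gradSq]
  have hB : 0 ≤ B := (norm_nonneg _).trans (h ⟨0, hd⟩)
  have hd1 : (1 : ℝ) ≤ d := by exact_mod_cast hd
  refine Real.sqrt_le_iff.2 ⟨by positivity, ?_⟩
  calc gradSq u x ≤ ∑ _j : Fin d, B ^ 2 :=
        Finset.sum_le_sum fun j _ => pow_le_pow_left₀ (norm_nonneg _) (h j) 2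
    _ = d * B ^ 2 := by simp
    _ ≤ (d * B) ^ 2 := by nlinarith [sq_nonneg B]

theorem exists_bound_derivatives {m : Euc d → ℝ} (hm : ContDiff ℝ (⊤ : ℕ∞) m)
    (hmc : HasCompactSupport m) :
    ∃ K > 0, ∀ x, |m x| ≤ K ∧ (∀ j, |pd j m x| ≤ K) ∧ |lap m x| ≤ K := by
  have hb : ∀ g : Euc d → ℝ, Continuous g → (∀ x, x ∉ tsupport m → g x = 0) →
      ∃ C, ∀ x, ‖g x‖ ≤ C := fun g hg h =>
    hg.bounded_above_of_compact_support (hmc.mono' fun x hx => by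
      by_contra h1
      exact hx (h x h1))
  obtain ⟨K₁, h1⟩ := hb m hm.continuous fun x hx => image_eq_zero_of_notMem_tsupport hx
  choose K₂ h2 using fun j => hb (pd j m) (hm.pd j).continuous fun x hx =>
    pd_eq_zero_of_notMem_tsupport hx j
  obtain ⟨K₃, h3⟩ := hb (lap m) hm.lap.continuous fun x hx => lap_eq_zero_of_notMem_tsupport hx
  have p1 := (norm_nonneg _).trans (h1 0)
  have p2 := fun j => (norm_nonneg _).trans (h2 j 0)
  have p3 := (norm_nonneg _).trans (h3 0)
  have p4 : 0 ≤ ∑ j, K₂ j := Finset.sum_nonneg fun j _ => p2 j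
  refine ⟨K₁ + ∑ j, K₂ j + K₃ + 1, by positivity, fun x => ⟨?_, fun j => ?_, ?_⟩⟩
  · exact (h1 x).trans (by linarith)
  · have := Finset.single_le_sum (f := K₂) (fun j _ => p2 j) (Finset.mem_univ j)
    exact (h2 j x).trans (by linarith)
  · exact (h3 x).trans (by linarith)

theorem exists_smul_bound {m : Euc d → ℝ} (hm : ContDiff ℝ (⊤ : ℕ∞) m)
    (hmc : HasCompactSupport m) :
    ∃ K > 0, ∀ u : Euc d → F, ContDiff ℝ (⊤ : ℕ∞) u → ∀ x, ‖m x • u x‖ ≤ K * ‖u x‖ ∧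
      √(gradSq (fun y => m y • u y) x) ≤ K * (‖u x‖ + √(gradSq u x)) := by
  obtain ⟨K, hK, h⟩ := exists_bound_derivatives hm hmc
  refine ⟨(d + 1) * K, by positivity, fun u hu x => ⟨?_, ?_⟩⟩
  · rw [norm_smul]
    have : K ≤ (d + 1) * K := by nlinarith [(Nat.cast_nonneg d : (0 : ℝ) ≤ d)]
    exact mul_le_mul_of_nonneg_right ((h x).1.trans this) (norm_nonneg _)
  · refine (sqrt_gradSq_le (B := K * (‖u x‖ + √(gradSq u x))) fun j => ?_).trans ?_
    · rw [pd_smul (hm.differentiableAt_top x) (hu.differentiableAt_top x)]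
      refine (norm_add_le _ _).trans ?_
      rw [norm_smul, norm_smul]
      have h1 := mul_le_mul (h x).1 (norm_pd_le_sqrt_gradSq u j x) (norm_nonneg _) hK.le
      have h2 := mul_le_mul_of_nonneg_right ((h x).2.1 j) (norm_nonneg (u x))
      simp only [Real.norm_eq_abs]
      linarith
    · have := Real.sqrt_nonneg (gradSq u x)
      have : 0 ≤ K * (‖u x‖ + √(gradSq u x)) := by positivity
      linarith

end Bounds

section LowerOrder

variable {d : ℕ} {c : ℝ} {s : Euc d → ℝ}

theorem IsLogRadius.norm_mul_abs_pd_le (hs : IsLogRadius c s) {x : Euc d} (hx : c < ‖x‖)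
    (j : Fin d) : ‖x‖ * |pd j s x| ≤ 1 := by
  have h0 : 0 < ‖x‖ := hs.pos.trans hx
  have h1 : |x j| ≤ ‖x‖ := PiLp.norm_apply_le x j
  rw [hs.pd_eq hx, abs_div, abs_of_pos (by positivity : 0 < ‖x‖ ^ 2)]
  have h2 : ‖x‖ * (|x j| / ‖x‖ ^ 2) = |x j| / ‖x‖ := by field_simp
  rw [h2]
  exact (div_le_one h0).2 h1

theorem exists_potential_bound {W : Euc d → Euc d} (hW : ContDiff ℝ 2 W) {q : Euc d → ℂ}
    (hq : ∃ M : ℝ, ∀ x, ‖q x‖ ≤ M) (R : ℝ) :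
    ∃ B > 0, ∀ x : Euc d, ‖x‖ ≤ R →
      ‖W x‖ ≤ B ∧ |∑ j, pd j (fun y => W y j) x| ≤ B ∧ ‖q x‖ ≤ B := by
  obtain ⟨M, hM⟩ := hq
  have hdiv : Continuous fun x => ∑ j, pd j (fun y => W y j) x :=
    continuous_finsetSum _ fun j _ =>
      ((((contDiff_euclidean (n := 2)).1 hW j).continuous_fderiv (by simp)).clm_apply
        continuous_const)
  obtain ⟨B₁, h1⟩ := (isCompact_closedBall (0 : Euc d) R).exists_bound_of_continuousOn
    hW.continuous.continuousOn
  obtain ⟨B₂, h2⟩ := (isCompact_closedBall (0 : Euc d) R).exists_bound_of_continuousOn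
    hdiv.continuousOn
  refine ⟨max 1 (max B₁ (max B₂ M)), by positivity, fun x hx => ?_⟩
  have hx' : x ∈ Metric.closedBall (0 : Euc d) R := by simpa using hx
  refine ⟨(h1 x hx').trans ?_, (h2 x hx').trans ?_, (hM x).trans ?_⟩ <;> simp

theorem exists_norm_lowerOp_le (hs : IsLogRadius c s) {W : Euc d → Euc d} (hW : ContDiff ℝ 2 W)
    {q : Euc d → ℂ} (hq : ∃ M : ℝ, ∀ x, ‖q x‖ ≤ M) {R : ℝ} (hR : 0 < R) :
    ∃ C > 0, ∀ h κ : ℝ, 0 < h → h ≤ 1 → 0 < κ → κ ≤ 1 → ∀ x : Euc d, c < ‖x‖ → ‖x‖ ≤ R →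
      |κ * s x| ≤ 1 / 4 → ∀ z : Euc d → ℂ,
      ‖lowerOp h κ s W q z x‖ ≤ C * h * (‖z x‖ + h * (‖x‖ * √(gradSq z x))) := by
  obtain ⟨B, hB, hWB⟩ := exists_potential_bound hW hq R
  refine ⟨(1 + 2 * (d + 2)) + 2 * d * B * R + 4 * d * B * R + R ^ 2 * (2 * B + B ^ 2),
    by positivity, ?_⟩
  intro h κ hh hh1 hκ hκ1 x hx hxR hκs z
  obtain ⟨hW1, hW2, hW3⟩ := hWB x hxR
  have hx0 : 0 < ‖x‖ := hs.pos.trans hx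
  have hd : (0 : ℝ) ≤ d := Nat.cast_nonneg d
  obtain ⟨hκ2, hκ3⟩ := abs_le.1 hκs
  set g := √(gradSq z x) with hg
  have hg0 : 0 ≤ g := Real.sqrt_nonneg _
  have hz0 := norm_nonneg (z x)
  have t1 : ‖(h ^ 2 * (2 - (d : ℝ))) • euler z x‖ ≤ h ^ 2 * (d + 2) * (‖x‖ * g) := by
    rw [norm_smul, Real.norm_eq_abs, abs_mul, abs_of_nonneg (sq_nonneg h)]
    have : |2 - (d : ℝ)| ≤ d + 2 := abs_le.2 ⟨by linarith, by linarith⟩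
    gcongr
    exact norm_euler_le z x
  have t2 : ‖(h * κ + h * (1 + κ * s x) * ((d : ℝ) - 2)) • z x‖ ≤
      h * (1 + 2 * (d + 2)) * ‖z x‖ := by
    rw [norm_smul, Real.norm_eq_abs]
    gcongr
    refine abs_le.2 ⟨?_, ?_⟩
    · have : 0 ≤ h * κ := by positivity
      have : -(2 * (d + 2)) ≤ (1 + κ * s x) * ((d : ℝ) - 2) := by nlinarith
      nlinarith
    · have : h * κ ≤ h := by nlinarith
      have : (1 + κ * s x) * ((d : ℝ) - 2) ≤ 2 * (d + 2) := by nlinarith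
      nlinarith
  have t3 : ∀ j, ‖((W x j : ℝ) : ℂ) * (pd j z x - ((1 + κ * s x) / h * pd j s x) • z x)‖ ≤
      B * (g + 2 / h * (‖x‖⁻¹ * ‖z x‖)) := fun j => by
    rw [norm_mul, Complex.norm_real]
    have e1 : ‖W x j‖ ≤ B := (PiLp.norm_apply_le (W x) j).trans hW1
    have e2 : |pd j s x| ≤ ‖x‖⁻¹ := by
      rw [← one_div, le_div_iff₀ hx0, mul_comm]
      exact hs.norm_mul_abs_pd_le hx j
    have e3 : |1 + κ * s x| ≤ 2 := abs_le.2 ⟨by linarith, by linarith⟩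
    refine mul_le_mul e1 ((norm_sub_le _ _).trans ?_) (norm_nonneg _) hB.le
    rw [norm_smul, Real.norm_eq_abs, abs_mul, abs_div, abs_of_pos hh, mul_assoc]
    have := norm_pd_le_sqrt_gradSq z j x
    gcongr
  have t4 : ‖∑ j, ((W x j : ℝ) : ℂ) * (pd j z x - ((1 + κ * s x) / h * pd j s x) • z x)‖ ≤
      d * (B * (g + 2 / h * (‖x‖⁻¹ * ‖z x‖))) := by
    refine (norm_sum_le_of_le _ fun j _ => t3 j).trans ?_
    simp
  have t5 : ‖(h ^ 2 * ‖x‖ ^ 2) •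
      (-(2 * Complex.I * ∑ j, ((W x j : ℝ) : ℂ) *
          (pd j z x - ((1 + κ * s x) / h * pd j s x) • z x)) -
        Complex.I * (((∑ j, pd j (fun y => W y j) x) : ℝ) : ℂ) * z x +
        ((((‖W x‖ ^ 2 : ℝ)) : ℂ) + q x) * z x)‖ ≤
      h ^ 2 * ‖x‖ ^ 2 * (2 * (d * (B * (g + 2 / h * (‖x‖⁻¹ * ‖z x‖)))) + B * ‖z x‖ +
        (B ^ 2 + B) * ‖z x‖) := by
    rw [norm_smul, Real.norm_of_nonneg (by positivity : 0 ≤ h ^ 2 * ‖x‖ ^ 2)]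
    gcongr
    refine (norm_add_le _ _).trans (add_le_add ((norm_sub_le _ _).trans (add_le_add ?_ ?_)) ?_)
    · rw [norm_neg, norm_mul]
      simp only [norm_mul, Complex.norm_I, mul_one, Complex.norm_ofNat]
      gcongr
    · rw [norm_mul, norm_mul, Complex.norm_I, one_mul, Complex.norm_real]
      gcongr
      exact hW2
    · rw [norm_mul]
      gcongr
      refine (norm_add_le _ _).trans (add_le_add ?_ hW3)
      rw [Complex.norm_real, Real.norm_of_nonneg (by positivity)]
      gcongr
  have t6 : h ^ 2 * ‖x‖ ^ 2 * (2 * (d * (B * (g + 2 / h * (‖x‖⁻¹ * ‖z x‖)))) + B * ‖z x‖ +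
        (B ^ 2 + B) * ‖z x‖) =
      2 * d * B * ‖x‖ * (h ^ 2 * (‖x‖ * g)) + 4 * d * B * ‖x‖ * (h * ‖z x‖) +
        h * ‖x‖ ^ 2 * (2 * B + B ^ 2) * (h * ‖z x‖) := by
    field_simp
    ring
  rw [t6] at t5
  have t7 : 2 * d * B * ‖x‖ * (h ^ 2 * (‖x‖ * g)) ≤ 2 * d * B * R * (h ^ 2 * (‖x‖ * g)) := by
    gcongr
  have t8 : 4 * d * B * ‖x‖ * (h * ‖z x‖) ≤ 4 * d * B * R * (h * ‖z x‖) := by gcongr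
  have t9 : h * ‖x‖ ^ 2 * (2 * B + B ^ 2) * (h * ‖z x‖) ≤
      1 * R ^ 2 * (2 * B + B ^ 2) * (h * ‖z x‖) := by gcongr
  refine (norm_add₃_le ..).trans ((add_le_add (add_le_add t1 t2) t5).trans ?_)
  have p1 : 0 ≤ h ^ 2 * (‖x‖ * g) := by positivity
  have p2 : 0 ≤ h * ‖z x‖ := by positivity
  have p3 : 0 ≤ d * B * R := by positivity
  have p4 : 0 ≤ R ^ 2 * (2 * B + B ^ 2) := by positivity
  nlinarith [mul_nonneg p1 p3, mul_nonneg p2 p3, mul_nonneg p1 p4, mul_nonneg p1 hd,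
    mul_nonneg p2 hd]

theorem carlemanOp_sub (h κ : ℝ) (s : Euc d → ℝ) {u v : Euc d → ℂ}
    (hu : ContDiff ℝ (⊤ : ℕ∞) u) (hv : ContDiff ℝ (⊤ : ℕ∞) v) (x : Euc d) :
    carlemanOp h κ s (fun y => u y - v y) x = carlemanOp h κ s u x - carlemanOp h κ s v x := by
  simp only [carlemanOp, lap_sub hu hv,
    euler_sub (hu.differentiableAt_top x) (hv.differentiableAt_top x)]
  module

theorem lowerOp_sub (h κ : ℝ) (s : Euc d → ℝ) (W : Euc d → Euc d) (q : Euc d → ℂ)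
    {u v : Euc d → ℂ} (hu : ContDiff ℝ (⊤ : ℕ∞) u) (hv : ContDiff ℝ (⊤ : ℕ∞) v) (x : Euc d) :
    lowerOp h κ s W q (fun y => u y - v y) x = lowerOp h κ s W q u x - lowerOp h κ s W q v x := by
  have h1 : ∑ j, ((W x j : ℝ) : ℂ) * (pd j (fun y => u y - v y) x -
      ((1 + κ * s x) / h * pd j s x) • (u x - v x)) =
      (∑ j, ((W x j : ℝ) : ℂ) * (pd j u x - ((1 + κ * s x) / h * pd j s x) • u x)) -
      ∑ j, ((W x j : ℝ) : ℂ) * (pd j v x - ((1 + κ * s x) / h * pd j s x) • v x) := by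
    rw [← Finset.sum_sub_distrib]
    refine Finset.sum_congr rfl fun j _ => ?_
    rw [pd_sub (hu.differentiableAt_top x) (hv.differentiableAt_top x), smul_sub]
    ring
  simp only [lowerOp, h1, euler_sub (hu.differentiableAt_top x) (hv.differentiableAt_top x)]
  simp only [real_smul]
  ring

/-- Multiplication by `m` intertwines `1 - h²Δ` with the model operator up to first order. -/
theorem exists_norm_resolvent_sub_le (hs : IsLogRadius c s) {W : Euc d → Euc d}
    (hW : ContDiff ℝ 2 W) {q : Euc d → ℂ} (hq : ∃ M : ℝ, ∀ x, ‖q x‖ ≤ M) {R : ℝ} (hR : 0 < R)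
    {m : Euc d → ℝ} (hm : ContDiff ℝ (⊤ : ℕ∞) m) (hmc : HasCompactSupport m) :
    ∃ C > 0, ∀ h κ : ℝ, 0 < h → h ≤ 1 → 0 < κ → κ ≤ 1 → ∀ x : Euc d, c < ‖x‖ → ‖x‖ ≤ R →
      |κ * s x| ≤ 1 / 4 → ∀ G : Euc d → ℂ, ContDiff ℝ (⊤ : ℕ∞) G →
      ‖(‖x‖ ^ 2 * m x) • (G x - h ^ 2 • lap G x) - carlemanOp h κ s (fun y => m y • G y) x -
        lowerOp h κ s W q (fun y => m y • G y) x‖ ≤ C * (‖G x‖ + h * √(gradSq G x)) := by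
  obtain ⟨C, hC, hlow⟩ := exists_norm_lowerOp_le hs hW hq hR
  obtain ⟨K, hK, hmK⟩ := exists_bound_derivatives hm hmc
  obtain ⟨K', hK', hsm⟩ := exists_smul_bound (F := ℂ) hm hmc
  refine ⟨R ^ 2 * K + R ^ 2 * (2 * d * K + K) + (d + 2) * R * K' + 4 * R * K' + 4 * K' +
    C * (K' + R * K'), by positivity, ?_⟩
  intro h κ hh hh1 hκ hκ1 x hx hxR hκs G hG
  obtain ⟨hκ2, hκ3⟩ := abs_le.1 hκs
  obtain ⟨hm1, hm2, hm3⟩ := hmK x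
  obtain ⟨hy1, hy2⟩ := hsm G hG x
  have hx0 : 0 < ‖x‖ := hs.pos.trans hx
  have hd : (0 : ℝ) ≤ d := Nat.cast_nonneg d
  set y : Euc d → ℂ := fun y => m y • G y with hy
  set g := √(gradSq G x) with hg
  have hg0 : 0 ≤ g := Real.sqrt_nonneg _
  have hG0 := norm_nonneg (G x)
  have hhG : h * ‖G x‖ ≤ ‖G x‖ := mul_le_of_le_one_left hG0 hh1
  have hhg : 0 ≤ h * g := by positivity
  set T := ‖G x‖ + h * g with hT
  have hT0 : 0 ≤ T := by positivity
  have hyx : ‖y x‖ ≤ K' * T := hy1.trans (by gcongr; linarith)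
  have hyg : h * √(gradSq y x) ≤ K' * T := by
    have := mul_le_mul_of_nonneg_left hy2 hh.le
    have : h * (K' * (‖G x‖ + g)) ≤ K' * T := by
      rw [hT]
      nlinarith
    linarith
  have hye : h * ‖euler y x‖ ≤ R * (K' * T) := by
    have h1 := norm_euler_le y x
    have h2 : ‖x‖ * √(gradSq y x) ≤ R * √(gradSq y x) := by gcongr
    have h3 : h * (R * √(gradSq y x)) = R * (h * √(gradSq y x)) := by ring
    have h4 : R * (h * √(gradSq y x)) ≤ R * (K' * T) := by gcongr
    nlinarith
  have e1 : (‖x‖ ^ 2 * m x) • (G x - h ^ 2 • lap G x) - carlemanOp h κ s y x =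
      (‖x‖ ^ 2 * m x) • G x +
      (‖x‖ ^ 2 * h ^ 2) • ((2 : ℝ) • ∑ j, pd j m x • pd j G x + lap m x • G x) +
      (h * (2 - (d : ℝ))) • (h • euler y x) - (2 * (1 + κ * s x)) • (h • euler y x) +
      (1 + κ * s x) ^ 2 • y x := by
    rw [carlemanOp, hy, lap_smul hm hG]
    module
  have hb : (1 + κ * s x) ≤ 2 := by linarith
  have hb0 : 0 ≤ (1 + κ * s x) := by linarith
  have t1 : ‖(‖x‖ ^ 2 * m x) • G x‖ ≤ R ^ 2 * K * T := by
    rw [norm_smul, norm_mul, Real.norm_of_nonneg (sq_nonneg _), Real.norm_eq_abs]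
    gcongr
    linarith
  have t2 : ‖(‖x‖ ^ 2 * h ^ 2) • ((2 : ℝ) • ∑ j, pd j m x • pd j G x + lap m x • G x)‖ ≤
      R ^ 2 * (2 * d * K + K) * T := by
    have e2 : ‖∑ j, pd j m x • pd j G x‖ ≤ d * (K * g) := by
      refine (norm_sum_le_of_le _ fun j _ => (norm_smul_le _ _).trans
        (mul_le_mul (hm2 j) (norm_pd_le_sqrt_gradSq G j x) (norm_nonneg _) hK.le)).trans ?_
      simp [hg]
    have e3 : ‖(2 : ℝ) • ∑ j, pd j m x • pd j G x + lap m x • G x‖ ≤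
        2 * (d * (K * g)) + K * ‖G x‖ := by
      refine (norm_add_le _ _).trans (add_le_add ?_ ?_)
      · rw [norm_smul, Real.norm_ofNat]
        gcongr
      · rw [norm_smul]
        gcongr
        exact hm3
    rw [norm_smul, Real.norm_of_nonneg (by positivity)]
    have e4 : h * (2 * (d * (K * g)) + K * ‖G x‖) ≤ (2 * d * K + K) * T := by
      have : 0 ≤ d * K := by positivity
      rw [hT]
      nlinarith [mul_nonneg this hG0, mul_nonneg hK.le hhg]
    calc ‖x‖ ^ 2 * h ^ 2 * ‖(2 : ℝ) • ∑ j, pd j m x • pd j G x + lap m x • G x‖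
        ≤ R ^ 2 * h ^ 2 * (2 * (d * (K * g)) + K * ‖G x‖) := by gcongr
      _ = R ^ 2 * h * (h * (2 * (d * (K * g)) + K * ‖G x‖)) := by ring
      _ ≤ R ^ 2 * 1 * ((2 * d * K + K) * T) := by gcongr
      _ = _ := by ring
  have t3 : ‖(h * (2 - (d : ℝ))) • (h • euler y x)‖ ≤ (d + 2) * R * K' * T := by
    rw [norm_smul, norm_smul, Real.norm_of_nonneg hh.le, norm_mul, Real.norm_of_nonneg hh.le,
      Real.norm_eq_abs]
    have : |2 - (d : ℝ)| ≤ d + 2 := abs_le.2 ⟨by linarith, by linarith⟩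
    calc h * |2 - (d : ℝ)| * (h * ‖euler y x‖) ≤ 1 * (d + 2) * (R * (K' * T)) := by gcongr
      _ = _ := by ring
  have t4 : ‖(2 * (1 + κ * s x)) • (h • euler y x)‖ ≤ 4 * R * K' * T := by
    rw [norm_smul, norm_smul, Real.norm_of_nonneg hh.le, Real.norm_of_nonneg (by positivity)]
    calc 2 * (1 + κ * s x) * (h * ‖euler y x‖) ≤ 2 * 2 * (R * (K' * T)) := by gcongr
      _ = _ := by ring
  have t5 : ‖(1 + κ * s x) ^ 2 • y x‖ ≤ 4 * K' * T := by
    rw [norm_smul, Real.norm_of_nonneg (by positivity)]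
    calc (1 + κ * s x) ^ 2 * ‖y x‖ ≤ 2 ^ 2 * (K' * T) := by gcongr
      _ = _ := by ring
  have t6 : ‖lowerOp h κ s W q y x‖ ≤ C * (K' + R * K') * T := by
    refine (hlow h κ hh hh1 hκ hκ1 x hx hxR hκs y).trans ?_
    have : h * (‖x‖ * √(gradSq y x)) ≤ R * (K' * T) := by
      calc h * (‖x‖ * √(gradSq y x)) = ‖x‖ * (h * √(gradSq y x)) := by ring
        _ ≤ R * (K' * T) := by gcongr
    calc C * h * (‖y x‖ + h * (‖x‖ * √(gradSq y x))) ≤ C * 1 * (K' * T + R * (K' * T)) := by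
          gcongr
      _ = _ := by ring
  rw [e1]
  refine (norm_sub_le _ _).trans ((add_le_add ((norm_add_le _ _).trans (add_le_add
    ((norm_sub_le _ _).trans (add_le_add ((norm_add₃_le ..).trans
      (add_le_add (add_le_add t1 t2) t3)) t4)) t5)) t6).trans (le_of_eq ?_))
  ring

end LowerOrder

section SobolevBounds

variable {d : ℕ} {c : ℝ} {s : Euc d → ℝ} {U : Set (Euc d)} {h : ℝ}

theorem h1Inner_eq_integral (h : ℝ) {G ψ : Euc d → ℂ} (hG : ContDiff ℝ (⊤ : ℕ∞) G)
    (hψ : IsTest U ψ) :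
    h1Inner h G ψ = ∫ x, inner ℝ (G x - h ^ 2 • lap G x) (ψ x) := by
  have h1 : ∀ j, Integrable fun x => pd j (fun y => inner ℝ (pd j G y) (ψ y)) x := fun j =>
    (((hG.pd j).inner ℝ hψ.1).pd j).continuous.integrable_of_hasCompactSupport
      (hψ.2.1.mono' fun x hx => by
        by_contra h1
        refine hx (pd_eq_zero_of_notMem_tsupport (fun h2 => h1 (closure_mono ?_ h2)) j)
        intro y hy
        contrapose! hy
        simp [Function.notMem_support.1 hy])
  have h2 : ∫ x, (gradInner G ψ x + inner ℝ (lap G x) (ψ x)) = 0 := by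
    have : ∀ x, gradInner G ψ x + inner ℝ (lap G x) (ψ x) =
        ∑ j, pd j (fun y => inner ℝ (pd j G y) (ψ y)) x := fun x => by
      simp only [lap, gradInner, sum_inner, ← Finset.sum_add_distrib]
      exact Finset.sum_congr rfl fun j _ => (pd_inner ((hG.pd j).differentiableAt_top x)
        (hψ.1.differentiableAt_top x) j).symm
    simp only [this]
    rw [integral_finsetSum _ fun j _ => h1 j]
    refine Finset.sum_eq_zero fun j _ => integral_pd_eq_zero ((hG.pd j).inner ℝ hψ.1)
      (hψ.2.1.mono fun y hy => ?_) j
    contrapose! hy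
    simp [Function.notMem_support.1 hy]
  have i1 := hψ.integrable_gradInner hG
  have i2 := hψ.integrable_inner hG.lap
  have i3 := hψ.integrable_inner hG
  rw [integral_add i1 i2] at h2
  have h3 : ∫ x, inner ℝ (G x - h ^ 2 • lap G x) (ψ x) =
      (∫ x, inner ℝ (G x) (ψ x)) - h ^ 2 * ∫ x, inner ℝ (lap G x) (ψ x) := by
    rw [← integral_const_mul, ← integral_sub i3 (i2.const_mul _)]
    simp only [inner_sub_left, real_inner_smul_left]
  rw [h3, h1Inner]
  linear_combination h ^ 2 * h2

theorem h1Inner_add_self_le (h : ℝ) {u v : Euc d → ℂ} (hu : IsTest U u) (hv : IsTest U v) :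
    h1Inner h (u + v) (u + v) ≤ 2 * h1Inner h u u + 2 * h1Inner h v v := by
  have h1 := h1Inner_self_nonneg h (u + (-1 : ℝ) • v)
  have hv' := hv.smul (-1)
  have e1 : ∀ a b : Euc d → ℂ, IsTest U a → IsTest U b →
      h1Inner h (a + b) (a + b) = h1Inner h a a + 2 * h1Inner h a b + h1Inner h b b := by
    intro a b ha hb
    rw [h1Inner_add_left h ha.1 hb.1 (ha.add hb), h1Inner_comm h a, h1Inner_comm h b,
      h1Inner_add_left h ha.1 hb.1 ha, h1Inner_add_left h ha.1 hb.1 hb, h1Inner_comm h b a]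
    ring
  rw [e1 _ _ hu hv', h1Inner_smul_left h _ hv.1, h1Inner_comm h u ((-1 : ℝ) • v),
    h1Inner_smul_left h _ hv.1, h1Inner_comm h v ((-1 : ℝ) • v), h1Inner_smul_left h _ hv.1,
    h1Inner_comm h v u] at h1
  rw [e1 _ _ hu hv]
  linarith

theorem h1Inner_sub_self_le (h : ℝ) {u v : Euc d → ℂ} (hu : IsTest U u) (hv : IsTest U v) :
    h1Inner h (u - v) (u - v) ≤ 2 * h1Inner h u u + 2 * h1Inner h v v := by
  have h1 := h1Inner_add_self_le h hu (hv.smul (-1))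
  rw [h1Inner_smul_left h _ hv.1, h1Inner_comm h v ((-1 : ℝ) • v), h1Inner_smul_left h _ hv.1,
    neg_one_smul, ← sub_eq_add_neg] at h1
  linarith

theorem IsTest.smul_fun {u : Euc d → ℂ} (hu : IsTest U u) {m : Euc d → ℝ}
    (hm : ContDiff ℝ (⊤ : ℕ∞) m) : IsTest U (fun x => m x • u x) :=
  ⟨hm.smul hu.1, hu.2.1.smul_left (f := m),
    (closure_mono (Function.support_smul_subset_right m u)).trans hu.2.2⟩

theorem IsTest.sub {u v : Euc d → ℂ} (hu : IsTest U u) (hv : IsTest U v) :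
    IsTest U (u - v) := by
  simpa [sub_eq_add_neg] using hu.add (hv.smul (-1))

theorem IsTest.comp_dil {u : Euc d → ℂ} (hu : IsTest U u)
    (hU : ∀ τ : ℝ, 0 ≤ τ → ∀ x, Real.exp (-τ) • x ∈ U → x ∈ U) {τ : ℝ} (hτ : 0 ≤ τ) :
    IsTest U (fun x => u (Real.exp (-τ) • x)) := by
  have he : Real.exp (-τ) ≠ 0 := (Real.exp_pos _).ne'
  refine ⟨hu.1.comp (contDiff_const_smul _),
    hu.2.1.comp_homeomorph (Homeomorph.smulOfNeZero _ he), fun x hx => hU τ hτ x (hu.2.2 ?_)⟩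
  exact tsupport_comp_subset_preimage u (continuous_const_smul (Real.exp (-τ))) hx

theorem exists_h1Inner_smul_le {m : Euc d → ℝ} (hm : ContDiff ℝ (⊤ : ℕ∞) m)
    (hmc : HasCompactSupport m) :
    ∃ K > 0, ∀ h : ℝ, 0 < h → h ≤ 1 → ∀ u : Euc d → ℂ, IsTest U u →
      h1Inner h (fun x => m x • u x) (fun x => m x • u x) ≤ K * h1Inner h u u := by
  obtain ⟨K, hK, hsm⟩ := exists_smul_bound (F := ℂ) hm hmc
  refine ⟨3 * K ^ 2, by positivity, fun h hh hh1 u hu => ?_⟩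
  have h1 : ∫ x, ‖m x • u x‖ ^ 2 ≤ K ^ 2 * ∫ x, ‖u x‖ ^ 2 := by
    rw [← integral_const_mul]
    refine integral_mono (hu.smul_fun hm).integrable_norm_sq (hu.integrable_norm_sq.const_mul _)
      fun x => ?_
    simp only
    rw [← mul_pow]
    gcongr
    exact (hsm u hu.1 x).1
  have h2 : ∫ x, gradSq (fun x => m x • u x) x ≤
      2 * K ^ 2 * ((∫ x, ‖u x‖ ^ 2) + ∫ x, gradSq u x) := by
    rw [← integral_add hu.integrable_norm_sq hu.integrable_gradSq, ← integral_const_mul]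
    refine integral_mono (hu.smul_fun hm).integrable_gradSq
      ((hu.integrable_norm_sq.add hu.integrable_gradSq).const_mul _) fun x => ?_
    have e1 := Real.sq_sqrt (gradSq_nonneg (fun x => m x • u x) x)
    have e2 := Real.sq_sqrt (gradSq_nonneg u x)
    have e3 := pow_le_pow_left₀ (Real.sqrt_nonneg _) (hsm u hu.1 x).2 2
    simp only
    rw [← e1, ← e2]
    nlinarith [mul_nonneg (sq_nonneg K) (sq_nonneg (‖u x‖ - √(gradSq u x)))]
  rw [h1Inner_self, h1Inner_self]
  have h3 : 0 ≤ ∫ x, ‖u x‖ ^ 2 := integral_nonneg fun x => by positivity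
  have h4 : 0 ≤ ∫ x, gradSq u x := integral_nonneg (gradSq_nonneg u)
  have h5 : h ^ 2 ≤ 1 := pow_le_one₀ hh.le hh1
  have h6 := mul_le_mul_of_nonneg_left h2 (sq_nonneg h)
  have h7 : h ^ 2 * (K ^ 2 * ∫ x, ‖u x‖ ^ 2) ≤ 1 * (K ^ 2 * ∫ x, ‖u x‖ ^ 2) := by gcongr
  nlinarith [mul_nonneg (mul_nonneg (sq_nonneg h) (sq_nonneg K)) h4]

theorem h1Inner_comp_dil_le {u : Euc d → ℂ} (h : ℝ) {τ : ℝ} (hτ : 0 ≤ τ) :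
    h1Inner h (fun x => u (Real.exp (-τ) • x)) (fun x => u (Real.exp (-τ) • x)) ≤
      |(Real.exp (-τ) ^ d)⁻¹| * h1Inner h u u := by
  have h1 : ∀ f : Euc d → ℝ, ∫ x, f (Real.exp (-τ) • x) =
      |(Real.exp (-τ) ^ d)⁻¹| * ∫ x, f x := fun f => by
    rw [Measure.integral_comp_smul]
    simp
  have h2 : ∀ x, gradSq (fun x => u (Real.exp (-τ) • x)) x =
      Real.exp (-τ) ^ 2 * gradSq u (Real.exp (-τ) • x) := fun x => by
    simp only [gradSq, pd_comp_dil, norm_smul, mul_pow, Finset.mul_sum, Real.norm_eq_abs, sq_abs]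
  rw [h1Inner_self, h1Inner_self]
  simp only [h2]
  rw [integral_const_mul, h1 (fun x => ‖u x‖ ^ 2), h1 (gradSq u)]
  have h4 : 0 ≤ ∫ x, gradSq u x := integral_nonneg (gradSq_nonneg u)
  have h5 : Real.exp (-τ) ^ 2 ≤ 1 := pow_le_one₀ (Real.exp_pos _).le (by simpa using hτ)
  have h6 : 0 ≤ |(Real.exp (-τ) ^ d)⁻¹| * ∫ x, gradSq u x := by positivity
  nlinarith [mul_le_mul_of_nonneg_left (mul_le_mul_of_nonneg_right h5 h6) (sq_nonneg h)]

theorem exists_carlemanMult_bound (hs : IsLogRadius c s)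
    (hU : ∀ τ : ℝ, 0 ≤ τ → ∀ x, Real.exp (-τ) • x ∈ U → x ∈ U) {m : Euc d → ℝ}
    (hm : ContDiff ℝ (⊤ : ℕ∞) m) (hmc : HasCompactSupport m) (κ : ℝ) {τ : ℝ} (hτ : 0 ≤ τ) :
    ∃ K > 0, ∀ h : ℝ, 0 < h → h ≤ 1 → ∀ v : Euc d → ℂ, IsTest U v →
      IsTest U (fun x => m x • carlemanMult κ τ s v x) ∧
      h1Inner h (fun x => m x • carlemanMult κ τ s v x) (fun x => m x • carlemanMult κ τ s v x) ≤
        K * h1Inner h v v := by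
  set m₁ : Euc d → ℝ := fun x => ((1 + κ * s x) * τ⁻¹ + κ) * m x with hm₁
  set m₂ : Euc d → ℝ := fun x => ((1 + κ * s x) * τ⁻¹) * m x with hm₂
  have hb : ContDiff ℝ (⊤ : ℕ∞) fun x => (1 + κ * s x) * τ⁻¹ :=
    (contDiff_const.add (contDiff_const.mul hs.smooth)).mul contDiff_const
  have s1 : ContDiff ℝ (⊤ : ℕ∞) m₁ := (hb.add contDiff_const).mul hm
  have s2 : ContDiff ℝ (⊤ : ℕ∞) m₂ := hb.mul hm
  obtain ⟨K₁, hK₁, h1⟩ := exists_h1Inner_smul_le (U := U) s1 hmc.mul_left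
  obtain ⟨K₂, hK₂, h2⟩ := exists_h1Inner_smul_le (U := U) s2 hmc.mul_left
  refine ⟨2 * K₁ + 2 * (K₂ * |(Real.exp (-τ) ^ d)⁻¹|), by positivity, fun h hh hh1 v hv => ?_⟩
  have hv' := hv.comp_dil hU hτ
  have e1 : (fun x => m x • carlemanMult κ τ s v x) =
      (fun x => m₁ x • v x) - fun x => m₂ x • v (Real.exp (-τ) • x) := by
    ext x
    simp only [carlemanMult, dilQuot, hm₁, hm₂, Pi.sub_apply, real_smul]
    push_cast
    ring
  rw [e1]
  refine ⟨(hv.smul_fun s1).sub (hv'.smul_fun s2), ?_⟩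
  have t1 := h1Inner_sub_self_le h (hv.smul_fun s1) (hv'.smul_fun s2)
  have t2 := h1 h hh hh1 v hv
  have t3 := (h2 h hh hh1 _ hv').trans
    (mul_le_mul_of_nonneg_left (h1Inner_comp_dil_le h hτ) hK₂.le)
  linarith

theorem exists_integral_euler_smul_le (hs : IsLogRadius c s) {m : Euc d → ℝ}
    (hm : ContDiff ℝ (⊤ : ℕ∞) m) (hmc : HasCompactSupport m) :
    ∃ K > 0, ∀ h : ℝ, 0 < h → h ≤ 1 → ∀ u : Euc d → ℂ, IsTest U u →
      h ^ 2 * ∫ x, invDensity s x * ‖euler (fun y => m y • u y) x‖ ^ 2 ≤ K * h1Inner h u u := by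
  obtain ⟨K, hK, hsm⟩ := exists_h1Inner_smul_le (U := U) hm hmc
  have hc : Continuous fun x => invDensity s x * ‖x‖ ^ 2 :=
    hs.contDiff_invDensity.continuous.mul (continuous_norm.pow 2)
  obtain ⟨B, hB⟩ := hmc.isCompact.exists_bound_of_continuousOn hc.continuousOn
  refine ⟨(|B| + 1) * K, by positivity, fun h hh hh1 u hu => ?_⟩
  have hu' := hu.smul_fun hm
  have h1 : ∀ x, invDensity s x * ‖euler (fun y => m y • u y) x‖ ^ 2 ≤
      (|B| + 1) * gradSq (fun y => m y • u y) x := fun x => by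
    by_cases hx : x ∈ tsupport m
    · have h2 := (le_abs_self _).trans ((hB x hx).trans (le_abs_self B))
      have h3 := gradSq_nonneg (fun y => m y • u y) x
      have h4 := mul_le_mul_of_nonneg_left (norm_sq_euler_le (fun y => m y • u y) x)
        (invDensity_pos s x).le
      nlinarith [mul_le_mul_of_nonneg_right h2 h3]
    · have h2 : x ∉ tsupport fun y => m y • u y := fun h5 =>
        hx (closure_mono (Function.support_smul_subset_left m u) h5)
      rw [euler_eq_zero_of_notMem_tsupport h2, gradSq_eq_zero_of_notMem_tsupport h2]
      simp
  have h2 : ∫ x, invDensity s x * ‖euler (fun y => m y • u y) x‖ ^ 2 ≤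
      (|B| + 1) * ∫ x, gradSq (fun y => m y • u y) x := by
    rw [← integral_const_mul]
    refine integral_mono_of_nonneg (Eventually.of_forall fun x => ?_)
      (hu'.integrable_gradSq.const_mul _) (Eventually.of_forall h1)
    exact mul_nonneg (invDensity_pos s x).le (sq_nonneg _)
  have h3 := hsm h hh hh1 u hu
  rw [h1Inner_self] at h3
  have h4 : 0 ≤ ∫ x, ‖m x • u x‖ ^ 2 := integral_nonneg fun x => by positivity
  have h5 := mul_le_mul_of_nonneg_left h2 (sq_nonneg h)
  have h6 : h ^ 2 * ∫ x, gradSq (fun y => m y • u y) x ≤ K * h1Inner h u u := by linarith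
  nlinarith [mul_le_mul_of_nonneg_left h6 (by positivity : 0 ≤ |B| + 1)]

theorem continuous_magSchrodinger {W : Euc d → Euc d} (hW : ContDiff ℝ 2 W) {u : Euc d → ℂ}
    (hu : ContDiff ℝ (⊤ : ℕ∞) u) : Continuous (magSchrodinger W 0 u) := by
  have hdiv : Continuous fun x => ∑ j, pd j (fun y => W y j) x :=
    continuous_finsetSum _ fun j _ =>
      ((((contDiff_euclidean (n := 2)).1 hW j).continuous_fderiv (by simp)).clm_apply
        continuous_const)
  have h1 : ∀ j, Continuous (pd j u) := fun j => (hu.pd j).continuous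
  have h2 : ∀ j, Continuous (pd j (pd j u)) := fun j => ((hu.pd j).pd j).continuous
  have h3 : ∀ j, Continuous fun x => W x j := fun j =>
    ((contDiff_euclidean (n := 2)).1 hW j).continuous
  have h4 := hu.continuous
  have h5 := hW.continuous
  unfold magSchrodinger
  simp only [Pi.zero_apply, add_zero]
  fun_prop

theorem exists_conjOp_eq (hs : IsLogRadius c s) {W : Euc d → Euc d} (hW : ContDiff ℝ 2 W)
    (q : Euc d → ℂ) (hh : h ≠ 0) {w : Euc d → ℂ} (hw : IsTestOff c w) :
    ∃ A B : Euc d → ℂ, Continuous A ∧ Continuous B ∧ HasCompactSupport A ∧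
      HasCompactSupport B ∧ conjOp h W q w = fun x => A x + q x * B x := by
  set u : Euc d → ℂ := fun y => Real.exp (-(s y / h)) • w y with hu
  have hE : ContDiff ℝ (⊤ : ℕ∞) fun y => Real.exp (-(s y / h)) :=
    Real.contDiff_exp.comp (hs.smooth.div_const h).neg
  have hus : ContDiff ℝ (⊤ : ℕ∞) u := hE.smul hw.smooth
  have h1 : (fun y => Complex.exp (((-(carlWeight y / h) : ℝ) : ℂ)) * w y) = u := by
    ext y
    by_cases hy : y ∈ tsupport w
    · rw [carlWeight, ← hs.eq_log y (hw.supp y hy), ← Complex.ofReal_exp, ← real_smul]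
    · simp [hu, image_eq_zero_of_notMem_tsupport hy]
  have h2 : ∀ q' x, x ∉ tsupport w → magSchrodinger W q' u x = 0 := fun q' x hx => by
    have := conjOp_eq_zero_of_notMem_tsupport h W q' hx
    rw [conjOp, h1] at this
    simpa [hh, Complex.exp_ne_zero] using this
  have hc : Continuous fun x => ((h ^ 2 * Real.exp (s x / h) : ℝ) : ℂ) :=
    continuous_ofReal.comp (continuous_const.mul
      (Real.continuous_exp.comp (hs.smooth.continuous.div_const h)))
  refine ⟨fun x => ((h ^ 2 * Real.exp (s x / h) : ℝ) : ℂ) * magSchrodinger W 0 u x,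
    fun x => ((h ^ 2 * Real.exp (s x / h) : ℝ) : ℂ) * u x,
    hc.mul (continuous_magSchrodinger hW hus), hc.mul hus.continuous,
    hw.compact.mono' fun x hx => ?_, hw.compact.mono fun x hx => ?_, ?_⟩
  · by_contra h3
    exact hx (by simp [h2 0 x h3])
  · contrapose! hx
    simp [hu, Function.notMem_support.1 hx]
  · ext x
    by_cases hx : x ∈ tsupport w
    · rw [conjOp, h1, carlWeight, ← hs.eq_log x (hw.supp x hx), ← Complex.ofReal_exp]
      simp only [magSchrodinger, Pi.zero_apply]
      push_cast
      ring
    · have h3 : u x = 0 := by simp [hu, image_eq_zero_of_notMem_tsupport hx]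
      simp [conjOp_eq_zero_of_notMem_tsupport h W q hx, h2 0 x hx, h3]

theorem aestronglyMeasurable_conjOp (hs : IsLogRadius c s) {W : Euc d → Euc d}
    (hW : ContDiff ℝ 2 W) {q : Euc d → ℂ} (hqm : Measurable q) (hh : h ≠ 0) {w : Euc d → ℂ}
    (hw : IsTestOff c w) : AEStronglyMeasurable (conjOp h W q w) := by
  obtain ⟨A, B, hA, hB, -, -, h1⟩ := exists_conjOp_eq hs hW q hh hw
  rw [h1]
  exact (hA.measurable.add (hqm.mul hB.measurable)).aestronglyMeasurable

theorem integrable_norm_sq_conjOp (hs : IsLogRadius c s) {W : Euc d → Euc d}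
    (hW : ContDiff ℝ 2 W) {q : Euc d → ℂ} (hqm : Measurable q) (hq : ∃ M : ℝ, ∀ x, ‖q x‖ ≤ M)
    (hh : h ≠ 0) {w : Euc d → ℂ} (hw : IsTestOff c w) :
    Integrable fun x => ‖conjOp h W q w x‖ ^ 2 := by
  have hm := aestronglyMeasurable_conjOp hs hW hqm hh hw
  obtain ⟨A, B, hA, hB, hAc, hBc, h1⟩ := exists_conjOp_eq hs hW q hh hw
  obtain ⟨M, hM⟩ := hq
  have hc : Continuous fun x => (‖A x‖ + M * ‖B x‖) ^ 2 :=
    (hA.norm.add (continuous_const.mul hB.norm)).pow 2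
  refine (hc.integrable_of_hasCompactSupport ?_).mono' (hm.norm.pow 2)
    (Eventually.of_forall fun x => ?_)
  · have : HasCompactSupport fun x => ‖A x‖ + M * ‖B x‖ :=
      hAc.norm.add hBc.norm.mul_left
    exact this.comp_left (g := fun t : ℝ => t ^ 2) (by simp)
  · rw [h1, Real.norm_of_nonneg (by positivity)]
    gcongr
    refine (norm_add_le _ _).trans ?_
    rw [norm_mul]
    have := mul_le_mul_of_nonneg_right (hM x) (norm_nonneg (B x))
    linarith

end SobolevBounds

section Estimate

variable {d : ℕ} {c : ℝ} {s : Euc d → ℝ} {U : Set (Euc d)}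

theorem continuous_carlemanOp (hs : IsLogRadius c s) (h κ : ℝ) {v : Euc d → ℂ}
    (hv : ContDiff ℝ (⊤ : ℕ∞) v) : Continuous (carlemanOp h κ s v) := by
  have h1 := hv.lap.continuous
  have h2 := hv.euler.continuous
  have h3 := hv.continuous
  have h4 := hs.smooth.continuous
  unfold carlemanOp
  fun_prop

theorem IsLogRadius.invDensity_le (hs : IsLogRadius c s) {x : Euc d} (hx : c < ‖x‖) :
    invDensity s x ≤ Real.exp (-(d : ℝ) * Real.log c) := by
  rw [invDensity, hs.eq_log x hx]
  refine Real.exp_le_exp.2 ?_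
  have := Real.log_le_log hs.pos hx.le
  nlinarith [(Nat.cast_nonneg d : (0 : ℝ) ≤ d)]

theorem IsTest.integrable_inner_of_sq {L Ψ : Euc d → ℂ} (hLm : AEStronglyMeasurable L)
    (hL : Integrable fun x => ‖L x‖ ^ 2) (hΨ : IsTest U Ψ) :
    Integrable fun x => inner ℝ (L x) (Ψ x) := by
  refine (hL.add hΨ.integrable_norm_sq).mono'
    (hLm.inner hΨ.1.continuous.aestronglyMeasurable) (Eventually.of_forall fun x => ?_)
  refine (norm_inner_le_norm _ _).trans ?_
  simp only [Pi.add_apply]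
  nlinarith [sq_nonneg (‖L x‖ - ‖Ψ x‖), sq_nonneg (‖L x‖ + ‖Ψ x‖)]

/-- The Carleman estimate for the difference of `w` and an approximate solution `G` of
`(1 - h²Δ) G = L_{φ,W,q} w`, both multiplied by `m`. -/
theorem carleman_sub_resolvent_le (hs : IsLogRadius c s) (hU : ∀ x ∈ U, c < ‖x‖)
    {W : Euc d → Euc d} (hW : ContDiff ℝ 2 W) {q : Euc d → ℂ} (hqm : Measurable q)
    (hq : ∃ M : ℝ, ∀ x, ‖q x‖ ≤ M) {m : Euc d → ℝ} (hm : ContDiff ℝ (⊤ : ℕ∞) m) {R : ℝ}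
    (hmR : ∀ x ∈ tsupport m, ‖x‖ ≤ R) {h κ τ δ C₂ C₃ : ℝ} (hh : 0 < h)
    (hκ : 0 < κ) (hτ : 0 < τ) (hhκ : h * κ ≤ 1 / 32) (hκτ : κ * τ ≤ 1 / 4)
    (hκs : ∀ x, c < ‖x‖ → ‖x‖ ≤ R → |κ * s x| ≤ 1 / 4)
    (hC₂ : 0 ≤ C₂) (hC₃ : 0 ≤ C₃) (hC : 1024 * C₂ ^ 2 * h ≤ κ)
    (hlow : ∀ x : Euc d, c < ‖x‖ → ‖x‖ ≤ R → ∀ z : Euc d → ℂ,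
      ‖lowerOp h κ s W q z x‖ ≤ C₂ * h * (‖z x‖ + h * (‖x‖ * √(gradSq z x))))
    (hres : ∀ x : Euc d, c < ‖x‖ → ‖x‖ ≤ R → ∀ G : Euc d → ℂ, ContDiff ℝ (⊤ : ℕ∞) G →
      ‖(‖x‖ ^ 2 * m x) • (G x - h ^ 2 • lap G x) - carlemanOp h κ s (fun y => m y • G y) x -
        lowerOp h κ s W q (fun y => m y • G y) x‖ ≤ C₃ * (‖G x‖ + h * √(gradSq G x)))
    {w G : Euc d → ℂ} (hw : IsTest U w)
    (hmw : ∀ x ∈ tsupport w, m x = Real.exp (κ / 2 * s x ^ 2 / h)) (hG : IsTest U G)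
    (he : ∀ ψ, IsTest U ψ →
      |h1Inner h G ψ - ∫ x, inner ℝ (conjOp h W q w x) (ψ x)| ≤ δ * √(h1Inner h ψ ψ))
    {v Ψ : Euc d → ℂ} (hv : v = fun x => m x • w x - m x • G x)
    (hΨ : Ψ = fun x => (‖x‖ ^ 2 * invDensity s x * m x) • carlemanMult κ τ s v x)
    (hΨU : IsTest U Ψ) :
    κ / 64 * ((∫ x, invDensity s x * ‖v x‖ ^ 2) +
        h ^ 2 * ∫ x, invDensity s x * (‖x‖ ^ 2 * gradSq v x)) ≤
      δ * √(h1Inner h Ψ Ψ) +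
        8 * h⁻¹ * (∫ x, invDensity s x * (C₃ * (‖G x‖ + h * √(gradSq G x))) ^ 2) +
        (51 * h + 128 * κ⁻¹) * ∫ x, invDensity s x * ‖dilQuot τ v x - euler v x‖ ^ 2 := by
  have hw' := hw.isTestOff hU
  have hG' := hG.isTestOff hU
  have hv' : IsTestOff c v := hv ▸ (hw'.smul hm).sub (hG'.smul hm)
  have hψ := hv'.carlemanMult hs κ hτ.le
  have hvm : ∀ x, x ∈ tsupport v → x ∈ tsupport m := fun x hx =>
    closure_mono (fun y hy => by
      contrapose! hy
      simp [hv, Function.notMem_support.1 hy]) hx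
  set ψ := carlemanMult κ τ s v with hψdef
  set S : Euc d → ℝ := fun x => C₃ * (‖G x‖ + h * √(gradSq G x)) with hS
  set T : Euc d → ℝ := fun x => C₂ * h * (‖v x‖ + h * (‖x‖ * √(gradSq v x))) with hT
  have hJ := hs.contDiff_invDensity.continuous
  have hSc : Continuous S := by
    have h1 := hG.1.continuous
    have h2 := continuous_gradSq hG.1
    fun_prop
  have hTc : Continuous T := by
    have h1 := hv'.smooth.continuous
    have h2 := continuous_gradSq hv'.smooth
    fun_prop
  have hS0 : ∀ x, 0 ≤ S x := fun x => by positivity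
  have hT0 : ∀ x, 0 ≤ T x := fun x => by positivity
  have hSz : ∀ x, x ∉ tsupport G → S x = 0 := fun x hx => by
    simp [hS, image_eq_zero_of_notMem_tsupport hx, gradSq_eq_zero_of_notMem_tsupport hx]
  have hTz : ∀ x, x ∉ tsupport v → T x = 0 := fun x hx => by
    simp [hT, image_eq_zero_of_notMem_tsupport hx, gradSq_eq_zero_of_notMem_tsupport hx]
  have hPc : HasCompactSupport fun x => T x + S x :=
    (hv'.compact.mono' fun x hx => by_contra fun h1 => hx (hTz x h1)).add
      (hG.2.1.mono' fun x hx => by_contra fun h1 => hx (hSz x h1))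
  have hLm := aestronglyMeasurable_conjOp hs hW hqm hh.ne' hw'
  have hL := integrable_norm_sq_conjOp hs hW hqm hq hh.ne' hw'
  have hpt : ∀ x, invDensity s x * inner ℝ (carlemanOp h κ s v x) (ψ x) +
      (inner ℝ (G x - h ^ 2 • lap G x) (Ψ x) - inner ℝ (conjOp h W q w x) (Ψ x)) ≤
      invDensity s x * ((T x + S x) * ‖ψ x‖) := fun x => by
    have e1 : invDensity s x * inner ℝ (carlemanOp h κ s v x) (ψ x) +
        (inner ℝ (G x - h ^ 2 • lap G x) (Ψ x) - inner ℝ (conjOp h W q w x) (Ψ x)) =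
        invDensity s x * inner ℝ (carlemanOp h κ s v x +
          (‖x‖ ^ 2 * m x) • (G x - h ^ 2 • lap G x) - (‖x‖ ^ 2 * m x) • conjOp h W q w x)
          (ψ x) := by
      simp only [hΨ, inner_add_left, inner_sub_left, real_inner_smul_left, real_inner_smul_right]
      ring
    rw [e1]
    refine mul_le_mul_of_nonneg_left ?_ (invDensity_pos s x).le
    by_cases hx : x ∈ tsupport ψ
    · have hcx := hψ.supp x hx
      refine (real_inner_le_norm _ _).trans (mul_le_mul_of_nonneg_right ?_ (norm_nonneg _))
      by_cases hxm : x ∈ tsupport m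
      · have hxR := hmR x hxm
        have e2 : carlemanOp h κ s v x + (‖x‖ ^ 2 * m x) • (G x - h ^ 2 • lap G x) -
            (‖x‖ ^ 2 * m x) • conjOp h W q w x =
            -lowerOp h κ s W q v x + ((‖x‖ ^ 2 * m x) • (G x - h ^ 2 • lap G x) -
              carlemanOp h κ s (fun y => m y • G y) x -
              lowerOp h κ s W q (fun y => m y • G y) x) := by
          rw [conjOp_eq hs hh.ne' κ W q hw' hm hmw hcx, hv,
            carlemanOp_sub h κ s (u := fun y => m y • w y) (v := fun y => m y • G y)
              (hm.smul hw.1) (hm.smul hG.1),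
            lowerOp_sub h κ s W q (u := fun y => m y • w y) (v := fun y => m y • G y)
              (hm.smul hw.1) (hm.smul hG.1)]
          abel
        rw [e2]
        refine (norm_add_le _ _).trans (add_le_add ?_ (hres x hcx hxR G hG.1))
        rw [norm_neg]
        exact hlow x hcx hxR v
      · have h1 : x ∉ tsupport v := fun h2 => hxm (hvm x h2)
        have h2 : carlemanOp h κ s v x + (‖x‖ ^ 2 * m x) • (G x - h ^ 2 • lap G x) -
            (‖x‖ ^ 2 * m x) • conjOp h W q w x = 0 := by
          simp [carlemanOp, lap_eq_zero_of_notMem_tsupport h1,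
            euler_eq_zero_of_notMem_tsupport h1, image_eq_zero_of_notMem_tsupport h1,
            image_eq_zero_of_notMem_tsupport hxm]
        rw [h2, norm_zero]
        exact add_nonneg (hT0 x) (hS0 x)
    · simp [image_eq_zero_of_notMem_tsupport hx]
  have i1 : Integrable fun x => invDensity s x * inner ℝ (carlemanOp h κ s v x) (ψ x) :=
    hψ.integrable_of_continuous
      (hJ.mul ((continuous_carlemanOp hs h κ hv'.smooth).inner hψ.smooth.continuous))
      fun x hx => by simp [image_eq_zero_of_notMem_tsupport hx]
  have i2 : Integrable fun x => inner ℝ (G x - h ^ 2 • lap G x) (Ψ x) :=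
    hΨU.integrable_inner (hG.1.sub (hG.1.lap.const_smul (h ^ 2)))
  have i3 := hΨU.integrable_inner_of_sq hLm hL
  have i4 : Integrable fun x => invDensity s x * ((T x + S x) * ‖ψ x‖) :=
    hψ.integrable_of_continuous (hJ.mul ((hTc.add hSc).mul hψ.smooth.continuous.norm))
      fun x hx => by simp [image_eq_zero_of_notMem_tsupport hx]
  have hR : ∫ x, invDensity s x * inner ℝ (carlemanOp h κ s v x) (ψ x) ≤
      δ * √(h1Inner h Ψ Ψ) + ∫ x, invDensity s x * ((T x + S x) * ‖ψ x‖) := by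
    have h1 := integral_mono (i1.add (i2.sub i3)) i4 hpt
    have h2 : ∫ x, (invDensity s x * inner ℝ (carlemanOp h κ s v x) (ψ x) +
        (inner ℝ (G x - h ^ 2 • lap G x) (Ψ x) - inner ℝ (conjOp h W q w x) (Ψ x))) =
        (∫ x, invDensity s x * inner ℝ (carlemanOp h κ s v x) (ψ x)) +
        ((∫ x, inner ℝ (G x - h ^ 2 • lap G x) (Ψ x)) -
          ∫ x, inner ℝ (conjOp h W q w x) (Ψ x)) := by
      rw [← integral_sub i2 i3]
      exact integral_add i1 (i2.sub i3)
    have h3 := he Ψ hΨU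
    rw [h1Inner_eq_integral h hG.1 hΨU] at h3
    have h4 := (abs_le.1 h3).1
    simp only [Pi.add_apply, Pi.sub_apply] at h1
    rw [h2] at h1
    linarith
  have main := carleman_integral_le hs hv' hh hκ hτ hhκ hκτ
    (fun x hx => hκs x (hv'.supp x hx) (hmR x (hvm x hx))) (hTc.add hSc) hPc
    (fun x => add_nonneg (hT0 x) (hS0 x)) hR
  set X := ∫ x, invDensity s x * ‖v x‖ ^ 2 with hX
  set Y := ∫ x, invDensity s x * (‖x‖ ^ 2 * gradSq v x) with hY
  have hX0 : 0 ≤ X := integral_nonneg fun x => mul_nonneg (invDensity_pos s x).le (sq_nonneg _)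
  have hY0 : 0 ≤ Y := integral_nonneg fun x =>
    mul_nonneg (invDensity_pos s x).le (mul_nonneg (sq_nonneg _) (gradSq_nonneg v x))
  have hgv := continuous_gradSq hv'.smooth
  have iX : Integrable fun x => invDensity s x * ‖v x‖ ^ 2 :=
    hv'.integrable_of_continuous (hJ.mul (hv'.smooth.continuous.norm.pow 2))
      fun x hx => by simp [image_eq_zero_of_notMem_tsupport hx]
  have iY : Integrable fun x => invDensity s x * (‖x‖ ^ 2 * gradSq v x) :=
    hv'.integrable_of_continuous (hJ.mul ((continuous_norm.pow 2).mul hgv))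
      fun x hx => by simp [gradSq_eq_zero_of_notMem_tsupport hx]
  have iXY : Integrable fun x => invDensity s x * ‖v x‖ ^ 2 +
      h ^ 2 * (invDensity s x * (‖x‖ ^ 2 * gradSq v x)) := iX.add (iY.const_mul _)
  have iS : Integrable fun x => invDensity s x * S x ^ 2 :=
    hG'.integrable_of_continuous (hJ.mul (hSc.pow 2)) fun x hx => by simp [hSz x hx]
  have hP : ∫ x, invDensity s x * (T x + S x) ^ 2 ≤
      2 * (∫ x, invDensity s x * S x ^ 2) + 4 * C₂ ^ 2 * h ^ 2 * (X + h ^ 2 * Y) := by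
    have e1 : 2 * (∫ x, invDensity s x * S x ^ 2) + 4 * C₂ ^ 2 * h ^ 2 * (X + h ^ 2 * Y) =
        ∫ x, (2 * (invDensity s x * S x ^ 2) + 4 * C₂ ^ 2 * h ^ 2 *
          (invDensity s x * ‖v x‖ ^ 2 + h ^ 2 * (invDensity s x * (‖x‖ ^ 2 * gradSq v x)))) := by
      rw [integral_add (iS.const_mul _) (iXY.const_mul _), integral_const_mul,
        integral_const_mul, integral_add iX (iY.const_mul _), integral_const_mul]
    rw [e1]
    refine integral_mono_of_nonneg
      (Eventually.of_forall fun x => mul_nonneg (invDensity_pos s x).le (sq_nonneg _))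
      ((iS.const_mul _).add (iXY.const_mul _))
      (Eventually.of_forall fun x => ?_)
    have e2 := Real.sq_sqrt (gradSq_nonneg v x)
    have e3 : (T x + S x) ^ 2 ≤ 2 * S x ^ 2 +
        4 * C₂ ^ 2 * h ^ 2 * (‖v x‖ ^ 2 + h ^ 2 * (‖x‖ ^ 2 * gradSq v x)) := by
      rw [← e2]
      have e4 : T x ^ 2 ≤ 2 * C₂ ^ 2 * h ^ 2 *
          (‖v x‖ ^ 2 + h ^ 2 * (‖x‖ ^ 2 * √(gradSq v x) ^ 2)) := by
        simp only [hT]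
        nlinarith [mul_nonneg (sq_nonneg (C₂ * h))
          (sq_nonneg (‖v x‖ - h * (‖x‖ * √(gradSq v x))))]
      nlinarith [sq_nonneg (T x - S x)]
    have e5 := mul_le_mul_of_nonneg_left e3 (invDensity_pos s x).le
    simp only
    linarith
  have hP' := mul_le_mul_of_nonneg_left hP (by positivity : 0 ≤ 4 * h⁻¹)
  have e6 : 4 * h⁻¹ * (2 * (∫ x, invDensity s x * S x ^ 2) +
      4 * C₂ ^ 2 * h ^ 2 * (X + h ^ 2 * Y)) =
      8 * h⁻¹ * (∫ x, invDensity s x * S x ^ 2) + 16 * C₂ ^ 2 * h * (X + h ^ 2 * Y) := by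
    field_simp
    ring
  rw [e6] at hP'
  have e7 : 16 * C₂ ^ 2 * h * (X + h ^ 2 * Y) ≤ κ / 64 * (X + h ^ 2 * Y) := by
    gcongr
    linarith
  have e8 : 0 ≤ κ * (h ^ 2 * Y) := by positivity
  simp only [Pi.add_apply] at main
  linarith

end Estimate

section Conclusion

variable {d : ℕ} {c : ℝ} {s : Euc d → ℝ} {U : Set (Euc d)}

theorem h1Inner_sub_self_comm (h : ℝ) {u v : Euc d → ℂ} (hu : IsTest U u) (hv : IsTest U v) :
    h1Inner h (u - v) (u - v) = h1Inner h (v - u) (v - u) := by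
  have h1 : u - v = (-1 : ℝ) • (v - u) := by
    rw [neg_smul, one_smul, neg_sub]
  have h2 := (hv.sub hu).1
  rw [h1, h1Inner_smul_left h _ h2, h1Inner_comm, h1Inner_smul_left h _ h2]
  ring

/-- An approximate solution `G` of `(1 - h²Δ) G = L_{φ,W,q} w`, controlled by the `H⁻¹` norm of
`L_{φ,W,q} w`, for which `m w - m G` satisfies the Carleman estimate. -/
theorem exists_resolvent_carleman_le (hs : IsLogRadius c s) (hU : ∀ x ∈ U, c < ‖x‖)
    (hUd : ∀ τ : ℝ, 0 ≤ τ → ∀ x, Real.exp (-τ) • x ∈ U → x ∈ U)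
    {W : Euc d → Euc d} (hW : ContDiff ℝ 2 W) {q : Euc d → ℂ} (hqm : Measurable q)
    (hq : ∃ M : ℝ, ∀ x, ‖q x‖ ≤ M) {m : Euc d → ℝ} (hm : ContDiff ℝ (⊤ : ℕ∞) m)
    (hmc : HasCompactSupport m) {R : ℝ}
    (hmR : ∀ x ∈ tsupport m, ‖x‖ ≤ R) {h κ C₂ C₃ K₁ K₂ : ℝ} (hh : 0 < h) (hh1 : h ≤ 1)
    (hκ : 0 < κ) (hhκ : h * κ ≤ 1 / 32)
    (hκs : ∀ x, c < ‖x‖ → ‖x‖ ≤ R → |κ * s x| ≤ 1 / 4)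
    (hC₂ : 0 ≤ C₂) (hC₃ : 0 ≤ C₃) (hC : 1024 * C₂ ^ 2 * h ≤ κ)
    (hlow : ∀ x : Euc d, c < ‖x‖ → ‖x‖ ≤ R → ∀ z : Euc d → ℂ,
      ‖lowerOp h κ s W q z x‖ ≤ C₂ * h * (‖z x‖ + h * (‖x‖ * √(gradSq z x))))
    (hres : ∀ x : Euc d, c < ‖x‖ → ‖x‖ ≤ R → ∀ G : Euc d → ℂ, ContDiff ℝ (⊤ : ℕ∞) G →
      ‖(‖x‖ ^ 2 * m x) • (G x - h ^ 2 • lap G x) - carlemanOp h κ s (fun y => m y • G y) x -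
        lowerOp h κ s W q (fun y => m y • G y) x‖ ≤ C₃ * (‖G x‖ + h * √(gradSq G x)))
    (hK₁ : 0 < K₁) (hsmul : ∀ u : Euc d → ℂ, IsTest U u →
      h1Inner h (fun x => m x • u x) (fun x => m x • u x) ≤ K₁ * h1Inner h u u)
    (hK₂ : 0 < K₂) (heuler : ∀ u : Euc d → ℂ, IsTest U u →
      h ^ 2 * ∫ x, invDensity s x * ‖euler (fun y => m y • u y) x‖ ^ 2 ≤ K₂ * h1Inner h u u)
    {w : Euc d → ℂ} (hw : IsTest U w)
    (hmw : ∀ x ∈ tsupport w, m x = Real.exp (κ / 2 * s x ^ 2 / h)) {δ : ℝ} (hδ : 0 < δ) :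
    ∃ G, IsTest U G ∧ √(h1Inner h G G) ≤ Hneg1norm h U (conjOp h W q w) + δ ∧
      κ / 64 * (∫ x, invDensity s x * ‖m x • w x - m x • G x‖ ^ 2) ≤
        δ + 8 * h⁻¹ * (∫ x, invDensity s x * (C₃ * (‖G x‖ + h * √(gradSq G x))) ^ 2) +
        (51 * h + 128 * κ⁻¹) * ((3 + 24 * K₂ / h ^ 2) * δ ^ 2) := by
  have hw' := hw.isTestOff hU
  set N := Hneg1norm h U (conjOp h W q w)
  have hN : 0 ≤ N := Hneg1norm_nonneg h U _
  obtain ⟨G₁, hG₁, hG⟩ := exists_approx_resolvent (U := U)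
    (aestronglyMeasurable_conjOp hs hW hqm hh.ne' hw')
    (integrable_norm_sq_conjOp hs hW hqm hq hh.ne' hw') h hδ
  have hu : IsTest U fun x => m x • w x - m x • G₁ x := (hw.smul_fun hm).sub (hG₁.smul_fun hm)
  obtain ⟨τ, hτδ, hτκ, hτ⟩ := (((tendsto_integral_dilQuot_sub_euler hs
      (hu.isTestOff hU)).eventually (gt_mem_nhds (by positivity : 0 < δ ^ 2))).and
    ((eventually_nhdsWithin_of_eventually_nhds
      (gt_mem_nhds (by positivity : 0 < 1 / (4 * κ)))).and
      (self_mem_nhdsWithin : Ioi (0 : ℝ) ∈ 𝓝[>] 0))).exists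
  replace hτ : 0 < τ := hτ
  have hκτ : κ * τ ≤ 1 / 4 := by
    rw [lt_div_iff₀ (by positivity)] at hτκ
    linarith
  have hM : ContDiff ℝ (⊤ : ℕ∞) fun x => ‖x‖ ^ 2 * invDensity s x * m x :=
    ((contDiff_norm_sq ℝ).mul hs.contDiff_invDensity).mul hm
  obtain ⟨Kτ, hKτ, hmult⟩ := exists_carlemanMult_bound hs hUd hM hmc.mul_left κ hτ.le
  set V := 2 * (K₁ * h1Inner h w w) + 2 * (K₁ * (N + δ) ^ 2)
  obtain ⟨G, hGt, hG₁₂, hGN, he⟩ := hG (min δ (δ / (√(Kτ * V) + 1)))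
    (lt_min hδ (by positivity)) (min_le_left _ _)
  refine ⟨G, hGt, hGN, ?_⟩
  have hv : IsTest U fun x => m x • w x - m x • G x := (hw.smul_fun hm).sub (hGt.smul_fun hm)
  have hGsq : h1Inner h G G ≤ (N + δ) ^ 2 := (Real.sqrt_le_left (by positivity)).1 hGN
  have hvV : h1Inner h (fun x => m x • w x - m x • G x) (fun x => m x • w x - m x • G x) ≤ V := by
    refine (h1Inner_sub_self_le h (hw.smul_fun hm) (hGt.smul_fun hm)).trans ?_
    have h1 := hsmul w hw
    have h2 := (hsmul G hGt).trans (mul_le_mul_of_nonneg_left hGsq hK₁.le)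
    simp only [V]
    linarith
  obtain ⟨hΨ, hΨV⟩ := hmult h hh hh1 _ hv
  have main := carleman_sub_resolvent_le hs hU hW hqm hq hm hmR hh hκ hτ hhκ hκτ hκs hC₂ hC₃ hC
    hlow hres hw hmw hGt he rfl rfl hΨ
  have h1 := integral_dilQuot_sub_euler_le hs (hu.isTestOff hU) (hv.isTestOff hU) hτ
  have h2 : h ^ 2 * ∫ x, invDensity s x * ‖euler (fun y => (m y • w y - m y • G y) -
      (m y • w y - m y • G₁ y)) x‖ ^ 2 ≤ K₂ * (4 * δ ^ 2) := by
    have e : (fun y => (m y • w y - m y • G y) - (m y • w y - m y • G₁ y)) =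
        fun y => m y • (G₁ - G) y := by
      funext y
      simp only [Pi.sub_apply, smul_sub]
      abel
    rw [e]
    refine (heuler _ (hG₁.sub hGt)).trans (mul_le_mul_of_nonneg_left ?_ hK₂.le)
    rw [h1Inner_sub_self_comm h hG₁ hGt]
    exact hG₁₂
  have h3 : ∫ x, invDensity s x * ‖euler (fun y => (m y • w y - m y • G y) -
      (m y • w y - m y • G₁ y)) x‖ ^ 2 ≤ 4 * K₂ / h ^ 2 * δ ^ 2 := by
    rw [div_mul_eq_mul_div, le_div_iff₀ (by positivity)]
    linarith
  have h4 : 3 * δ ^ 2 + 6 * (4 * K₂ / h ^ 2 * δ ^ 2) = (3 + 24 * K₂ / h ^ 2) * δ ^ 2 := by ring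
  have h5 := mul_le_mul_of_nonneg_left
    (h1.trans ((add_le_add (mul_le_mul_of_nonneg_left hτδ.le (by norm_num))
      (mul_le_mul_of_nonneg_left h3 (by norm_num))).trans_eq h4))
    (by positivity : 0 ≤ 51 * h + 128 * κ⁻¹)
  have h6 : min δ (δ / (√(Kτ * V) + 1)) * √(h1Inner h
      (fun x => (‖x‖ ^ 2 * invDensity s x * m x) •
        carlemanMult κ τ s (fun x => m x • w x - m x • G x) x)
      (fun x => (‖x‖ ^ 2 * invDensity s x * m x) •
        carlemanMult κ τ s (fun x => m x • w x - m x • G x) x)) ≤ δ := by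
    have g1 := Real.sqrt_le_sqrt (hΨV.trans (mul_le_mul_of_nonneg_left hvV hKτ.le))
    refine (mul_le_mul (min_le_right _ _) g1 (Real.sqrt_nonneg _) (by positivity)).trans ?_
    rw [div_mul_eq_mul_div, div_le_iff₀ (by positivity)]
    nlinarith [Real.sqrt_nonneg (Kτ * V)]
  have h7 : 0 ≤ κ / 64 * (h ^ 2 * ∫ x, invDensity s x * (‖x‖ ^ 2 *
      gradSq (fun x => m x • w x - m x • G x) x)) := by
    refine mul_nonneg (by positivity) (mul_nonneg (by positivity) (integral_nonneg fun x => ?_))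
    exact mul_nonneg (invDensity_pos s x).le (mul_nonneg (sq_nonneg _) (gradSq_nonneg _ x))
  linarith

end Conclusion

section Absorption

variable {d : ℕ} {c : ℝ} {s : Euc d → ℝ} {U : Set (Euc d)}

theorem IsTest.integral_invDensity_norm_sq_le (hs : IsLogRadius c s) (hU : ∀ x ∈ U, c < ‖x‖)
    (h : ℝ) {u : Euc d → ℂ} (hu : IsTest U u) :
    ∫ x, invDensity s x * ‖u x‖ ^ 2 ≤ Real.exp (-(d : ℝ) * Real.log c) * h1Inner h u u := by
  refine le_trans (b := Real.exp (-(d : ℝ) * Real.log c) * ∫ x, ‖u x‖ ^ 2) ?_ ?_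
  · rw [← integral_const_mul]
    refine integral_mono_of_nonneg
      (Eventually.of_forall fun x => mul_nonneg (invDensity_pos s x).le (sq_nonneg _))
      (hu.integrable_norm_sq.const_mul _) (Eventually.of_forall fun x => ?_)
    by_cases hx : x ∈ tsupport u
    · exact mul_le_mul_of_nonneg_right (hs.invDensity_le (hU x (hu.2.2 hx))) (sq_nonneg _)
    · simp [image_eq_zero_of_notMem_tsupport hx]
  · refine mul_le_mul_of_nonneg_left ?_ (Real.exp_pos _).le
    rw [h1Inner_self]
    have : 0 ≤ ∫ x, gradSq u x := integral_nonneg fun x => gradSq_nonneg u x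
    nlinarith [sq_nonneg h]

theorem IsTest.integral_invDensity_norm_add_sq_le (hs : IsLogRadius c s)
    (hU : ∀ x ∈ U, c < ‖x‖) (h C : ℝ) {u : Euc d → ℂ} (hu : IsTest U u) :
    ∫ x, invDensity s x * (C * (‖u x‖ + h * √(gradSq u x))) ^ 2 ≤
      2 * Real.exp (-(d : ℝ) * Real.log c) * C ^ 2 * h1Inner h u u := by
  have h1 : 2 * Real.exp (-(d : ℝ) * Real.log c) * C ^ 2 * h1Inner h u u =
      ∫ x, 2 * Real.exp (-(d : ℝ) * Real.log c) * C ^ 2 * (‖u x‖ ^ 2 + h ^ 2 * gradSq u x) := by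
    rw [integral_const_mul, h1Inner_self,
      integral_add hu.integrable_norm_sq (hu.integrable_gradSq.const_mul _), integral_const_mul]
  rw [h1]
  refine integral_mono_of_nonneg
    (Eventually.of_forall fun x => mul_nonneg (invDensity_pos s x).le (sq_nonneg _))
    ((hu.integrable_norm_sq.add (hu.integrable_gradSq.const_mul _)).const_mul _)
    (Eventually.of_forall fun x => ?_)
  have h2 : (C * (‖u x‖ + h * √(gradSq u x))) ^ 2 ≤
      2 * C ^ 2 * (‖u x‖ ^ 2 + h ^ 2 * gradSq u x) := by
    have h3 := Real.sq_sqrt (gradSq_nonneg u x)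
    have h4 : C ^ 2 * h ^ 2 * √(gradSq u x) ^ 2 = C ^ 2 * h ^ 2 * gradSq u x := by rw [h3]
    have h5 := mul_nonneg (sq_nonneg C) (sq_nonneg (‖u x‖ - h * √(gradSq u x)))
    linarith
  by_cases hx : x ∈ tsupport u
  · have h4 := mul_le_mul (hs.invDensity_le (hU x (hu.2.2 hx))) h2 (sq_nonneg _)
      (Real.exp_pos _).le
    simp only
    linarith
  · simp [image_eq_zero_of_notMem_tsupport hx, gradSq_eq_zero_of_notMem_tsupport hx]

theorem IsTest.mul_integral_norm_sq_le (hs : IsLogRadius c s) (hU : ∀ x ∈ U, c < ‖x‖)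
    {w G : Euc d → ℂ} (hw : IsTest U w) (hG : IsTest U G) {m : Euc d → ℝ}
    (hm : ContDiff ℝ (⊤ : ℕ∞) m) {j : ℝ} (hj : ∀ x ∈ tsupport w, j ≤ invDensity s x)
    (hm1 : ∀ x ∈ tsupport w, 1 ≤ m x) :
    j * ∫ x, ‖w x‖ ^ 2 ≤ 2 * (∫ x, invDensity s x * ‖m x • w x - m x • G x‖ ^ 2) +
      2 * ∫ x, invDensity s x * ‖m x • G x‖ ^ 2 := by
  have hGm := hG.smul_fun hm
  have hv : IsTest U fun x => m x • w x - m x • G x := (hw.smul_fun hm).sub hGm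
  have hJ := hs.contDiff_invDensity.continuous
  have i1 : Integrable fun x => invDensity s x * ‖m x • w x - m x • G x‖ ^ 2 :=
    (hv.isTestOff hU).integrable_of_continuous (hJ.mul (hv.1.continuous.norm.pow 2))
      fun x hx => by
        have h0 : m x • w x - m x • G x = 0 :=
          image_eq_zero_of_notMem_tsupport (f := fun y => m y • w y - m y • G y) hx
        rw [h0]
        simp
  have i2 : Integrable fun x => invDensity s x * ‖m x • G x‖ ^ 2 :=
    (hGm.isTestOff hU).integrable_of_continuous (hJ.mul (hGm.1.continuous.norm.pow 2))
      fun x hx => by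
        have h0 : m x • G x = 0 :=
          image_eq_zero_of_notMem_tsupport (f := fun y => m y • G y) hx
        rw [h0]
        simp
  rw [← integral_const_mul, ← integral_const_mul, ← integral_const_mul,
    ← integral_add (i1.const_mul _) (i2.const_mul _)]
  refine integral_mono (hw.integrable_norm_sq.const_mul _)
    ((i1.const_mul _).add (i2.const_mul _)) fun x => ?_
  have h1 : ‖m x • w x‖ ^ 2 ≤ 2 * ‖m x • w x - m x • G x‖ ^ 2 + 2 * ‖m x • G x‖ ^ 2 := by
    have h2 := norm_add_le (m x • w x - m x • G x) (m x • G x)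
    rw [sub_add_cancel] at h2
    nlinarith [sq_nonneg (‖m x • w x - m x • G x‖ - ‖m x • G x‖), norm_nonneg (m x • w x)]
  have h3 : j * ‖w x‖ ^ 2 ≤ invDensity s x * ‖m x • w x‖ ^ 2 := by
    by_cases hx : x ∈ tsupport w
    · have h7 : ‖w x‖ ≤ ‖m x • w x‖ := by
        rw [norm_smul, Real.norm_of_nonneg (zero_le_one.trans (hm1 x hx))]
        exact le_mul_of_one_le_left (norm_nonneg _) (hm1 x hx)
      exact mul_le_mul (hj x hx) (pow_le_pow_left₀ (norm_nonneg _) h7 2) (sq_nonneg _)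
        (invDensity_pos s x).le
    · simp [image_eq_zero_of_notMem_tsupport hx]
  have h8 := mul_le_mul_of_nonneg_left h1 (invDensity_pos s x).le
  simp only
  linarith

theorem exists_conjOp_estimate (hs : IsLogRadius c s) (hU : ∀ x ∈ U, c < ‖x‖)
    (hUd : ∀ τ : ℝ, 0 ≤ τ → ∀ x, Real.exp (-τ) • x ∈ U → x ∈ U)
    {W : Euc d → Euc d} (hW : ContDiff ℝ 2 W) {q : Euc d → ℂ} (hqm : Measurable q)
    (hq : ∃ M : ℝ, ∀ x, ‖q x‖ ≤ M) {R : ℝ} (hR : 0 < R) :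
    ∃ C > 0, ∃ h₀ > 0, ∀ h : ℝ, 0 < h → h ≤ h₀ → ∀ w : Euc d → ℂ, IsTest U w →
      (∀ x ∈ tsupport w, ‖x‖ ≤ R) →
      h ^ 2 * ∫ x, ‖w x‖ ^ 2 ≤ C * Hneg1norm h U (conjOp h W q w) ^ 2 := by
  let χ : ContDiffBump (0 : Euc d) := ⟨R, R + 1, hR, by linarith⟩
  have hR' : 0 < R + 1 := by linarith
  obtain ⟨M, hM⟩ := (isCompact_closedBall (0 : Euc d) (R + 1)).exists_bound_of_continuousOn
    hs.smooth.continuous.continuousOn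
  have hM0 : 0 ≤ M := (norm_nonneg _).trans (hM 0 (Metric.mem_closedBall_self hR'.le))
  obtain ⟨C₂, hC₂, hlow⟩ := exists_norm_lowerOp_le hs hW hq hR'
  set A := 1024 * C₂ ^ 2 + 1 with hA
  have hA1 : 1 ≤ A := by nlinarith
  have hA0 : 0 < A := by linarith
  set m : Euc d → ℝ := fun x => χ x * Real.exp (A / 2 * s x ^ 2) with hmdef
  have hm : ContDiff ℝ (⊤ : ℕ∞) m :=
    χ.contDiff.mul (contDiff_const.mul (hs.smooth.pow 2)).exp
  have hmc : HasCompactSupport m := χ.hasCompactSupport.mul_right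
  have hmR : ∀ x ∈ tsupport m, ‖x‖ ≤ R + 1 := fun x hx => by
    have h1 := closure_mono (Function.support_mul_subset_left _ _) hx
    rw [← tsupport, χ.tsupport_eq] at h1
    simpa using h1
  obtain ⟨C₃, hC₃, hres⟩ := exists_norm_resolvent_sub_le hs hW hq hR' hm hmc
  obtain ⟨K₁, hK₁, hsmul⟩ := exists_h1Inner_smul_le (U := U) hm hmc
  obtain ⟨K₂, hK₂, heuler⟩ := exists_integral_euler_smul_le (U := U) hs hm hmc
  set J₀ := Real.exp (-(d : ℝ) * Real.log c)
  have hJ₀ : 0 < J₀ := Real.exp_pos _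
  set j := Real.exp (-(d : ℝ) * M)
  have hj : 0 < j := Real.exp_pos _
  refine ⟨j⁻¹ * (2048 * J₀ * C₃ ^ 2 / A + 2 * J₀ * K₁), by positivity,
    1 / (32 * A * (M + 1)), by positivity, fun h hh hh₀ w hw hwR => ?_⟩
  rw [le_div_iff₀ (by positivity)] at hh₀
  have hAh : 0 < A * h := by positivity
  have hAM : 0 ≤ A * h * M := by positivity
  have hκ32 : A * h ≤ 1 / 32 := by linarith
  have hhκ : h ≤ A * h := le_mul_of_one_le_left hh.le hA1
  have hκs : ∀ x, c < ‖x‖ → ‖x‖ ≤ R + 1 → |A * h * s x| ≤ 1 / 4 := fun x _ hx => by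
    have h1 : |s x| ≤ M := hM x (by simpa using hx)
    rw [abs_mul, abs_of_pos hAh]
    have h2 := mul_le_mul_of_nonneg_left h1 hAh.le
    linarith
  have hmw : ∀ x ∈ tsupport w, m x = Real.exp (A * h / 2 * s x ^ 2 / h) := fun x hx => by
    have h1 : χ x = 1 := χ.one_of_mem_closedBall (by simpa using hwR x hx)
    simp only [hmdef, h1, one_mul]
    congr 1
    field_simp
  set N := Hneg1norm h U (conjOp h W q w)
  have hN : 0 ≤ N := Hneg1norm_nonneg h U _
  set E := j⁻¹ * (2 * (64 * h / A)) *
    (1 + (51 * h + 128 * (A * h)⁻¹) * (3 + 24 * K₂ / h ^ 2))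
  have key : ∀ δ : ℝ, 0 < δ → δ < 1 → h ^ 2 * ∫ x, ‖w x‖ ^ 2 ≤
      j⁻¹ * (2048 * J₀ * C₃ ^ 2 / A + 2 * J₀ * K₁) * (N + δ) ^ 2 + E * δ := by
    intro δ hδ hδ1
    obtain ⟨G, hG, hGN, hest⟩ := exists_resolvent_carleman_le hs hU hUd hW hqm hq hm hmc hmR hh
      (by linarith) hAh (by nlinarith) hκs hC₂.le hC₃.le
      (mul_le_mul_of_nonneg_right (by linarith) hh.le)
      (fun x hx hxR => hlow h (A * h) hh (by linarith) hAh (by linarith) x hx hxR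
        (hκs x hx hxR))
      (fun x hx hxR => hres h (A * h) hh (by linarith) hAh (by linarith) x hx hxR
        (hκs x hx hxR))
      hK₁ (hsmul h hh (by linarith)) hK₂ (heuler h hh (by linarith)) hw hmw hδ
    have hGsq : h1Inner h G G ≤ (N + δ) ^ 2 := (Real.sqrt_le_left (by positivity)).1 hGN
    have hGm := hG.smul_fun hm
    have hv : IsTest U fun x => m x • w x - m x • G x := (hw.smul_fun hm).sub hGm
    set X := ∫ x, invDensity s x * ‖m x • w x - m x • G x‖ ^ 2
    have hw2 := hw.mul_integral_norm_sq_le hs hU hG hm (j := j)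
      (fun x hx => by
        have h1 : |s x| ≤ M := hM x (by simpa using (hwR x hx).trans (by linarith))
        exact Real.exp_le_exp.2
          (mul_le_mul_of_nonpos_left (abs_le.1 h1).2 (neg_nonpos.2 (Nat.cast_nonneg d))))
      (fun x hx => by
        rw [hmw x hx]
        exact Real.one_le_exp (by positivity))
    have hG2 : ∫ x, invDensity s x * ‖m x • G x‖ ^ 2 ≤ J₀ * (K₁ * (N + δ) ^ 2) :=
      (hGm.integral_invDensity_norm_sq_le hs hU h).trans (mul_le_mul_of_nonneg_left
        ((hsmul h hh (by linarith) G hG).trans (mul_le_mul_of_nonneg_left hGsq hK₁.le)) hJ₀.le)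
    have hQ := (hG.integral_invDensity_norm_add_sq_le hs hU h C₃).trans
      (mul_le_mul_of_nonneg_left hGsq (by positivity))
    have hX : h ^ 2 * X ≤ 64 * h / A * (δ + 8 * h⁻¹ * (2 * J₀ * C₃ ^ 2 * (N + δ) ^ 2) +
        (51 * h + 128 * (A * h)⁻¹) * ((3 + 24 * K₂ / h ^ 2) * δ)) := by
      have h1 : h ^ 2 * X = 64 * h / A * (A * h / 64 * X) := by field_simp
      rw [h1]
      refine mul_le_mul_of_nonneg_left (hest.trans ?_) (by positivity)
      gcongr
      nlinarith
    have h1 : h ^ 2 * ∫ x, ‖w x‖ ^ 2 ≤ j⁻¹ * (2 * (h ^ 2 * X) + 2 * (J₀ * (K₁ * (N + δ) ^ 2))) := by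
      rw [inv_mul_eq_div, le_div_iff₀ hj]
      have h2 : h ^ 2 ≤ 1 := by nlinarith
      have h3 := mul_le_mul_of_nonneg_left (hw2.trans (add_le_add_right
        (mul_le_mul_of_nonneg_left hG2 zero_le_two) (2 * X))) (sq_nonneg h)
      have h4 := mul_le_mul_of_nonneg_right h2
        (by positivity : 0 ≤ 2 * (J₀ * (K₁ * (N + δ) ^ 2)))
      linarith
    refine (h1.trans (mul_le_mul_of_nonneg_left (add_le_add_left
      (mul_le_mul_of_nonneg_left hX zero_le_two) _) (inv_pos.2 hj).le)).trans_eq ?_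
    simp only [E]
    field_simp
    ring
  have hlim : Tendsto (fun δ : ℝ =>
      j⁻¹ * (2048 * J₀ * C₃ ^ 2 / A + 2 * J₀ * K₁) * (N + δ) ^ 2 + E * δ) (𝓝[>] 0)
      (𝓝 (j⁻¹ * (2048 * J₀ * C₃ ^ 2 / A + 2 * J₀ * K₁) * N ^ 2)) := by
    refine Tendsto.mono_left ?_ nhdsWithin_le_nhds
    exact Continuous.tendsto' (by fun_prop) _ _ (by simp)
  refine ge_of_tendsto hlim ?_
  filter_upwards [self_mem_nhdsWithin,
    eventually_nhdsWithin_of_eventually_nhds (gt_mem_nhds one_pos)] with δ h1 h2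
  exact key δ h1 h2

end Absorption

section Geometry

variable {d : ℕ}

theorem exists_isLogRadius {c : ℝ} (hc : 0 < c) : ∃ s : Euc d → ℝ, IsLogRadius c s := by
  let χ : ContDiffBump (0 : Euc d) := ⟨c / 2, c, half_pos hc, half_lt_self hc⟩
  have hpos : ∀ x : Euc d, 0 < ‖x‖ ^ 2 + χ x := fun x => by
    by_cases hx : x = 0
    · subst hx
      have h1 : χ (0 : Euc d) = 1 :=
        χ.one_of_mem_closedBall (Metric.mem_closedBall_self χ.rIn_pos.le)
      rw [h1]
      positivity
    · have := norm_pos_iff.2 hx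
      have := χ.nonneg' x
      positivity
  refine ⟨fun x => 1 / 2 * Real.log (‖x‖ ^ 2 + χ x), hc,
    contDiff_const.mul (((contDiff_norm_sq ℝ).add χ.contDiff).log fun x => (hpos x).ne'),
    fun x hx => ?_⟩
  have h1 : χ x = 0 := χ.zero_of_le_dist (by simpa using hx.le)
  simp only [h1, add_zero, Real.log_pow]
  push_cast
  ring

theorem inv_norm_smul_smul {t : ℝ} (ht : 0 < t) (x : Euc d) :
    ‖t • x‖⁻¹ • t • x = ‖x‖⁻¹ • x := by
  rw [norm_smul, Real.norm_of_nonneg ht.le, smul_smul, mul_inv]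
  congr 1
  field_simp

theorem exists_pos_le_of_continuousOn_compl_zero {f : Euc d → ℝ}
    (hf : ContinuousOn (fun x => f (‖x‖⁻¹ • x)) {x : Euc d | x ≠ 0})
    (hf_pos : ∀ x : Euc d, x ≠ 0 → 0 < f (‖x‖⁻¹ • x)) :
    ∃ c > 0, ∀ x : Euc d, x ≠ 0 → c ≤ f (‖x‖⁻¹ • x) := by
  have h0 : ∀ x ∈ Metric.sphere (0 : Euc d) 1, x ≠ 0 := fun x hx =>
    ne_zero_of_mem_unit_sphere ⟨x, hx⟩
  have h1 : ∀ x : Euc d, x ≠ 0 → ‖x‖⁻¹ • x ∈ Metric.sphere (0 : Euc d) 1 := fun x hx => by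
    rw [mem_sphere_zero_iff_norm]
    exact norm_smul_inv_norm (𝕜 := ℝ) hx
  obtain he | hne := (Metric.sphere (0 : Euc d) 1).eq_empty_or_nonempty
  · exact ⟨1, one_pos, fun x hx => absurd (h1 x hx) (by simp [he])⟩
  · obtain ⟨x₀, hx₀, hmin⟩ := (isCompact_sphere (0 : Euc d) 1).exists_isMinOn hne (hf.mono h0)
    refine ⟨_, hf_pos x₀ (h0 x₀ hx₀), fun x hx => ?_⟩
    have h2 := hmin (h1 x hx)
    have h3 := inv_norm_smul_smul (inv_pos.2 (norm_pos_iff.2 hx)) x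
    simp only [mem_ofPred_eq, h3] at h2
    exact h2

theorem subset_lt_norm_of_isOpen {f : Euc d → ℝ} {Ω : Set (Euc d)} (hΩ : IsOpen Ω)
    (hΩA : Ω ⊆ {x : Euc d | x ≠ 0 ∧ f (‖x‖⁻¹ • x) ≤ ‖x‖}) :
    Ω ⊆ {x : Euc d | x ≠ 0 ∧ f (‖x‖⁻¹ • x) < ‖x‖} := by
  intro x hx
  obtain ⟨hx0, hfx⟩ := hΩA hx
  refine ⟨hx0, hfx.lt_of_ne fun he => ?_⟩
  have h1 : Tendsto (fun t : ℝ => t • x) (𝓝[<] 1) (𝓝 x) :=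
    ((continuous_id.smul continuous_const).tendsto' 1 x (one_smul ℝ x)).mono_left
      nhdsWithin_le_nhds
  obtain ⟨t, ⟨ht, ht0⟩, ht1⟩ := (((h1.eventually (hΩ.mem_nhds hx)).and
    (eventually_nhdsWithin_of_eventually_nhds (lt_mem_nhds (zero_lt_one (α := ℝ))))).and
      self_mem_nhdsWithin).exists
  have h2 := (hΩA ht).2
  rw [inv_norm_smul_smul ht0, he, norm_smul, Real.norm_of_nonneg ht0.le] at h2
  have h3 := norm_pos_iff.2 hx0
  have h4 : t < 1 := ht1
  nlinarith

theorem IsTest.L2normOn_eq {U : Set (Euc d)} {w : Euc d → ℂ} (hw : IsTest U w) :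
    L2normOn U w = √(∫ x, ‖w x‖ ^ 2) := by
  rw [L2normOn, setIntegral_eq_integral_of_forall_compl_eq_zero fun x hx => ?_]
  simp [image_eq_zero_of_notMem_tsupport fun h => hx (hw.2.2 h)]

end Geometry

/-- Carleman estimate for the conjugated magnetic Schrödinger operator with logarithmic
weight (Proposition 2.1 / Theorem 1.4-type statement). -/
theorem stmt1 (n : ℕ) (hn : 2 ≤ n)
    (f : Euc (n + 1) → ℝ)
    (hf_smooth : ContDiffOn ℝ (⊤ : ℕ∞) (fun x => f (‖x‖⁻¹ • x)) {x : Euc (n + 1) | x ≠ 0})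
    (hf_pos : ∀ x : Euc (n + 1), x ≠ 0 → 0 < f (‖x‖⁻¹ • x))
    (Ω : Set (Euc (n + 1))) (hΩopen : IsOpen Ω) (hΩbdd : Bornology.IsBounded Ω)
    (hΩA : Ω ⊆ {x : Euc (n + 1) | x ≠ 0 ∧ f (‖x‖⁻¹ • x) ≤ ‖x‖})
    (hx0 : (0 : Euc (n + 1)) ∉ closure (convexHull ℝ Ω))
    (W : Euc (n + 1) → Euc (n + 1)) (hW : ContDiff ℝ 2 W)
    (q : Euc (n + 1) → ℂ) (hq_meas : Measurable q) (hq_bdd : ∃ M : ℝ, ∀ x, ‖q x‖ ≤ M) :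
    ∃ C > (0 : ℝ), ∃ h₀ > (0 : ℝ),
      ∀ h ∈ Set.Ioc (0 : ℝ) h₀, ∀ w : Euc (n + 1) → ℂ, IsTest Ω w →
        h * L2normOn Ω w ≤
          C * Hneg1norm h {x : Euc (n + 1) | x ≠ 0 ∧ f (‖x‖⁻¹ • x) < ‖x‖}
            (conjOp h W q w) := by
  obtain ⟨c, hc, hcf⟩ := exists_pos_le_of_continuousOn_compl_zero hf_smooth.continuousOn hf_pos
  obtain ⟨s, hs⟩ := exists_isLogRadius (d := n + 1) hc
  obtain ⟨R, hR, hΩR⟩ := hΩbdd.exists_pos_norm_le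
  have hΩU := subset_lt_norm_of_isOpen hΩopen hΩA
  set U := {x : Euc (n + 1) | x ≠ 0 ∧ f (‖x‖⁻¹ • x) < ‖x‖}
  have hUd : ∀ τ : ℝ, 0 ≤ τ → ∀ x, Real.exp (-τ) • x ∈ U → x ∈ U := by
    rintro τ hτ x ⟨h1, h2⟩
    rw [inv_norm_smul_smul (Real.exp_pos _), norm_smul, Real.norm_of_nonneg (Real.exp_pos _).le]
      at h2
    exact ⟨(smul_ne_zero_iff.1 h1).2, h2.trans_le
      (mul_le_of_le_one_left (norm_nonneg _) (Real.exp_le_one_iff.2 (neg_nonpos.2 hτ)))⟩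
  obtain ⟨C, hC, h₀, hh₀, hest⟩ := exists_conjOp_estimate hs
    (fun x hx => (hcf x hx.1).trans_lt hx.2) hUd hW hq_meas hq_bdd hR
  refine ⟨√C, Real.sqrt_pos.2 hC, h₀, hh₀, fun h hh w hw => ?_⟩
  have h1 := hest h hh.1 hh.2 w ⟨hw.1, hw.2.1, hw.2.2.trans hΩU⟩ fun x hx => hΩR x (hw.2.2 hx)
  have h2 := Real.sqrt_le_sqrt h1
  rwa [Real.sqrt_mul (sq_nonneg h), Real.sqrt_sq hh.1.le, Real.sqrt_mul hC.le,
    Real.sqrt_sq (Hneg1norm_nonneg h U _), ← hw.L2normOn_eq] at h2
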